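/- Let Ω ⊂ ℝ² be a bounded strictly convex open set with smooth boundary of strictly positive curvature. Let f : ℝ → ℝ be real analytic and nondecreasing, and let u be a positive solution of the Dirichlet problem div(∇u/√(1+|∇u|²)) = f(u) in Ω, u = 0 on ∂Ω, which is real analytic in Ω and C² up to the closure of Ω. Then u has exactly one critical point in Ω and this critical point is nondegenerate: there is a unique x₀ ∈ Ω with ∇u(x₀) = 0, and the Hessian matrix D²u(x₀) is invertible. -/

import Mathlib

open Set Metric

noncomputable section

/-- The coefficients `a_{ij}(p) = (1+|p|²)^{-1/2}(δ_{ij} − pᵢpⱼ/(1+|p|²))`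
of the mean curvature operator. -/
def mcCoeff {n : ℕ} (p : EuclideanSpace ℝ (Fin n)) (i j : Fin n) : ℝ :=
  (Real.sqrt (1 + ‖p‖ ^ 2))⁻¹ * ((if i = j then 1 else 0) - p i * p j / (1 + ‖p‖ ^ 2))

/-- Second partial derivative `∂²u/∂xᵢ∂xⱼ`. -/
def hessEntry {n : ℕ} (u : EuclideanSpace ℝ (Fin n) → ℝ) (x : EuclideanSpace ℝ (Fin n))
    (i j : Fin n) : ℝ :=
  iteratedFDeriv ℝ 2 u x ![EuclideanSpace.single i 1, EuclideanSpace.single j 1]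

/-- The Hessian matrix `D²u(x)`. -/
def hessMatrix {n : ℕ} (u : EuclideanSpace ℝ (Fin n) → ℝ) (x : EuclideanSpace ℝ (Fin n)) :
    Matrix (Fin n) (Fin n) ℝ :=
  Matrix.of fun i j => hessEntry u x i j

/-- The mean curvature operator `L u = div(∇u/√(1+|∇u|²)) = Σ a_{ij}(∇u) ∂²u/∂xᵢ∂xⱼ`. -/
def meanCurv {n : ℕ} (u : EuclideanSpace ℝ (Fin n) → ℝ) (x : EuclideanSpace ℝ (Fin n)) : ℝ :=
  ∑ i, ∑ j, mcCoeff (gradient u x) i j * hessEntry u x i j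

/-- A solution of the Dirichlet problem `L u = f(u)` in `Ω`, `u = 0` on `∂Ω`:
`u ∈ C²(Ω) ∩ C(closure Ω)`. -/
def IsMCSolution {n : ℕ} (Ω : Set (EuclideanSpace ℝ (Fin n))) (f : ℝ → ℝ)
    (u : EuclideanSpace ℝ (Fin n) → ℝ) : Prop :=
  ContDiffOn ℝ 2 u Ω ∧ ContinuousOn u (closure Ω) ∧
    (∀ x ∈ Ω, meanCurv u x = f (u x)) ∧ (∀ x ∈ frontier Ω, u x = 0)

/-- `Ω ⊆ ℝ²` has smooth boundary of strictly positive curvature: the boundary is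
parametrized by a smooth periodic regular curve with positive signed curvature. -/
def SmoothPosCurvBoundary (Ω : Set (EuclideanSpace ℝ (Fin 2))) : Prop :=
  ∃ T > (0:ℝ), ∃ γ : ℝ → EuclideanSpace ℝ (Fin 2),
    ContDiff ℝ (⊤ : ℕ∞) γ ∧ Function.Periodic γ T ∧ range γ = frontier Ω ∧
    ∀ t : ℝ, deriv γ t ≠ 0 ∧
      0 < deriv γ t 0 * deriv (deriv γ) t 1 - deriv γ t 1 * deriv (deriv γ) t 0

/-- A nonvanishing continuous function on a convex set has a continuous logarithm. -/
theorem exists_continuousOn_log_of_convex {E : Type*} [NormedAddCommGroup E] [NormedSpace ℝ E]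
    {U : Set E} (hU : Convex ℝ U) {g : E → ℂ} (hgc : ContinuousOn g U)
    (hg0 : ∀ x ∈ U, g x ≠ 0) :
    ∃ l : E → ℂ, ContinuousOn l U ∧ ∀ x ∈ U, Complex.exp (l x) = g x := by
  classical
  rcases U.eq_empty_or_nonempty with rfl | hne
  · exact ⟨0, continuousOn_empty _, by simp⟩
  have := hU.contractibleSpace hne
  have := hU.locallyPathConnectedSpace
  obtain ⟨x₀, hx₀U⟩ := hne
  have hx₀ : g x₀ ≠ 0 := hg0 x₀ hx₀U
  lift x₀ to U using hx₀U
  rcases Complex.isCoveringMapOn_exp.existsUnique_continuousMap_lifts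
    ⟨U.domRestrict g, continuousOn_iff_continuous_domRestrict.mp hgc⟩ (Complex.exp_log hx₀)
    (fun x ↦ hg0 x x.2) with ⟨f, ⟨-, hf⟩, -⟩
  obtain ⟨l, hl⟩ : ∃ l : E → ℂ, ∀ z : U, l z = f z :=
    ⟨fun z ↦ if hz : z ∈ U then f ⟨z, hz⟩ else 0, by simp⟩
  refine ⟨l, ?_, ?_⟩
  · rw [continuousOn_iff_continuous_domRestrict]
    convert! map_continuous f
    ext z
    exact hl z
  · intro x hx
    lift x to U using hx
    simpa [hl] using congrFun hf x

/-- Two continuous logarithms of the same function on a preconnected set differ by a constant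
multiple of `2πi`. -/
theorem IsPreconnected.exists_int_im_eq_of_exp_eq {X : Type*} [TopologicalSpace X]
    {S : Set X} (hS : IsPreconnected S) {l₁ l₂ : X → ℂ} (h₁ : ContinuousOn l₁ S)
    (h₂ : ContinuousOn l₂ S) (h : ∀ x ∈ S, Complex.exp (l₁ x) = Complex.exp (l₂ x)) :
    ∃ n : ℤ, ∀ x ∈ S, (l₁ x).im = (l₂ x).im + n * (2 * Real.pi) := by
  rcases S.eq_empty_or_nonempty with rfl | ⟨x₀, hx₀⟩
  · exact ⟨0, by simp⟩
  have key : ∀ x ∈ S, ∃ n : ℤ, l₁ x = l₂ x + n * (2 * Real.pi * Complex.I) := fun x hx =>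
    Complex.exp_eq_exp_iff_exists_int.1 (h x hx)
  choose! n hn using key
  have hnim : ∀ x ∈ S, (l₁ x).im = (l₂ x).im + n x * (2 * Real.pi) := by
    intro x hx
    rw [hn x hx]; simp
  have hnc : ContinuousOn n S := by
    have h1 : ContinuousOn (fun x => ((n x : ℤ) : ℝ)) S := by
      have : ContinuousOn (fun x => ((l₁ x).im - (l₂ x).im) / (2 * Real.pi)) S :=
        ((Complex.continuous_im.comp_continuousOn h₁).sub
          (Complex.continuous_im.comp_continuousOn h₂)).div_const _
      refine this.congr fun x hx => ?_
      simp only [hnim x hx]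
      field_simp
      ring
    exact (Int.isClosedEmbedding_coe_real.isInducing.continuousOn_iff).2 h1
  refine ⟨n x₀, fun x hx => ?_⟩
  rw [hnim x hx, hS.constant hnc hx hx₀]

/-- The angle swept by a continuous logarithm around a corner at which the function is a positive
combination of two directions. -/
theorem im_sub_im_of_corner {l : ℝ → ℝ → ℂ} {ε a b c c' : ℝ} (hc : 0 < c)
    (hc' : 0 < c') (hab : |a - b| < Real.pi)
    (hl : ContinuousOn (fun z : ℝ × ℝ => l z.1 z.2)
      {z | z ∈ Icc (0 : ℝ) ε ×ˢ Icc (0 : ℝ) ε ∧ 0 < z.1 + z.2})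
    (hexp : ∀ s ∈ Icc 0 ε, ∀ t ∈ Icc 0 ε, 0 < s + t →
      Complex.exp (l s t) = (s * c : ℝ) * Complex.exp (a * Complex.I)
        + (t * c' : ℝ) * Complex.exp (b * Complex.I)) :
    ∀ s ∈ Ioc 0 ε, ∀ t ∈ Ioc 0 ε, (l s 0).im - (l 0 t).im = a - b := by
  intro s hs t ht
  have hε : 0 < ε := hs.1.trans_le hs.2
  set S : Set (ℝ × ℝ) := {z | z ∈ Icc (0 : ℝ) ε ×ˢ Icc (0 : ℝ) ε ∧ 0 < z.1 + z.2} with hS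
  have hSc : Convex ℝ S := by
    refine ((convex_Icc 0 ε).prod (convex_Icc 0 ε)).inter ?_
    have := convex_halfSpace_gt (𝕜 := ℝ) (E := ℝ × ℝ) (f := fun z => z.1 + z.2)
      ((LinearMap.fst ℝ ℝ ℝ + LinearMap.snd ℝ ℝ ℝ).isLinear) 0
    have h2 : Convex ℝ {w : ℝ × ℝ | 0 < w.1 + w.2} := by simpa using this
    exact h2
  set μ : ℝ := (a + b) / 2 with hμ
  set d : ℝ := (a - b) / 2 with hd
  have hdlt : |d| < Real.pi / 2 := by rw [hd, abs_div, abs_two]; linarith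
  have hcos : 0 < Real.cos d := Real.cos_pos_of_mem_Ioo (abs_lt.1 hdlt)
  set F : ℝ × ℝ → ℂ := fun z => (z.1 * c : ℝ) * Complex.exp (d * Complex.I)
        + (z.2 * c' : ℝ) * Complex.exp ((-d : ℝ) * Complex.I) with hF
  have hFre : ∀ z ∈ S, 0 < (F z).re := by
    intro z hz
    have h1 := hz.1.1.1
    have h2 := hz.1.2.1
    have h3 := hz.2
    simp only [hF, Complex.add_re, Complex.re_ofReal_mul, Complex.exp_ofReal_mul_I_re,
      Real.cos_neg]
    rcases h1.lt_or_eq with h | h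
    · have : 0 ≤ z.2 * c' * Real.cos d := by positivity
      have : 0 < z.1 * c * Real.cos d := by positivity
      linarith
    · have hz2 : 0 < z.2 := by linarith
      have : 0 ≤ z.1 * c * Real.cos d := by positivity
      have : 0 < z.2 * c' * Real.cos d := by positivity
      linarith
  have hFc : Continuous F := by fun_prop
  have hl2 : ContinuousOn (fun z => Complex.log (F z) + μ * Complex.I) S :=
    (hFc.continuousOn.clog fun z hz => Or.inl (hFre z hz)).add continuousOn_const
  obtain ⟨n, hn⟩ := hSc.isPreconnected.exists_int_im_eq_of_exp_eq hl hl2 (by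
    intro z hz
    have hF0 : F z ≠ 0 := fun h => by have := hFre z hz; rw [h] at this; simp at this
    rw [hexp z.1 hz.1.1 z.2 hz.1.2 hz.2, Complex.exp_add, Complex.exp_log hF0, hF]
    simp only [add_mul, mul_assoc, ← Complex.exp_add]
    congr 3 <;> simp only [hμ, hd] <;> push_cast <;> ring)
  have e1 := hn (s, 0) ⟨⟨⟨hs.1.le, hs.2⟩, ⟨le_rfl, hε.le⟩⟩, by simpa using hs.1⟩
  have e2 := hn (0, t) ⟨⟨⟨le_rfl, hε.le⟩, ⟨ht.1.le, ht.2⟩⟩, by simpa using ht.1⟩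
  have a1 : Complex.arg (F (s, 0)) = d := by
    simp only [hF, zero_mul, Complex.ofReal_zero, add_zero]
    rw [Complex.arg_real_mul _ (mul_pos hs.1 hc), Complex.arg_exp_mul_I,
      toIocMod_eq_self]
    constructor <;> linarith [abs_lt.1 hdlt, Real.pi_pos]
  have a2 : Complex.arg (F (0, t)) = -d := by
    simp only [hF, zero_mul, Complex.ofReal_zero, zero_add]
    rw [Complex.arg_real_mul _ (mul_pos ht.1 hc'), Complex.arg_exp_mul_I,
      toIocMod_eq_self]
    constructor <;> linarith [abs_lt.1 hdlt, Real.pi_pos]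
  simp only [Complex.add_im, Complex.log_im, a1, a2] at e1 e2
  rw [e1, e2, hd]
  simp

/-- `γ` leaves `p` and arrives at `q` along straight rays of directions `e^{iα}` and `e^{iβ}`. -/
def IsRayEnded (γ : ℝ → ℂ) (p q : ℂ) (α β c : ℝ) : Prop :=
  0 < c ∧ Continuous γ ∧ ∀ s ∈ Icc (0 : ℝ) (1 / 3),
    γ s = p + (s * c : ℝ) * Complex.exp (α * Complex.I) ∧
    γ (1 - s) = q + (s * c : ℝ) * Complex.exp (β * Complex.I)

/-- `B` is the sum of the arguments of `γ 1 - p` and `γ 0 - q`, continued along `γ` from the value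
`α` they take near the ends of `γ`. -/
def HasTurn (γ : ℝ → ℂ) (p q : ℂ) (α B : ℝ) : Prop :=
  ∃ l m : ℝ → ℂ, ContinuousOn l (Ioc 0 1) ∧ ContinuousOn m (Ico 0 1) ∧
    (∀ s ∈ Ioc (0 : ℝ) 1, Complex.exp (l s) = γ s - p) ∧
    (∀ s ∈ Ico (0 : ℝ) 1, Complex.exp (m s) = γ s - q) ∧
    (l (1 / 3)).im = α ∧ (m (2 / 3)).im = α ∧ B = (l 1).im + (m 0).im

theorem exists_log_im_eq {U : Set ℝ} (hU : Convex ℝ U) {g : ℝ → ℂ} (hgc : ContinuousOn g U)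
    (hg0 : ∀ x ∈ U, g x ≠ 0) {x₀ α r : ℝ} (hx₀ : x₀ ∈ U) (hr : 0 < r)
    (hα : g x₀ = r * Complex.exp (α * Complex.I)) :
    ∃ l : ℝ → ℂ, ContinuousOn l U ∧ (∀ x ∈ U, Complex.exp (l x) = g x) ∧ (l x₀).im = α := by
  obtain ⟨l, hl, hle⟩ := exists_continuousOn_log_of_convex hU hgc hg0
  have h1 : Complex.exp (l x₀) = Complex.exp (Real.log r + α * Complex.I) := by
    rw [hle x₀ hx₀, hα, Complex.exp_add, ← Complex.ofReal_exp, Real.exp_log hr]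
  obtain ⟨n, hn⟩ := Complex.exp_eq_exp_iff_exists_int.1 h1
  refine ⟨fun x => l x - n * (2 * Real.pi * Complex.I), hl.sub continuousOn_const,
    fun x hx => ?_, ?_⟩
  · rw [Complex.exp_sub, Complex.exp_int_mul_two_pi_mul_I, div_one, hle x hx]
  · simp [hn]

theorem IsRayEnded.exists_hasTurn {γ : ℝ → ℂ} {p q : ℂ} {α c : ℝ}
    (hγ : IsRayEnded γ p q α α c) (hp : ∀ s ∈ Ioc (0 : ℝ) 1, γ s ≠ p)
    (hq : ∀ s ∈ Ico (0 : ℝ) 1, γ s ≠ q) : ∃ B, HasTurn γ p q α B := by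
  obtain ⟨hc, hγc, hr⟩ := hγ
  have h3 := hr (1 / 3) (by norm_num)
  obtain ⟨l, hl, hle, hl0⟩ := exists_log_im_eq (convex_Ioc (0 : ℝ) 1)
    (g := fun s => γ s - p) (by fun_prop) (fun s hs => sub_ne_zero.2 (hp s hs))
    (x₀ := 1 / 3) (α := α) (r := 1 / 3 * c) (by norm_num) (by positivity)
    (by simp only [h3.1, add_sub_cancel_left])
  obtain ⟨m, hm, hme, hm0⟩ := exists_log_im_eq (convex_Ico (0 : ℝ) 1)
    (g := fun s => γ s - q) (by fun_prop) (fun s hs => sub_ne_zero.2 (hq s hs))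
    (x₀ := 2 / 3) (α := α) (r := 1 / 3 * c) (by norm_num) (by positivity)
    (by have := h3.2
        norm_num at this ⊢
        simp only [this, add_sub_cancel_left])
  exact ⟨_, l, m, hl, hm, hle, hme, hl0, hm0, rfl⟩

theorem convex_square_inter {P : ℝ × ℝ → Prop} (hP : Convex ℝ {z | P z}) :
    Convex ℝ {z : ℝ × ℝ | z ∈ Icc (0 : ℝ) 1 ×ˢ Icc (0 : ℝ) 1 ∧ P z} :=
  ((convex_Icc (0 : ℝ) 1).prod (convex_Icc (0 : ℝ) 1)).inter hP

theorem HasTurn.eq_add_two_pi {γ δ : ℝ → ℂ} {p q : ℂ} {α β c c' B B' : ℝ}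
    (hγ : IsRayEnded γ p q α α c) (hδ : IsRayEnded δ p q β β c')
    (hB : HasTurn γ p q α B) (hB' : HasTurn δ p q β B')
    (hab : |α - (β - Real.pi)| < Real.pi)
    (hne : ∀ s ∈ Icc (0 : ℝ) 1, ∀ t ∈ Icc (0 : ℝ) 1, 0 < s + t → s + t < 2 → γ s ≠ δ t) :
    B' = B + 2 * Real.pi := by
  obtain ⟨hc, hγc, hγr⟩ := hγ
  obtain ⟨hc', hδc, hδr⟩ := hδ
  obtain ⟨l, m, hl, hm, hle, hme, hl0, hm0, rfl⟩ := hB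
  obtain ⟨l', m', hl', hm', hle', hme', hl0', hm0', rfl⟩ := hB'
  have h0 : γ 0 = p := by simpa using (hγr 0 (by norm_num)).1
  have h1 : γ 1 = q := by simpa using (hγr 0 (by norm_num)).2
  have k0 : δ 0 = p := by simpa using (hδr 0 (by norm_num)).1
  have k1 : δ 1 = q := by simpa using (hδr 0 (by norm_num)).2
  have hconv : Convex ℝ {z : ℝ × ℝ | z ∈ Icc (0 : ℝ) 1 ×ˢ Icc (0 : ℝ) 1 ∧
      (0 < z.1 + z.2 ∧ z.1 + z.2 < 2)} := by
    have hlin := (LinearMap.fst ℝ ℝ ℝ + LinearMap.snd ℝ ℝ ℝ).isLinear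
    have c1 : Convex ℝ {w : ℝ × ℝ | 0 < w.1 + w.2} := by
      simpa using convex_halfSpace_gt hlin 0
    have c2 : Convex ℝ {w : ℝ × ℝ | w.1 + w.2 < 2} := by
      simpa using convex_halfSpace_lt hlin 2
    exact convex_square_inter (c1.inter c2)
  obtain ⟨L, hL, hLe⟩ := exists_continuousOn_log_of_convex hconv
    (g := fun z : ℝ × ℝ => γ z.1 - δ z.2) (by fun_prop)
    (fun z hz => sub_ne_zero.2 (hne _ hz.1.1 _ hz.1.2 hz.2.1 hz.2.2))
  have hpi : Complex.exp (Real.pi * Complex.I) = -1 := Complex.exp_pi_mul_I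
  obtain ⟨n1, e1⟩ := (isPreconnected_Ioc (a := (0 : ℝ)) (b := 1)).exists_int_im_eq_of_exp_eq
    (l₁ := fun s => L (s, 0)) (hL.comp (by fun_prop) (fun s hs =>
      ⟨⟨⟨hs.1.le, hs.2⟩, ⟨le_rfl, zero_le_one⟩⟩, by simpa using hs.1, by
        have := hs.2; simp; linarith⟩)) hl (fun s hs => by
      rw [hle s hs, hLe (s, 0) ⟨⟨⟨hs.1.le, hs.2⟩, ⟨le_rfl, zero_le_one⟩⟩, by simpa using hs.1, by
        have := hs.2; simp; linarith⟩, k0])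
  obtain ⟨n2, e2⟩ := (isPreconnected_Ioc (a := (0 : ℝ)) (b := 1)).exists_int_im_eq_of_exp_eq
    (l₁ := fun s => L (0, s)) (hL.comp (by fun_prop) (fun s hs =>
      ⟨⟨⟨le_rfl, zero_le_one⟩, ⟨hs.1.le, hs.2⟩⟩, by simpa using hs.1, by
        have := hs.2; simp; linarith⟩)) (hl'.add (continuousOn_const (c := Real.pi * Complex.I)))
      (fun s hs => by
      rw [Pi.add_apply, Complex.exp_add, hle' s hs, hLe (0, s) ⟨⟨⟨le_rfl, zero_le_one⟩, ⟨hs.1.le, hs.2⟩⟩,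
        by simpa using hs.1, by have := hs.2; simp; linarith⟩, h0, hpi]
      ring)
  obtain ⟨n3, e3⟩ := (isPreconnected_Ico (a := (0 : ℝ)) (b := 1)).exists_int_im_eq_of_exp_eq
    (l₁ := fun s => L (1, s)) (hL.comp (by fun_prop) (fun s hs =>
      ⟨⟨⟨zero_le_one, le_rfl⟩, ⟨hs.1, hs.2.le⟩⟩, by have := hs.1; simp; linarith, by
        have := hs.2; simp; linarith⟩)) (hm'.add (continuousOn_const (c := Real.pi * Complex.I)))
      (fun s hs => by
      rw [Pi.add_apply, Complex.exp_add, hme' s hs, hLe (1, s) ⟨⟨⟨zero_le_one, le_rfl⟩, ⟨hs.1, hs.2.le⟩⟩,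
        by have := hs.1; simp; linarith, by have := hs.2; simp; linarith⟩, h1, hpi]
      ring)
  obtain ⟨n4, e4⟩ := (isPreconnected_Ico (a := (0 : ℝ)) (b := 1)).exists_int_im_eq_of_exp_eq
    (l₁ := fun s => L (s, 1)) (hL.comp (by fun_prop) (fun s hs =>
      ⟨⟨⟨hs.1, hs.2.le⟩, ⟨zero_le_one, le_rfl⟩⟩, by have := hs.1; simp; linarith, by
        have := hs.2; simp; linarith⟩)) hm (fun s hs => by
      rw [hme s hs, hLe (s, 1) ⟨⟨⟨hs.1, hs.2.le⟩, ⟨zero_le_one, le_rfl⟩⟩,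
        by have := hs.1; simp; linarith, by have := hs.2; simp; linarith⟩, k1])
  have hneg : Complex.exp ((β - Real.pi : ℝ) * Complex.I) = -Complex.exp (β * Complex.I) := by
    push_cast
    rw [sub_mul, Complex.exp_sub, hpi, div_neg, div_one]
  have third : (1 / 3 : ℝ) ∈ Ioc (0 : ℝ) (1 / 3) := by norm_num
  have c00 := im_sub_im_of_corner (l := fun s t => L (s, t)) (ε := 1 / 3) hc hc' hab
    (hL.mono fun z hz => ⟨⟨⟨hz.1.1.1, hz.1.1.2.trans (by norm_num)⟩,
      ⟨hz.1.2.1, hz.1.2.2.trans (by norm_num)⟩⟩, hz.2, by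
        have := hz.1.1.2; have := hz.1.2.2; linarith⟩)
    (fun s hs t ht hst => by
      rw [hLe (s, t) ⟨⟨⟨hs.1, hs.2.trans (by norm_num)⟩,
      ⟨ht.1, ht.2.trans (by norm_num)⟩⟩, hst, by
        have := hs.2; have := ht.2; simp only; linarith⟩, hneg]
      simp only [(hγr s hs).1, (hδr t ht).1]
      ring) _ third _ third
  have c11 := im_sub_im_of_corner (l := fun s t => L (1 - s, 1 - t)) (ε := 1 / 3) hc hc' hab
    (hL.comp (f := fun z : ℝ × ℝ => (1 - z.1, 1 - z.2)) (by fun_prop) fun z hz =>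
      ⟨⟨⟨by have := hz.1.1.2; simp only; linarith, by have := hz.1.1.1; simp only; linarith⟩,
      ⟨by have := hz.1.2.2; simp only; linarith, by have := hz.1.2.1; simp only; linarith⟩⟩,
      by have := hz.1.1.2; have := hz.1.2.2; simp only; linarith,
      by have := hz.2; simp only; linarith⟩)
    (fun s hs t ht hst => by
      rw [hLe (1 - s, 1 - t)
        ⟨⟨⟨by have := hs.2; simp only; linarith, by have := hs.1; simp only; linarith⟩,
      ⟨by have := ht.2; simp only; linarith, by have := ht.1; simp only; linarith⟩⟩,
      by have := hs.2; have := ht.2; simp only; linarith,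
      by simp only; linarith⟩, hneg]
      simp only [(hγr s hs).2, (hδr t ht).2]
      ring) _ third _ third
  have a1 := e1 (1 / 3) (by norm_num)
  have a2 := e2 (1 / 3) (by norm_num)
  have a3 := e3 (2 / 3) (by norm_num)
  have a4 := e4 (2 / 3) (by norm_num)
  have b1 := e1 1 (by norm_num)
  have b2 := e2 1 (by norm_num)
  have b3 := e3 0 (by norm_num)
  have b4 := e4 0 (by norm_num)
  norm_num [Pi.add_apply] at c00 c11 a1 a2 a3 a4 b1 b2 b3 b4 hl0 hm0 hl0' hm0'
  linarith

theorem exp_sub_pi_mul_I (β : ℝ) :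
    Complex.exp ((β - Real.pi : ℝ) * Complex.I) = -Complex.exp (β * Complex.I) := by
  push_cast
  rw [sub_mul, Complex.exp_sub, Complex.exp_pi_mul_I, div_neg, div_one]

theorem exp_add_pi_mul_I (β : ℝ) :
    Complex.exp ((β + Real.pi : ℝ) * Complex.I) = -Complex.exp (β * Complex.I) := by
  push_cast
  rw [add_mul, Complex.exp_add, Complex.exp_pi_mul_I, mul_neg, mul_one]

/-- Two loops at `x₀` whose end directions interlace must cross. -/
theorem IsRayEnded.false_of_interlace {γ δ : ℝ → ℂ} {x₀ : ℂ} {α₁ α₂ α₃ α₄ c c' : ℝ}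
    (hγ : IsRayEnded γ x₀ x₀ α₁ α₃ c) (hδ : IsRayEnded δ x₀ x₀ α₂ α₄ c')
    (h₁₂ : α₁ < α₂) (h₂₃ : α₂ < α₃) (h₃₄ : α₃ < α₄) (h₄₁ : α₄ < α₁ + 2 * Real.pi)
    (hne : ∀ s ∈ Icc (0 : ℝ) 1, ∀ t ∈ Icc (0 : ℝ) 1, 0 < s + t → s + t < 2 → s < 1 + t →
      t < 1 + s → γ s ≠ δ t) : False := by
  obtain ⟨hc, hγc, hγr⟩ := hγ
  obtain ⟨hc', hδc, hδr⟩ := hδ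
  have h0 : γ 0 = x₀ := by simpa using (hγr 0 (by norm_num)).1
  have h1 : γ 1 = x₀ := by simpa using (hγr 0 (by norm_num)).2
  have k0 : δ 0 = x₀ := by simpa using (hδr 0 (by norm_num)).1
  have k1 : δ 1 = x₀ := by simpa using (hδr 0 (by norm_num)).2
  set S : Set (ℝ × ℝ) := {z : ℝ × ℝ | z ∈ Icc (0 : ℝ) 1 ×ˢ Icc (0 : ℝ) 1 ∧
      (0 < z.1 + z.2 ∧ z.1 + z.2 < 2 ∧ z.1 - z.2 < 1 ∧ -1 < z.1 - z.2)} with hSdef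
  have hconv : Convex ℝ S := by
    have hlin := (LinearMap.fst ℝ ℝ ℝ + LinearMap.snd ℝ ℝ ℝ).isLinear
    have hlin' := (LinearMap.fst ℝ ℝ ℝ - LinearMap.snd ℝ ℝ ℝ).isLinear
    have c1 : Convex ℝ {w : ℝ × ℝ | 0 < w.1 + w.2} := by
      simpa using convex_halfSpace_gt hlin 0
    have c2 : Convex ℝ {w : ℝ × ℝ | w.1 + w.2 < 2} := by
      simpa using convex_halfSpace_lt hlin 2
    have c3 : Convex ℝ {w : ℝ × ℝ | w.1 - w.2 < 1} := by
      simpa using convex_halfSpace_lt hlin' 1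
    have c4 : Convex ℝ {w : ℝ × ℝ | -1 < w.1 - w.2} := by
      simpa using convex_halfSpace_gt hlin' (-1)
    exact convex_square_inter (c1.inter (c2.inter (c3.inter c4)))
  have hmem : ∀ {s t : ℝ}, (s, t) ∈ S ↔ ((0 ≤ s ∧ s ≤ 1) ∧ (0 ≤ t ∧ t ≤ 1)) ∧
      0 < s + t ∧ s + t < 2 ∧ s - t < 1 ∧ -1 < s - t := by
    intro s t
    simp only [hSdef, mem_ofPred_eq, mem_prod, mem_Icc]
  obtain ⟨L, hL, hLe⟩ := exists_continuousOn_log_of_convex hconv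
    (g := fun z : ℝ × ℝ => γ z.1 - δ z.2) (by fun_prop)
    (fun z hz => sub_ne_zero.2 (hne _ hz.1.1 _ hz.1.2 hz.2.1 hz.2.2.1
      (by linarith [hz.2.2.2.1]) (by linarith [hz.2.2.2.2])))
  have hb : ∀ s ∈ Ioo (0 : ℝ) 1, (s, (0 : ℝ)) ∈ S ∧ (s, (1 : ℝ)) ∈ S ∧ ((0 : ℝ), s) ∈ S ∧
      ((1 : ℝ), s) ∈ S := by
    rintro s ⟨hs0, hs1⟩
    simp only [hmem]
    refine ⟨⟨⟨⟨?_, ?_⟩, ?_, ?_⟩, ?_, ?_, ?_, ?_⟩, ⟨⟨⟨?_, ?_⟩, ?_, ?_⟩, ?_, ?_, ?_, ?_⟩,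
      ⟨⟨⟨?_, ?_⟩, ?_, ?_⟩, ?_, ?_, ?_, ?_⟩, ⟨⟨⟨?_, ?_⟩, ?_, ?_⟩, ?_, ?_, ?_, ?_⟩⟩ <;> linarith
  obtain ⟨n, e1⟩ := (isPreconnected_Ioo (a := (0 : ℝ)) (b := 1)).exists_int_im_eq_of_exp_eq
    (l₁ := fun s => L (s, 1)) (l₂ := fun s => L (s, 0))
    (hL.comp (by fun_prop) fun s hs => (hb s hs).2.1)
    (hL.comp (by fun_prop) fun s hs => (hb s hs).1) (fun s hs => by
      rw [hLe _ (hb s hs).2.1, hLe _ (hb s hs).1, k0, k1])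
  obtain ⟨m, e2⟩ := (isPreconnected_Ioo (a := (0 : ℝ)) (b := 1)).exists_int_im_eq_of_exp_eq
    (l₁ := fun s => L (1, s)) (l₂ := fun s => L (0, s))
    (hL.comp (by fun_prop) fun s hs => (hb s hs).2.2.2)
    (hL.comp (by fun_prop) fun s hs => (hb s hs).2.2.1) (fun s hs => by
      rw [hLe _ (hb s hs).2.2.2, hLe _ (hb s hs).2.2.1, h0, h1])
  have third : (1 / 3 : ℝ) ∈ Ioc (0 : ℝ) (1 / 3) := by norm_num
  have corner : ∀ (φ ψ : ℝ → ℝ) (a b : ℝ), Continuous φ → Continuous ψ → |a - b| < Real.pi →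
      (∀ s ∈ Icc (0 : ℝ) (1 / 3), ∀ t ∈ Icc (0 : ℝ) (1 / 3), 0 < s + t → (φ s, ψ t) ∈ S) →
      (∀ s ∈ Icc (0 : ℝ) (1 / 3), γ (φ s) = x₀ + (s * c : ℝ) * Complex.exp (a * Complex.I)) →
      (∀ s ∈ Icc (0 : ℝ) (1 / 3), δ (ψ s) = x₀ - (s * c' : ℝ) * Complex.exp (b * Complex.I)) →
      (L (φ (1 / 3), ψ 0)).im - (L (φ 0, ψ (1 / 3))).im = a - b := by
    intro φ ψ a b hφ hψ hab hS hg hd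
    refine im_sub_im_of_corner (l := fun s t => L (φ s, ψ t)) (ε := 1 / 3) hc hc' hab
      (hL.comp (f := fun z : ℝ × ℝ => (φ z.1, ψ z.2)) (by fun_prop) fun z hz =>
        hS _ hz.1.1 _ hz.1.2 hz.2) (fun s hs t ht hst => ?_) _ third _ third
    rw [hLe _ (hS s hs t ht hst)]
    simp only [hg s hs, hd t ht]
    ring
  have c00 := corner (fun s => s) (fun t => t) α₁ (α₂ - Real.pi) (by fun_prop) (by fun_prop)
    (abs_lt.2 ⟨by linarith, by linarith⟩) (by
      rintro s ⟨hs, hs'⟩ t ⟨ht, ht'⟩ hst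
      rw [hmem]; refine ⟨⟨⟨?_, ?_⟩, ?_, ?_⟩, ?_, ?_, ?_, ?_⟩ <;> linarith)
    (fun s hs => (hγr s hs).1) (fun s hs => by rw [exp_sub_pi_mul_I, (hδr s hs).1]; ring)
  have c10 := corner (fun s => 1 - s) (fun t => t) α₃ (α₂ + Real.pi) (by fun_prop) (by fun_prop)
    (abs_lt.2 ⟨by linarith, by linarith⟩) (by
      rintro s ⟨hs, hs'⟩ t ⟨ht, ht'⟩ hst
      rw [hmem]; refine ⟨⟨⟨?_, ?_⟩, ?_, ?_⟩, ?_, ?_, ?_, ?_⟩ <;> linarith)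
    (fun s hs => (hγr s hs).2) (fun s hs => by rw [exp_add_pi_mul_I, (hδr s hs).1]; ring)
  have c11 := corner (fun s => 1 - s) (fun t => 1 - t) α₃ (α₄ - Real.pi) (by fun_prop)
    (by fun_prop) (abs_lt.2 ⟨by linarith, by linarith⟩) (by
      rintro s ⟨hs, hs'⟩ t ⟨ht, ht'⟩ hst
      rw [hmem]; refine ⟨⟨⟨?_, ?_⟩, ?_, ?_⟩, ?_, ?_, ?_, ?_⟩ <;> linarith)
    (fun s hs => (hγr s hs).2) (fun s hs => by rw [exp_sub_pi_mul_I, (hδr s hs).2]; ring)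
  have c01 := corner (fun s => s) (fun t => 1 - t) α₁ (α₄ - Real.pi) (by fun_prop)
    (by fun_prop) (abs_lt.2 ⟨by linarith, by linarith⟩) (by
      rintro s ⟨hs, hs'⟩ t ⟨ht, ht'⟩ hst
      rw [hmem]; refine ⟨⟨⟨?_, ?_⟩, ?_, ?_⟩, ?_, ?_, ?_, ?_⟩ <;> linarith)
    (fun s hs => (hγr s hs).1) (fun s hs => by rw [exp_sub_pi_mul_I, (hδr s hs).2]; ring)
  have a1 := e1 (1 / 3) (by norm_num)
  have a2 := e1 (2 / 3) (by norm_num)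
  have a3 := e2 (1 / 3) (by norm_num)
  have a4 := e2 (2 / 3) (by norm_num)
  norm_num at c00 c10 c11 c01 a1 a2 a3 a4
  linarith [Real.pi_pos]

/-- In a connected open set of the plane, two rays can be joined by a path. -/
theorem exists_isRayEnded {P : Set ℂ} (hP : IsOpen P) (hPc : IsPreconnected P) {p q : ℂ}
    {α β ε : ℝ} (hε : 0 < ε)
    (hp : ∀ t ∈ Ioc 0 ε, p + (t : ℝ) * Complex.exp (α * Complex.I) ∈ P)
    (hq : ∀ t ∈ Ioc 0 ε, q + (t : ℝ) * Complex.exp (β * Complex.I) ∈ P) :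
    ∃ γ : ℝ → ℂ, IsRayEnded γ p q α β (3 * ε) ∧ ∀ s ∈ Ioo (0 : ℝ) 1, γ s ∈ P := by
  have hεm : ε ∈ Ioc 0 ε := ⟨hε, le_rfl⟩
  have hPC : IsConnected P := ⟨⟨_, hp ε hεm⟩, hPc⟩
  have hpath : IsPathConnected P := (hP.isConnected_iff_isPathConnected).1 hPC
  obtain ⟨σ, hσ⟩ := hpath.joinedIn _ (hp ε hεm) _ (hq ε hεm)
  let γ : ℝ → ℂ := fun s => if s ≤ 1 / 3 then p + ((s * (3 * ε) : ℝ) : ℂ) * Complex.exp (α * Complex.I)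
    else if s ≤ 2 / 3 then σ.extend (3 * s - 1)
    else q + (((1 - s) * (3 * ε) : ℝ) : ℂ) * Complex.exp (β * Complex.I)
  refine ⟨γ, ⟨by positivity, ?_, fun s hs => ⟨?_, ?_⟩⟩, fun s hs => ?_⟩
  · refine Continuous.if_le (by fun_prop) (Continuous.if_le ?_ (by fun_prop) (by fun_prop)
      (by fun_prop) ?_) (by fun_prop) (by fun_prop) ?_
    · exact σ.continuous_extend.comp (by fun_prop)
    · rintro x rfl
      have : (3 * (2 / 3) - 1 : ℝ) = 1 := by norm_num
      rw [this, σ.extend_one]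
      congr 3; ring
    · rintro x rfl
      have : (3 * (1 / 3) - 1 : ℝ) = 0 := by norm_num
      rw [if_pos (by norm_num), this, σ.extend_zero]
      congr 3; ring
  · simp only [γ, if_pos hs.2]
  · have h1 : ¬ (1 - s ≤ 1 / 3) := by have := hs.2; linarith
    rcases hs.2.lt_or_eq with h | h
    · have h2 : ¬ (1 - s ≤ 2 / 3) := by linarith
      simp only [γ, if_neg h1, if_neg h2]
      congr 3; ring
    · subst h
      have : (3 * (1 - 1 / 3) - 1 : ℝ) = 1 := by norm_num
      simp only [γ, if_neg h1]
      rw [if_pos (by norm_num), this, σ.extend_one]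
      congr 3; ring
  · simp only [γ]
    split_ifs with h1 h2
    · exact hp _ ⟨by have := hs.1; positivity, by nlinarith⟩
    · have h3 : 3 * s - 1 ∈ Icc (0 : ℝ) 1 := ⟨by linarith, by linarith⟩
      rw [σ.extend_apply h3]
      exact hσ _
    · exact hq _ ⟨by have := hs.2; nlinarith, by nlinarith⟩

/-- Disjoint connected open sets of the plane cannot contain two interlacing pairs of rays
issuing from a common point. -/
theorem false_of_interlacing_rays {P M : Set ℂ} (hP : IsOpen P) (hPc : IsPreconnected P)
    (hM : IsOpen M) (hMc : IsPreconnected M) (hPM : Disjoint P M) {x₀ : ℂ} (hxP : x₀ ∉ P)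
    (hxM : x₀ ∉ M) {α₁ α₂ α₃ α₄ ε : ℝ} (hε : 0 < ε) (h₁₂ : α₁ < α₂) (h₂₃ : α₂ < α₃)
    (h₃₄ : α₃ < α₄) (h₄₁ : α₄ < α₁ + 2 * Real.pi)
    (h₁ : ∀ t ∈ Ioc 0 ε, x₀ + (t : ℝ) * Complex.exp (α₁ * Complex.I) ∈ P)
    (h₂ : ∀ t ∈ Ioc 0 ε, x₀ + (t : ℝ) * Complex.exp (α₂ * Complex.I) ∈ M)
    (h₃ : ∀ t ∈ Ioc 0 ε, x₀ + (t : ℝ) * Complex.exp (α₃ * Complex.I) ∈ P)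
    (h₄ : ∀ t ∈ Ioc 0 ε, x₀ + (t : ℝ) * Complex.exp (α₄ * Complex.I) ∈ M) : False := by
  obtain ⟨γ, hγ, hγP⟩ := exists_isRayEnded hP hPc hε h₁ h₃
  obtain ⟨δ, hδ, hδM⟩ := exists_isRayEnded hM hMc hε h₂ h₄
  have ends : ∀ {γ : ℝ → ℂ} {α β c : ℝ}, IsRayEnded γ x₀ x₀ α β c → γ 0 = x₀ ∧ γ 1 = x₀ := by
    rintro γ α β c ⟨-, -, h⟩
    have := h 0 (by norm_num)
    simpa using this
  have hin : ∀ s ∈ Icc (0 : ℝ) 1, s ∉ Ioo (0 : ℝ) 1 → s = 0 ∨ s = 1 := by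
    intro s hs h
    rcases hs.1.eq_or_lt with h0 | h0
    · exact Or.inl h0.symm
    · rcases hs.2.eq_or_lt with h1 | h1
      · exact Or.inr h1
      · exact absurd ⟨h0, h1⟩ h
  refine hγ.false_of_interlace hδ h₁₂ h₂₃ h₃₄ h₄₁ fun s hs t ht k1 k2 k3 k4 heq => ?_
  by_cases hs' : s ∈ Ioo (0 : ℝ) 1
  · have hPs := hγP s hs'
    by_cases ht' : t ∈ Ioo (0 : ℝ) 1
    · exact hPM.notMem_of_mem_left hPs (heq ▸ hδM t ht')
    · rcases hin t ht ht' with rfl | rfl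
      · exact hxP ((heq.trans (ends hδ).1) ▸ hPs)
      · exact hxP ((heq.trans (ends hδ).2) ▸ hPs)
  · have hγs : γ s = x₀ := by
      rcases hin s hs hs' with rfl | rfl
      exacts [(ends hγ).1, (ends hγ).2]
    by_cases ht' : t ∈ Ioo (0 : ℝ) 1
    · exact hxM ((heq.symm.trans hγs) ▸ hδM t ht')
    · rcases hin s hs hs' with rfl | rfl <;> rcases hin t ht ht' with rfl | rfl <;> linarith

/-- Near a zero with negative definite derivative, a field of linear forms is negative on cones. -/
theorem exists_cone_neg {G : ℂ → ℂ →L[ℝ] ℝ} {Ω : Set ℂ} (hΩ : IsOpen Ω) {p : ℂ} (hp : p ∈ Ω)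
    (hGp : G p = 0) {H : ℂ →L[ℝ] ℂ →L[ℝ] ℝ} (hH : HasFDerivAt G H p)
    (hneg : ∀ v ≠ 0, H v v < 0) :
    ∃ ε > 0, ∃ η > 0, ∀ v w : ℂ, ‖v‖ = 1 → ‖w‖ = 1 → ‖w - v‖ ≤ η → ∀ ρ ∈ Ioc (0 : ℝ) ε,
      p + (ρ : ℝ) * v ∈ Ω ∧ G (p + (ρ : ℝ) * v) w < 0 := by
  obtain ⟨v₀, hv₀, hmax⟩ := (isCompact_sphere (0 : ℂ) 1).exists_isMaxOn
    ⟨1, by simp⟩ (f := fun v => H v v) (by fun_prop)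
  set m : ℝ := -(H v₀ v₀) with hm
  have hm0 : 0 < m := by
    have : v₀ ≠ 0 := by rintro rfl; simp at hv₀
    have := hneg v₀ this
    linarith
  have hle : ∀ v : ℂ, ‖v‖ = 1 → H v v ≤ -m := fun v hv => by
    have := hmax (by simpa using hv : v ∈ sphere (0 : ℂ) 1)
    simpa [hm] using this
  have hlit := hH.isLittleO.def (show 0 < m / 4 by positivity)
  obtain ⟨r, hr, hball⟩ := Metric.eventually_nhds_iff_ball.1
    (hlit.and (hΩ.mem_nhds hp))
  refine ⟨r / 2, by positivity, m / (2 * (‖H‖ + 1)), by positivity, fun v w hv hw hvw ρ hρ => ?_⟩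
  have hmem : p + (ρ : ℝ) * v ∈ ball p r := by
    rw [mem_ball, dist_self_add_left, norm_mul, hv, mul_one, Complex.norm_real, Real.norm_eq_abs,
      abs_of_pos hρ.1]
    linarith [hρ.2]
  obtain ⟨h1, h2⟩ := hball _ hmem
  refine ⟨h2, ?_⟩
  rw [hGp, sub_zero, add_sub_cancel_left, norm_mul, hv, mul_one, Complex.norm_real,
    Real.norm_eq_abs, abs_of_pos hρ.1] at h1
  have h3 : (ρ : ℂ) * v = ρ • v := (Complex.real_smul).symm
  have h4 := (ContinuousLinearMap.le_opNorm (G (p + ρ * v) - H (ρ * v)) w).trans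
    (mul_le_mul_of_nonneg_right h1 (norm_nonneg w))
  have h5 := (le_abs_self _).trans h4
  have h6 : H v (w - v) ≤ m / 2 := by
    have a1 := (le_abs_self _).trans (H.le_opNorm₂ v (w - v))
    have a2 : ‖H‖ * ‖v‖ * ‖w - v‖ ≤ (‖H‖ + 1) * (m / (2 * (‖H‖ + 1))) := by
      rw [hv, mul_one]; gcongr; linarith
    have a3 : (‖H‖ + 1) * (m / (2 * (‖H‖ + 1))) = m / 2 := by
      have : ‖H‖ + 1 ≠ 0 := by positivity
      field_simp
    linarith
  have h7 := hle v hv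
  have h8 : H (ρ * v) w = ρ * H v w := by rw [h3, map_smul]; simp
  have h9 : H v w = H v v + H v (w - v) := by rw [map_sub]; ring
  rw [sub_apply, h8, hw, h9] at h5
  nlinarith [hρ.1, mul_pos hρ.1 hm0]

theorem norm_exp_mul_I_sub_le (a b : ℝ) :
    ‖Complex.exp (a * Complex.I) - Complex.exp (b * Complex.I)‖ ≤ |a - b| := by
  have : Complex.exp (a * Complex.I) - Complex.exp (b * Complex.I)
      = Complex.exp (b * Complex.I) * (Complex.exp (Complex.I * (a - b : ℝ)) - 1) := by
    rw [mul_sub, ← Complex.exp_add, mul_one]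
    congr 2
    push_cast; ring
  rw [this, norm_mul, Complex.norm_exp_ofReal_mul_I, one_mul]
  simpa using Real.norm_exp_I_mul_ofReal_sub_one_le (x := a - b)

/-- A field of linear forms all of whose directional positivity sets are connected has at most one
zero with negative definite derivative. -/
theorem eq_of_negDef_of_isPreconnected {G : ℂ → ℂ →L[ℝ] ℝ} {Ω : Set ℂ} (hΩ : IsOpen Ω)
    (hG : ContinuousOn G Ω)
    (hconn : ∀ α : ℝ, IsPreconnected {x ∈ Ω | G x (Complex.exp (α * Complex.I)) < 0})
    {p q : ℂ} (hp : p ∈ Ω) (hq : q ∈ Ω) (hGp : G p = 0) (hGq : G q = 0)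
    {H H' : ℂ →L[ℝ] ℂ →L[ℝ] ℝ} (hH : HasFDerivAt G H p) (hH' : HasFDerivAt G H' q)
    (hneg : ∀ v ≠ 0, H v v < 0) (hneg' : ∀ v ≠ 0, H' v v < 0) : p = q := by
  by_contra hpq
  obtain ⟨ε₁, hε₁, η₁, hη₁, hcp⟩ := exists_cone_neg hΩ hp hGp hH hneg
  obtain ⟨ε₂, hε₂, η₂, hη₂, hcq⟩ := exists_cone_neg hΩ hq hGq hH' hneg'
  set e : ℝ → ℂ := fun α => Complex.exp (α * Complex.I) with he
  have hen : ∀ α, ‖e α‖ = 1 := fun α => Complex.norm_exp_ofReal_mul_I α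
  have hepi : ∀ α, e (α + Real.pi) = -e α := exp_add_pi_mul_I
  set ε := min ε₁ ε₂ with hε
  have hε0 : 0 < ε := lt_min hε₁ hε₂
  set η := min η₁ η₂ with hη
  have hη0 : 0 < η := lt_min hη₁ hη₂
  have hcp' : ∀ v w : ℂ, ‖v‖ = 1 → ‖w‖ = 1 → ‖w - v‖ ≤ η → ∀ ρ ∈ Ioc (0 : ℝ) ε,
      p + (ρ : ℝ) * v ∈ Ω ∧ G (p + (ρ : ℝ) * v) w < 0 := fun v w hv hw h ρ hρ =>
    hcp v w hv hw (h.trans (min_le_left _ _)) ρ ⟨hρ.1, hρ.2.trans (min_le_left _ _)⟩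
  have hcq' : ∀ v w : ℂ, ‖v‖ = 1 → ‖w‖ = 1 → ‖w - v‖ ≤ η → ∀ ρ ∈ Ioc (0 : ℝ) ε,
      q + (ρ : ℝ) * v ∈ Ω ∧ G (q + (ρ : ℝ) * v) w < 0 := fun v w hv hw h ρ hρ =>
    hcq v w hv hw (h.trans (min_le_right _ _)) ρ ⟨hρ.1, hρ.2.trans (min_le_right _ _)⟩
  set P : ℝ → Set ℂ := fun α => {x ∈ Ω | G x (e α) < 0} with hPdef
  have hPo : ∀ α, IsOpen (P α) := fun α =>
    (hG.clm_apply continuousOn_const).isOpen_inter_preimage hΩ isOpen_Iio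
  have hex : ∀ α, ∃ γ : ℝ → ℂ, IsRayEnded γ p q α α (3 * ε) ∧ ∀ s ∈ Ioo (0 : ℝ) 1, γ s ∈ P α :=
    fun α => exists_isRayEnded (hPo α) (hconn α) hε0
      (fun t ht => hcp' (e α) (e α) (hen α) (hen α) (by simpa using hη0.le) t ht)
      (fun t ht => hcq' (e α) (e α) (hen α) (hen α) (by simpa using hη0.le) t ht)
  choose γ hγ hγP using hex
  have hγ0 : ∀ α, γ α 0 = p := fun α => by
    simpa using ((hγ α).2.2 0 (by norm_num)).1
  have hγ1 : ∀ α, γ α 1 = q := fun α => by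
    simpa using ((hγ α).2.2 0 (by norm_num)).2
  have hpP : ∀ α, p ∉ P α := fun α h => by have := h.2; simp [hGp] at this
  have hqP : ∀ α, q ∉ P α := fun α h => by have := h.2; simp [hGq] at this
  have hcases : ∀ s ∈ Icc (0 : ℝ) 1, s = 0 ∨ s ∈ Ioo (0 : ℝ) 1 ∨ s = 1 := by
    intro s hs
    rcases hs.1.eq_or_lt with h0 | h0
    · exact Or.inl h0.symm
    · rcases hs.2.eq_or_lt with h1 | h1
      · exact Or.inr (Or.inr h1)
      · exact Or.inr (Or.inl ⟨h0, h1⟩)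
  have hturn : ∀ α, ∃ B, HasTurn (γ α) p q α B := fun α => by
    refine (hγ α).exists_hasTurn (fun s hs h => ?_) (fun s hs h => ?_)
    · rcases hcases s ⟨hs.1.le, hs.2⟩ with rfl | h1 | rfl
      · exact lt_irrefl _ hs.1
      · exact hpP α (h ▸ hγP α s h1)
      · exact hpq (h.symm.trans (hγ1 α))
    · rcases hcases s ⟨hs.1, hs.2.le⟩ with rfl | h1 | rfl
      · exact hpq ((hγ0 α).symm.trans h)
      · exact hqP α (h ▸ hγP α s h1)
      · exact lt_irrefl _ hs.2
  choose B hB using hturn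
  have key : ∀ α₀, ∀ᶠ α in nhds α₀, B (α₀ + Real.pi) = B α + 2 * Real.pi := by
    intro α₀
    set δ := γ (α₀ + Real.pi) with hδ
    have hmid : ∀ s ∈ Icc (1 / 3 : ℝ) (2 / 3), δ s ∈ P (α₀ + Real.pi) := fun s hs =>
      hγP _ s ⟨by linarith [hs.1], by linarith [hs.2]⟩
    have hδc : Continuous δ := (hγ _).2.1
    have hGδ : ContinuousOn (fun s => G (δ s)) (Icc (1 / 3 : ℝ) (2 / 3)) :=
      hG.comp hδc.continuousOn fun s hs => (hmid s hs).1
    obtain ⟨s₀, hs₀, hmin⟩ := isCompact_Icc.exists_isMinOn (s := Icc (1 / 3 : ℝ) (2 / 3))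
      ⟨1 / 3, by norm_num⟩ (f := fun s => G (δ s) (e α₀)) (hGδ.clm_apply continuousOn_const)
    obtain ⟨C, hC⟩ := isCompact_Icc.exists_bound_of_continuousOn hGδ
    have hm0 : 0 < G (δ s₀) (e α₀) := by
      have := (hmid s₀ hs₀).2
      rw [hepi, map_neg] at this
      linarith
    set m := G (δ s₀) (e α₀) with hm
    have hC0 : 0 ≤ C := (norm_nonneg _).trans (hC _ hs₀)
    have hnear : ∀ᶠ α in nhds α₀, |α - α₀| < min (min η 1) (m / (C + 1)) := by
      have : 0 < min (min η 1) (m / (C + 1)) :=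
        lt_min (lt_min hη0 one_pos) (by positivity)
      exact Metric.eventually_nhds_iff.2 ⟨_, this, fun α h => by rwa [Real.dist_eq] at h⟩
    filter_upwards [hnear] with α hα
    have hα1 : |α - α₀| < η := hα.trans_le ((min_le_left _ _).trans (min_le_left _ _))
    have hα2 : |α - α₀| < 1 := hα.trans_le ((min_le_left _ _).trans (min_le_right _ _))
    have hα3 : |α - α₀| < m / (C + 1) := hα.trans_le (min_le_right _ _)
    have hpos : ∀ s ∈ Ioo (0 : ℝ) 1, 0 < G (δ s) (e α) := by
      have hshift : ‖e (α + Real.pi) - e (α₀ + Real.pi)‖ ≤ η := by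
        refine (norm_exp_mul_I_sub_le _ _).trans ?_
        rw [add_sub_add_right_eq_sub]
        exact hα1.le
      have hend : ∀ x, G x (e (α + Real.pi)) < 0 → 0 < G x (e α) := fun x hx => by
        rw [hepi, map_neg] at hx; linarith
      intro s hs
      rcases le_or_gt s (1 / 3) with h1 | h1
      · apply hend
        rw [hδ, ((hγ _).2.2 s ⟨hs.1.le, h1⟩).1]
        exact (hcp' _ _ (hen _) (hen _) hshift (s * (3 * ε))
          ⟨by have := hs.1; positivity, by nlinarith⟩).2
      · rcases le_or_gt s (2 / 3) with h2 | h2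
        · have a1 := hmin (⟨h1.le, h2⟩ : s ∈ Icc (1 / 3 : ℝ) (2 / 3))
          have a1 : m ≤ G (δ s) (e α₀) := a1
          have a2 := (G (δ s)).le_opNorm (e α - e α₀)
          have a3 : ‖G (δ s)‖ * ‖e α - e α₀‖ ≤ C * |α - α₀| :=
            mul_le_mul (hC s ⟨h1.le, h2⟩) (norm_exp_mul_I_sub_le _ _) (norm_nonneg _) hC0
          have a4 : C * |α - α₀| < m := by
            rw [lt_div_iff₀ (by positivity)] at hα3
            nlinarith [abs_nonneg (α - α₀)]
          have a5 := neg_abs_le (G (δ s) (e α - e α₀))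
          rw [Real.norm_eq_abs] at a2
          rw [map_sub] at a2 a5
          linarith
        · apply hend
          have := ((hγ (α₀ + Real.pi)).2.2 (1 - s) ⟨by linarith [hs.2], by linarith⟩).2
          rw [sub_sub_cancel] at this
          rw [hδ, this]
          exact (hcq' _ _ (hen _) (hen _) hshift ((1 - s) * (3 * ε))
            ⟨by have := hs.2; have : 0 < 1 - s := by linarith
                positivity, by nlinarith⟩).2
    refine HasTurn.eq_add_two_pi (hγ α) (hγ _) (hB α) (hB _) ?_ ?_
    · rw [add_sub_cancel_right]
      linarith [Real.pi_gt_three]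
    · intro s hs t ht k1 k2 heq
      rcases hcases t ht with rfl | h | rfl
      · rw [hγ0] at heq
        rcases hcases s hs with rfl | h' | rfl
        · linarith
        · exact hpP α (heq ▸ hγP α s h')
        · exact hpq (heq.symm.trans (hγ1 α))
      · have h3 := hpos t h
        rcases hcases s hs with rfl | h' | rfl
        · rw [hγ0] at heq
          rw [hδ, ← heq, hGp] at h3
          simp at h3
        · have h4 := (hγP α s h').2
          rw [heq] at h4
          exact lt_asymm h3 h4
        · rw [hγ1] at heq
          rw [hδ, ← heq, hGq] at h3
          simp at h3
      · rw [hγ1] at heq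
        rcases hcases s hs with rfl | h' | rfl
        · exact hpq ((hγ0 α).symm.trans heq)
        · exact hqP α (heq ▸ hγP α s h')
        · linarith
  have hloc : IsLocallyConstant B := by
    rw [IsLocallyConstant.iff_eventually_eq]
    intro α₀
    filter_upwards [key α₀] with α hα
    have := (key α₀).self_of_nhds
    linarith
  have h1 := (key 0).self_of_nhds
  rw [hloc.apply_eq_of_preconnectedSpace (0 + Real.pi) 0] at h1
  linarith [Real.pi_pos]

/-- One-sided second-derivative test. -/
theorem nonneg_of_forall_le_of_hasDerivWithinAt {h h' : ℝ → ℝ} {q δ : ℝ} (hδ : 0 < δ)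
    (hc : ContinuousOn h (Icc 0 δ)) (hd : ∀ t ∈ Ioo 0 δ, HasDerivAt h (h' t) t)
    (h0 : h' 0 = 0) (hq : HasDerivWithinAt h' q (Ici 0) 0)
    (hmin : ∀ t ∈ Ioo 0 δ, h 0 ≤ h t) : 0 ≤ q := by
  by_contra! hneg
  rw [hasDerivWithinAt_iff_tendsto_slope, Ici_sdiff_left] at hq
  have hev := hq.eventually (gt_mem_nhds hneg)
  rw [eventually_nhdsWithin_iff, Metric.eventually_nhds_iff] at hev
  obtain ⟨r, hr, hr'⟩ := hev
  set s := min r δ / 2 with hs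
  have hmr : 0 < min r δ := lt_min hr hδ
  have hs0 : 0 < s := by positivity
  have hsr : s < r := by linarith [min_le_left r δ]
  have hsδ : s < δ := by linarith [min_le_right r δ]
  have hanti : StrictAntiOn h (Icc 0 s) := by
    refine strictAntiOn_of_deriv_neg (convex_Icc 0 s) (hc.mono (Icc_subset_Icc_right hsδ.le)) ?_
    intro t ht
    rw [interior_Icc] at ht
    rw [(hd t ⟨ht.1, ht.2.trans hsδ⟩).deriv]
    have := hr' (y := t) (by rw [Real.dist_eq, sub_zero, abs_of_pos ht.1]; linarith [ht.2]) ht.1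
    rw [slope_def_field, h0, sub_zero, sub_zero] at this
    by_contra! hle
    exact absurd this (not_lt.2 (div_nonneg hle ht.1.le))
  have := hanti (left_mem_Icc.2 hs0.le) (right_mem_Icc.2 hs0.le) hs0
  exact absurd (hmin s ⟨hs0, hsδ⟩) (not_le.2 this)

section

variable {E : Type*} [NormedAddCommGroup E] [NormedSpace ℝ E]

theorem ContDiffAt.hasFDerivAt_fderiv {V : E → ℝ} {x : E} (h : ContDiffAt ℝ 2 V x) :
    HasFDerivAt (fderiv ℝ V) (fderiv ℝ (fderiv ℝ V) x) x :=
  ((h.fderiv_right (m := 1) (by norm_num)).differentiableAt (by norm_num)).hasFDerivAt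

theorem ContDiffAt.eventually_hasFDerivAt {V : E → ℝ} {x : E} (h : ContDiffAt ℝ 2 V x) :
    ∀ᶠ y in nhds x, HasFDerivAt V (fderiv ℝ V y) y := by
  filter_upwards [h.eventually (by simp)] with y hy
  exact (hy.differentiableAt (by norm_num)).hasFDerivAt

/-- The Hessian is positive semidefinite at a local minimum. -/
theorem IsLocalMin.fderiv_fderiv_nonneg {V : E → ℝ} {x : E} (hmin : IsLocalMin V x)
    (h : ContDiffAt ℝ 2 V x) (v : E) : 0 ≤ fderiv ℝ (fderiv ℝ V) x v v := by
  have hline : ∀ t : ℝ, HasDerivAt (fun t : ℝ => x + t • v) v t := fun t => by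
    simpa using ((hasDerivAt_id t).smul_const v).const_add x
  have hcont : Filter.Tendsto (fun t : ℝ => x + t • v) (nhds 0) (nhds x) := by
    have := (hline 0).continuousAt.tendsto
    simpa using this
  obtain ⟨δ, hδ, hball⟩ := Metric.eventually_nhds_iff.1
    (hcont.eventually (h.eventually_hasFDerivAt.and hmin))
  have hmem : ∀ t ∈ Icc 0 (δ / 2), dist t 0 < δ := fun t ht => by
    rw [Real.dist_eq, sub_zero, abs_of_nonneg ht.1]; linarith [ht.2]
  have hder : ∀ t ∈ Icc 0 (δ / 2), HasDerivAt (fun t : ℝ => V (x + t • v))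
      (fderiv ℝ V (x + t • v) v) t := fun t ht =>
    (hball (hmem t ht)).1.comp_hasDerivAt t (hline t)
  refine nonneg_of_forall_le_of_hasDerivWithinAt (h := fun t : ℝ => V (x + t • v))
    (h' := fun t => fderiv ℝ V (x + t • v) v) (half_pos hδ)
    (fun t ht => (hder t ht).continuousAt.continuousWithinAt)
    (fun t ht => hder t ⟨ht.1.le, ht.2.le⟩) ?_ ?_ ?_
  · simp [hmin.fderiv_eq_zero]
  · have h1 : HasFDerivAt (fderiv ℝ V) (fderiv ℝ (fderiv ℝ V) x) (x + (0 : ℝ) • v) := by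
      simpa using h.hasFDerivAt_fderiv
    have h2 := h1.comp_hasDerivAt 0 (hline 0)
    have h3 := h2.clm_apply (hasDerivAt_const (0 : ℝ) v)
    simpa using h3.hasDerivWithinAt
  · intro t ht
    have := (hball (hmem t ⟨ht.1.le, ht.2.le⟩)).2
    simpa using this

theorem IsLocalMax.fderiv_fderiv_nonpos {V : E → ℝ} {x : E} (hmax : IsLocalMax V x)
    (h : ContDiffAt ℝ 2 V x) (v : E) : fderiv ℝ (fderiv ℝ V) x v v ≤ 0 := by
  have h1 := hmax.neg.fderiv_fderiv_nonneg h.neg v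
  have h2 : fderiv ℝ (fun y => -V y) = fun y => -fderiv ℝ V y := by
    ext1 y; exact fderiv_fun_neg
  change 0 ≤ fderiv ℝ (fderiv ℝ (fun y => -V y)) x v v at h1
  rw [h2, fderiv_fun_neg] at h1
  simpa using h1

end

/-- The trace of a bilinear form on `ℂ`, corrected by its value in the direction `η`. -/
def ellip (η : ℂ) (B : ℂ →L[ℝ] ℂ →L[ℝ] ℝ) : ℝ := B 1 1 + B Complex.I Complex.I + B η η

theorem ellip_add (η : ℂ) (B B' : ℂ →L[ℝ] ℂ →L[ℝ] ℝ) :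
    ellip η (B + B') = ellip η B + ellip η B' := by
  simp only [ellip, add_apply]; ring

theorem ellip_nonpos {η : ℂ} {B : ℂ →L[ℝ] ℂ →L[ℝ] ℝ} (h : ∀ v, B v v ≤ 0) : ellip η B ≤ 0 :=
  add_nonpos (add_nonpos (h _) (h _)) (h _)

/-- Weak maximum principle for `tr D²V + D²V(η,η) ≥ c V - β ‖DV‖`. -/
theorem nonpos_of_le_ellip {D : Set ℂ} (hD : IsOpen D) (hDb : Bornology.IsBounded D) {V : ℂ → ℝ}
    (hVc : ContinuousOn V (closure D)) (hV : ∀ x ∈ D, ContDiffAt ℝ 2 V x)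
    (hfr : ∀ x ∈ frontier D, V x ≤ 0) {η : ℂ → ℂ} {c : ℂ → ℝ} {β : ℝ} (hβ : 0 ≤ β)
    (hc : ∀ x ∈ D, 0 ≤ c x)
    (hL : ∀ x ∈ D, c x * V x - β * ‖fderiv ℝ V x‖ ≤ ellip (η x) (fderiv ℝ (fderiv ℝ V) x)) :
    ∀ x ∈ D, V x ≤ 0 := by
  by_contra! hcon
  obtain ⟨x₁, hx₁, hpos⟩ := hcon
  set b : ℝ := β + 1 with hb
  have hb0 : 0 < b := by positivity
  set F : ℂ → ℝ := fun x => Real.exp (b * x.re) with hF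
  have hFc : ContDiff ℝ 2 F := by
    have : ContDiff ℝ 2 (fun x : ℂ => b * Complex.reCLM x) :=
      contDiff_const.mul Complex.reCLM.contDiff
    exact Real.contDiff_exp.comp this
  have hF0 : ∀ x, 0 < F x := fun x => Real.exp_pos _
  have hF1 : ∀ x, HasFDerivAt F ((b * F x) • Complex.reCLM) x := by
    intro x
    have h1 : HasFDerivAt (fun x : ℂ => b * x.re) (b • Complex.reCLM) x :=
      Complex.reCLM.hasFDerivAt.const_mul b
    have h2 := h1.exp
    convert! h2 using 1
    rw [smul_smul, mul_comm]
  have hF1' : fderiv ℝ F = fun x => (b * F x) • Complex.reCLM := funext fun x => (hF1 x).fderiv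
  have hF2 : ∀ x, fderiv ℝ (fderiv ℝ F) x =
      ((b * (b * F x)) • Complex.reCLM).smulRight Complex.reCLM := by
    intro x
    rw [hF1']
    have h1 : HasFDerivAt (fun x => b * F x) ((b * (b * F x)) • Complex.reCLM) x := by
      convert! (hF1 x).const_mul b using 1
      rw [smul_smul]
    exact (h1.smul_const Complex.reCLM).fderiv
  have hK : IsCompact (closure D) := hDb.isCompact_closure
  obtain ⟨M, hM⟩ := hK.exists_bound_of_continuousOn (hFc.continuous.continuousOn)
  have hM0 : 0 < M := (hF0 x₁).trans_le ((le_abs_self _).trans (hM x₁ (subset_closure hx₁)))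
  set ε : ℝ := V x₁ / (2 * M) with hε
  have hε0 : 0 < ε := by positivity
  obtain ⟨x, hx, hmax⟩ := hK.exists_isMaxOn ⟨x₁, subset_closure hx₁⟩
    (f := fun x => V x + ε * F x) (hVc.add (continuousOn_const.mul hFc.continuous.continuousOn))
  have hVx : 0 < V x := by
    have h1 : V x₁ + ε * F x₁ ≤ V x + ε * F x := hmax (subset_closure hx₁)
    have h2 : ε * F x ≤ ε * M :=
      mul_le_mul_of_nonneg_left ((le_abs_self _).trans (hM x hx)) hε0.le
    have h3 : ε * M = V x₁ / 2 := by rw [hε]; field_simp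
    have h4 : 0 < ε * F x₁ := mul_pos hε0 (hF0 _)
    linarith
  have hxD : x ∈ D := by
    by_contra hxD
    exact absurd (hfr x ⟨hx, by rwa [hD.interior_eq]⟩) (not_le.2 hVx)
  have hlm : IsLocalMax (fun x => V x + ε * F x) x :=
    hmax.isLocalMax (Filter.mem_of_superset (hD.mem_nhds hxD) subset_closure)
  have hεF : ContDiffAt ℝ 2 (fun x => ε * F x) x := contDiffAt_const.mul hFc.contDiffAt
  have hFd : ∀ y, fderiv ℝ (fun x => ε * F x) y = ε • fderiv ℝ F y := fun y =>
    fderiv_const_mul (hF1 y).differentiableAt ε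
  have hd1 : ∀ᶠ y in nhds x, fderiv ℝ (fun x => V x + ε * F x) y
      = fderiv ℝ V y + ε • fderiv ℝ F y := by
    filter_upwards [(hV x hxD).eventually_hasFDerivAt] with y hy
    rw [fderiv_fun_add hy.differentiableAt ((hF1 y).differentiableAt.const_mul ε), hFd]
  have hd2 : fderiv ℝ (fderiv ℝ (fun x => V x + ε * F x)) x
      = fderiv ℝ (fderiv ℝ V) x + ε • fderiv ℝ (fderiv ℝ F) x := by
    rw [Filter.EventuallyEq.fderiv_eq hd1]
    have a1 := (hV x hxD).hasFDerivAt_fderiv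
    have a2 := (hFc.contDiffAt (x := x)).hasFDerivAt_fderiv.const_smul ε
    exact (a1.add a2).fderiv
  have hgrad : fderiv ℝ V x = -(ε • fderiv ℝ F x) := by
    have := hlm.fderiv_eq_zero
    rw [hd1.self_of_nhds] at this
    exact eq_neg_of_add_eq_zero_left this
  have hH := ellip_nonpos (η := η x)
    (hlm.fderiv_fderiv_nonpos ((hV x hxD).add hεF))
  rw [hd2, ellip_add, hF2] at hH
  have hn : ‖fderiv ℝ V x‖ = ε * (b * F x) := by
    rw [hgrad, norm_neg, norm_smul, hF1', norm_smul, Complex.reCLM_norm, mul_one,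
      Real.norm_of_nonneg hε0.le, Real.norm_of_nonneg (mul_pos hb0 (hF0 x)).le]
  have h1 := hL x hxD
  rw [hn] at h1
  have h2 : 0 ≤ c x * V x := mul_nonneg (hc x hxD) hVx.le
  have h3 : ellip (η x) (ε • ((b * (b * F x)) • Complex.reCLM).smulRight Complex.reCLM)
      = ε * b * b * F x * (1 + (η x).re ^ 2) := by
    simp [ellip]; ring
  rw [h3] at hH
  have h4 : 0 < ε * b * F x := by have := hF0 x; positivity
  nlinarith [mul_nonneg (mul_pos h4 hb0).le (sq_nonneg (η x).re), mul_nonneg h4.le hβ]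

/-- If `V` satisfies the maximum principle in a convex domain and is positive on a connected part
of the boundary, then it is positive on a connected part of the domain. -/
theorem isPreconnected_pos_of_le_ellip {Ω : Set ℂ} (hΩ : IsOpen Ω) (hΩb : Bornology.IsBounded Ω)
    (hΩc : Convex ℝ Ω) {V : ℂ → ℝ} (hVc : ContinuousOn V (closure Ω))
    (hV : ∀ x ∈ Ω, ContDiffAt ℝ 2 V x) {η : ℂ → ℂ} {c : ℂ → ℝ} {β : ℝ} (hβ : 0 ≤ β)
    (hc : ∀ x ∈ Ω, 0 ≤ c x)
    (hL : ∀ x ∈ Ω, c x * V x - β * ‖fderiv ℝ V x‖ ≤ ellip (η x) (fderiv ℝ (fderiv ℝ V) x))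
    (hΓ : IsPreconnected {y ∈ frontier Ω | 0 < V y}) :
    IsPreconnected {x ∈ Ω | 0 < V x} := by
  set P : Set ℂ := {x ∈ Ω | 0 < V x} with hP
  set Γ : Set ℂ := {y ∈ frontier Ω | 0 < V y} with hΓd
  have hPo : IsOpen P := (hVc.mono subset_closure).isOpen_inter_preimage hΩ isOpen_Ioi
  intro U₁ U₂ hU₁ hU₂ hcov hne₁ hne₂
  by_contra hdis
  rw [not_nonempty_iff_eq_empty] at hdis
  have hmem : ∀ x ∈ P, x ∈ U₁ → x ∈ U₂ → False := fun x h h1 h2 => by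
    have : x ∈ P ∩ (U₁ ∩ U₂) := ⟨h, h1, h2⟩
    rw [hdis] at this; exact this
  have touch : ∀ A B : Set ℂ, IsOpen A → IsOpen B → P ⊆ A ∪ B → (∀ x ∈ P, x ∈ A → x ∈ B → False) →
      (P ∩ A).Nonempty → (Γ ∩ closure (P ∩ A)).Nonempty := by
    intro A B hA hB hAB hd ⟨x, hx⟩
    by_contra hempty
    have hAP : closure (P ∩ A) ⊆ closure Ω := closure_mono fun y hy => hy.1.1
    have hle := nonpos_of_le_ellip (hPo.inter hA) (hΩb.subset fun y hy => hy.1.1)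
      (hVc.mono hAP) (fun y hy => hV y hy.1.1) (fun y hy => ?_) hβ
      (fun y hy => hc y hy.1.1) (fun y hy => hL y hy.1.1)
    · exact absurd (hle x hx) (not_le.2 hx.1.2)
    · by_contra! hpos
      rw [(hPo.inter hA).frontier_eq] at hy
      by_cases hyΩ : y ∈ Ω
      · have hyP : y ∈ P := ⟨hyΩ, hpos⟩
        rcases hAB hyP with h | h
        · exact hy.2 ⟨hyP, h⟩
        · obtain ⟨z, hz, hz'⟩ := mem_closure_iff.1 hy.1 B hB h
          exact hd z hz'.1 hz'.2 hz
      · exact hempty ⟨y, ⟨⟨hAP hy.1, by rwa [hΩ.interior_eq]⟩, hpos⟩, hy.1⟩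
  have hlocal : ∀ y ∈ Γ, ∃ B : Set ℂ, IsOpen B ∧ y ∈ B ∧ (B ∩ Ω).Nonempty ∧ B ∩ Ω ⊆ P ∧
      IsPreconnected (B ∩ Ω) := by
    intro y hy
    have h1 : ∀ᶠ x in nhdsWithin y (closure Ω), 0 < V x :=
      (hVc y hy.1.1).eventually (lt_mem_nhds hy.2)
    obtain ⟨r, hr, hr'⟩ := Metric.mem_nhdsWithin_iff.1 h1
    refine ⟨ball y r, isOpen_ball, mem_ball_self hr, ?_, fun x hx => ⟨hx.2, hr' ⟨hx.1,
      subset_closure hx.2⟩⟩, ((convex_ball y r).inter hΩc).isPreconnected⟩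
    exact mem_closure_iff.1 hy.1.1 _ isOpen_ball (mem_ball_self hr)
  have hside : ∀ y ∈ Γ, ∃ B : Set ℂ, IsOpen B ∧ y ∈ B ∧
      (B ∩ Ω ⊆ P ∩ U₁ ∨ B ∩ Ω ⊆ P ∩ U₂) := by
    intro y hy
    obtain ⟨B, hB, hyB, -, hsub, hpre⟩ := hlocal y hy
    refine ⟨B, hB, hyB, ?_⟩
    refine hpre.subset_or_subset (hPo.inter hU₁) (hPo.inter hU₂)
      (disjoint_left.2 fun x h1 h2 => hmem x h1.1 h1.2 h2.2) fun x hx => ?_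
    exact (hcov (hsub hx)).imp (fun h => ⟨hsub hx, h⟩) fun h => ⟨hsub hx, h⟩
  have hadh : ∀ y ∈ frontier Ω, ∀ B : Set ℂ, IsOpen B → y ∈ B → ∀ A : Set ℂ, B ∩ Ω ⊆ A →
      y ∈ closure A := by
    intro y hy B hB hyB A hA
    rw [_root_.mem_closure_iff]
    intro O hO hyO
    obtain ⟨z, hz, hzΩ⟩ := mem_closure_iff.1 hy.1 (O ∩ B) (hO.inter hB) ⟨hyO, hyB⟩
    exact ⟨z, hz.1, hA ⟨hz.2, hzΩ⟩⟩
  have hclos := isPreconnected_closed_iff.1 hΓ _ _ (isClosed_closure (s := P ∩ U₁))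
    (isClosed_closure (s := P ∩ U₂)) (fun y hy => by
      obtain ⟨B, hB, hyB, h⟩ := hside y hy
      exact h.imp (hadh y hy.1 B hB hyB _) (hadh y hy.1 B hB hyB _))
    (touch U₁ U₂ hU₁ hU₂ hcov hmem hne₁)
    (touch U₂ U₁ hU₂ hU₁ (by rwa [union_comm]) (fun x hx h1 h2 => hmem x hx h2 h1) hne₂)
  obtain ⟨y, hyΓ, hy1, hy2⟩ := hclos
  obtain ⟨B, hB, hyB, h⟩ := hside y hyΓ
  obtain ⟨z, hzB, hz⟩ := mem_closure_iff.1 hy1 B hB hyB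
  obtain ⟨w, hwB, hw⟩ := mem_closure_iff.1 hy2 B hB hyB
  rcases h with h | h
  · exact hmem w hw.1 (h ⟨hwB, hw.1.1⟩).2 hw.2
  · exact hmem z hz.1 hz.2 (h ⟨hzB, hz.1.1⟩).2

/-- The vector obtained from a linear form by a quarter turn. -/
def perp (p : ℂ →L[ℝ] ℝ) : ℂ := ⟨p Complex.I, -p 1⟩

/-- The area element `√(1+|p|²)`. -/
def areaElt (p : ℂ →L[ℝ] ℝ) : ℝ := Real.sqrt (1 + (p 1 ^ 2 + p Complex.I ^ 2))

theorem one_le_areaElt (p : ℂ →L[ℝ] ℝ) : 1 ≤ areaElt p :=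
  Real.one_le_sqrt.2 (by nlinarith [sq_nonneg (p 1), sq_nonneg (p Complex.I)])

theorem continuous_perp : Continuous perp := by
  have : perp = fun p => ((p Complex.I : ℝ) : ℂ) - (p 1 : ℝ) * Complex.I := by
    ext p; apply Complex.ext <;> simp [perp]
  rw [this]
  fun_prop

theorem continuous_areaElt : Continuous areaElt := by
  unfold areaElt
  fun_prop

theorem continuous_ellip : Continuous fun z : ℂ × (ℂ →L[ℝ] ℂ →L[ℝ] ℝ) => ellip z.1 z.2 := by
  unfold ellip
  fun_prop

/-- A positive solution, analytic inside and `C²` up to the boundary, of the mean curvature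
equation in a plane domain with convex closure and regular boundary. -/
structure IsPlanarSolution (Ω : Set ℂ) (f : ℝ → ℝ) (u : ℂ → ℝ) : Prop where
  nonempty : Ω.Nonempty
  isOpen : IsOpen Ω
  isBounded : Bornology.IsBounded Ω
  convex_closure : Convex ℝ (closure Ω)
  exists_param : ∃ γ : ℝ → ℂ, ContDiff ℝ 2 γ ∧ (∀ t, deriv γ t ≠ 0) ∧ range γ = frontier Ω
  contDiff : ContDiff ℝ 1 f
  monotone : Monotone f
  analytic : AnalyticOnNhd ℝ u Ω
  contDiffOn : ContDiffOn ℝ 2 u (closure Ω)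
  eq_zero : ∀ x ∈ frontier Ω, u x = 0
  pos : ∀ x ∈ Ω, 0 < u x
  eqn : ∀ x ∈ Ω, ellip (perp (fderiv ℝ u x)) (fderiv ℝ (fderiv ℝ u) x)
    = f (u x) * areaElt (fderiv ℝ u x) ^ 3

/-- The derivative of `u`, extended to the closure of `Ω`. -/
def grad (Ω : Set ℂ) (u : ℂ → ℝ) : ℂ → ℂ →L[ℝ] ℝ := fderivWithin ℝ u (closure Ω)

/-- The second derivative of `u`, extended to the closure of `Ω`. -/
def hess (Ω : Set ℂ) (u : ℂ → ℝ) : ℂ → ℂ →L[ℝ] ℂ →L[ℝ] ℝ :=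
  fderivWithin ℝ (grad Ω u) (closure Ω)

namespace IsPlanarSolution

variable {Ω : Set ℂ} {f : ℝ → ℝ} {u : ℂ → ℝ}

theorem isCompact_closure (h : IsPlanarSolution Ω f u)
    : IsCompact (closure Ω) := h.isBounded.isCompact_closure

theorem uniqueDiffOn (h : IsPlanarSolution Ω f u) : UniqueDiffOn ℝ (closure Ω) :=
  uniqueDiffOn_convex h.convex_closure
    (h.nonempty.mono (interior_maximal subset_closure h.isOpen))

theorem subset_interior (h : IsPlanarSolution Ω f u)
    : Ω ⊆ interior (closure Ω) := interior_maximal subset_closure h.isOpen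

theorem contDiffOn_grad (h : IsPlanarSolution Ω f u) : ContDiffOn ℝ 1 (grad Ω u) (closure Ω) :=
  h.contDiffOn.fderivWithin h.uniqueDiffOn (by norm_num)

theorem continuousOn_grad (h : IsPlanarSolution Ω f u)
    : ContinuousOn (grad Ω u) (closure Ω) := h.contDiffOn_grad.continuousOn

theorem continuousOn_hess (h : IsPlanarSolution Ω f u) : ContinuousOn (hess Ω u) (closure Ω) :=
  h.contDiffOn_grad.continuousOn_fderivWithin h.uniqueDiffOn (by norm_num)

theorem hasFDerivWithinAt (h : IsPlanarSolution Ω f u) {x : ℂ} (hx : x ∈ closure Ω) :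
    HasFDerivWithinAt u (grad Ω u x) (closure Ω) x :=
  (h.contDiffOn.differentiableOn (by norm_num) x hx).hasFDerivWithinAt

theorem hasFDerivWithinAt_grad (h : IsPlanarSolution Ω f u) {x : ℂ} (hx : x ∈ closure Ω) :
    HasFDerivWithinAt (grad Ω u) (hess Ω u x) (closure Ω) x :=
  (h.contDiffOn_grad.differentiableOn (by norm_num) x hx).hasFDerivWithinAt

theorem _root_.grad_eq_fderiv {x : ℂ} (hx : x ∈ interior (closure Ω)) :
    grad Ω u x = fderiv ℝ u x :=
  fderivWithin_of_mem_nhds (mem_interior_iff_mem_nhds.1 hx)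

theorem hess_eq (h : IsPlanarSolution Ω f u)
    {x : ℂ} (hx : x ∈ Ω) : hess Ω u x = fderiv ℝ (fderiv ℝ u) x := by
  have h1 : grad Ω u =ᶠ[nhds x] fderiv ℝ u := by
    filter_upwards [h.isOpen.mem_nhds hx] with y hy using grad_eq_fderiv (h.subset_interior hy)
  rw [hess, fderivWithin_of_mem_nhds
    (mem_interior_iff_mem_nhds.1 (h.subset_interior hx)), h1.fderiv_eq]

theorem eqn_closure (h : IsPlanarSolution Ω f u) {x : ℂ} (hx : x ∈ closure Ω) :
    ellip (perp (grad Ω u x)) (hess Ω u x) = f (u x) * areaElt (grad Ω u x) ^ 3 := by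
  have hG := h.continuousOn_grad
  have h1 : EqOn (fun x => ellip (perp (grad Ω u x)) (hess Ω u x))
      (fun x => f (u x) * areaElt (grad Ω u x) ^ 3) Ω := fun x hx => by
    simp only [grad_eq_fderiv (h.subset_interior hx), h.hess_eq hx, h.eqn x hx]
  refine h1.of_subset_closure ?_ ?_ subset_closure subset_rfl hx
  · exact continuous_ellip.comp_continuousOn
      ((continuous_perp.comp_continuousOn hG).prodMk h.continuousOn_hess)
  · exact (h.contDiff.continuous.comp_continuousOn h.contDiffOn.continuousOn).mul
      ((continuous_areaElt.comp_continuousOn hG).pow 3)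

theorem nonneg (h : IsPlanarSolution Ω f u) {x : ℂ} (hx : x ∈ closure Ω) : 0 ≤ u x := by
  by_cases hxΩ : x ∈ Ω
  · exact (h.pos x hxΩ).le
  · exact (h.eq_zero x ⟨hx, by rwa [h.isOpen.interior_eq]⟩).ge

theorem contDiffAt (h : IsPlanarSolution Ω f u) {x : ℂ} (hx : x ∈ Ω) : ContDiffAt ℝ 2 u x :=
  (h.analytic x hx).contDiffAt

theorem f_zero_neg (h : IsPlanarSolution Ω f u) : f 0 < 0 := by
  by_contra! hf
  obtain ⟨x, hx⟩ := h.nonempty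
  have := nonpos_of_le_ellip h.isOpen h.isBounded h.contDiffOn.continuousOn
    (fun x hx => h.contDiffAt hx) (fun x hx => (h.eq_zero x hx).le)
    (η := fun x => perp (fderiv ℝ u x)) (c := 0) le_rfl (fun _ _ => le_rfl) (fun x hx => by
      rw [h.eqn x hx]
      have h1 : 0 ≤ f (u x) := hf.trans (h.monotone (h.pos x hx).le)
      have h2 := one_le_areaElt (fderiv ℝ u x)
      simp only [Pi.zero_apply, zero_mul, sub_zero]
      positivity) x hx
  exact absurd (h.pos x hx) (not_lt.2 this)

/-- Hopf's lemma: the derivative does not vanish on the boundary. -/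
theorem grad_ne_zero (h : IsPlanarSolution Ω f u)
    {y : ℂ} (hy : y ∈ frontier Ω) : grad Ω u y ≠ 0 := by
  intro hG
  obtain ⟨γ, hγ, hγ', hγr⟩ := h.exists_param
  obtain ⟨t₀, rfl⟩ : y ∈ range γ := hγr ▸ hy
  set τ := deriv γ t₀ with hτ
  set B := hess Ω u (γ t₀) with hB
  have hγK : ∀ t, γ t ∈ closure Ω := fun t =>
    frontier_subset_closure (hγr ▸ mem_range_self t)
  have hγd : ∀ t, HasDerivAt γ (deriv γ t) t := fun t =>
    (hγ.differentiable (by norm_num) t).hasDerivAt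
  have hγd2 : ∀ t, HasDerivAt (deriv γ) (deriv (deriv γ) t) t := fun t => by
    have : ContDiff ℝ 1 (deriv γ) := by
      have h2 : ContDiff ℝ (1 + 1) γ := by norm_num; exact hγ
      exact (contDiff_succ_iff_deriv.1 h2).2.2
    exact (this.differentiable (by norm_num) t).hasDerivAt
  have hcurve : ∀ (c c' : ℝ → ℂ) (c'' : ℂ) (s : Set ℝ), 0 ∈ s → MapsTo c s (closure Ω) →
      c 0 = γ t₀ → HasDerivWithinAt c (c' 0) s 0 → HasDerivWithinAt c' c'' s 0 →
      HasDerivWithinAt (fun t => grad Ω u (c t) (c' t)) (B (c' 0) (c' 0)) s 0 := by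
    intro c c' c'' s h0 hm hc0 hc hc'
    have h1 : HasFDerivWithinAt (grad Ω u) B (closure Ω) (c 0) := by
      rw [hc0]; exact h.hasFDerivWithinAt_grad (hγK t₀)
    have h2 := (h1.comp_hasDerivWithinAt 0 hc hm).clm_apply hc'
    simpa [hc0, hG] using h2
  have hττ : B τ τ = 0 := by
    have hz : ∀ t, grad Ω u (γ t) (deriv γ t) = 0 := by
      intro t
      have h1 := (h.hasFDerivWithinAt (hγK t)).comp_hasDerivWithinAt t
        ((hγd t).hasDerivWithinAt (s := univ)) (fun t _ => hγK t)
      have h2 : u ∘ γ = fun _ => 0 := funext fun t => h.eq_zero _ (hγr ▸ mem_range_self t)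
      rw [h2, hasDerivWithinAt_univ] at h1
      exact h1.unique (hasDerivAt_const t (0 : ℝ))
    have h1 := hcurve (fun t => γ (t₀ + t)) (fun t => deriv γ (t₀ + t)) (deriv (deriv γ) t₀) univ
      (mem_univ _) (fun t _ => hγK _) (by simp)
      (by simpa using (hγd (t₀ + 0)).comp_const_add t₀ 0)
      (by simpa using (hγd2 (t₀ + 0)).comp_const_add t₀ 0)
    simp only [hz, add_zero, hasDerivWithinAt_univ] at h1
    exact h1.unique (hasDerivAt_const 0 (0 : ℝ))
  have hτ0 : τ ≠ 0 := hγ' t₀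
  obtain ⟨z, hz, hdet⟩ : ∃ z ∈ Ω, τ.re * (z - γ t₀).im - τ.im * (z - γ t₀).re ≠ 0 := by
    obtain ⟨z₀, hz₀⟩ := h.nonempty
    by_cases hb : τ.re * (z₀ - γ t₀).im - τ.im * (z₀ - γ t₀).re = 0
    · have hc : Filter.Tendsto (fun t : ℝ => z₀ + t * (Complex.I * τ)) (nhds 0) (nhds z₀) := by
        have : Continuous (fun t : ℝ => z₀ + t * (Complex.I * τ)) := by fun_prop
        simpa using this.tendsto 0
      obtain ⟨r, hr, hr'⟩ := Metric.eventually_nhds_iff.1 (hc.eventually (h.isOpen.mem_nhds hz₀))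
      refine ⟨_, hr' (y := r / 2) (by
        rw [Real.dist_eq, sub_zero, abs_of_pos (by positivity)]; linarith), ?_⟩
      have h1 : 0 < τ.re ^ 2 + τ.im ^ 2 := by
        have := Complex.normSq_pos.2 hτ0
        rw [Complex.normSq_apply] at this
        nlinarith
      have h2 : τ.re * (z₀ + (r / 2 : ℝ) * (Complex.I * τ) - γ t₀).im
          - τ.im * (z₀ + (r / 2 : ℝ) * (Complex.I * τ) - γ t₀).re
          = r / 2 * (τ.re ^ 2 + τ.im ^ 2) := by
        simp only [Complex.sub_im, Complex.sub_re, Complex.add_im, Complex.add_re,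
          Complex.re_ofReal_mul, Complex.im_ofReal_mul, Complex.I_mul_re, Complex.I_mul_im]
          at hb ⊢
        linear_combination hb
      rw [h2]
      positivity
    · exact ⟨z₀, hz₀, hb⟩
  set d := z - γ t₀ with hd
  have hquad : ∀ s : ℝ, 0 ≤ B (s • τ + d) (s • τ + d) := by
    intro s
    set σ : ℝ → ℝ := fun t => t₀ + t * s
    have hσ : ∀ t, HasDerivAt σ s t := fun t =>
      (((hasDerivAt_id t).mul_const s).const_add t₀).congr_deriv (one_mul s)
    set c : ℝ → ℂ := fun t => γ (σ t) + t • (z - γ (σ t)) with hc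
    set c' : ℝ → ℂ := fun t => s • deriv γ (σ t) + ((z - γ (σ t)) - t • (s • deriv γ (σ t)))
      with hc'
    have hcd : ∀ t, HasDerivAt c (c' t) t := by
      intro t
      have h1 : HasDerivAt (fun t => γ (σ t)) (s • deriv γ (σ t)) t :=
        (hγd (σ t)).scomp t (hσ t)
      convert! h1.add ((hasDerivAt_id t).smul (h1.const_sub z)) using 1
      simp only [hc', id, one_smul, smul_neg]
      abel
    have hcd' : ∃ c'', HasDerivAt c' c'' 0 := by
      have h1 : HasDerivAt (fun t => γ (σ t)) (s • deriv γ (σ 0)) 0 :=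
        (hγd (σ 0)).scomp 0 (hσ 0)
      have h2 : HasDerivAt (fun t => deriv γ (σ t)) (s • deriv (deriv γ) (σ 0)) 0 :=
        (hγd2 (σ 0)).scomp 0 (hσ 0)
      exact ⟨_, (h2.const_smul s).add ((h1.const_sub z).sub
        ((hasDerivAt_id (0 : ℝ)).smul (h2.const_smul s)))⟩
    obtain ⟨c'', hc''⟩ := hcd'
    have hcK : MapsTo c (Icc 0 1) (closure Ω) := fun t ht => by
      have := h.convex_closure (hγK (σ t)) (subset_closure hz) (sub_nonneg.2 ht.2) ht.1
        (by ring)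
      convert! this using 1
      simp only [hc, sub_smul, smul_sub, one_smul]
      abel
    have hσ0 : σ 0 = t₀ := by simp [σ]
    have hc0 : c 0 = γ t₀ := by simp [hc, hσ0]
    have hc'0 : c' 0 = s • τ + d := by simp [hc', hσ0, hτ, hd]
    have huc : ∀ t ∈ Icc (0 : ℝ) 1, HasDerivWithinAt (fun t => u (c t))
        (grad Ω u (c t) (c' t)) (Icc 0 1) t := fun t ht =>
      (h.hasFDerivWithinAt (hcK ht)).comp_hasDerivWithinAt t (hcd t).hasDerivWithinAt hcK
    rw [← hc'0]
    refine nonneg_of_forall_le_of_hasDerivWithinAt (h := fun t => u (c t))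
      (h' := fun t => grad Ω u (c t) (c' t)) one_pos
      (fun t ht => (huc t ht).continuousWithinAt)
      (fun t ht => (huc t ⟨ht.1.le, ht.2.le⟩).hasDerivAt (Icc_mem_nhds ht.1 ht.2)) ?_ ?_ ?_
    · simp [hc0, hG]
    · have := hcurve c c' c'' (Icc 0 1) (by simp) hcK hc0 (hcd 0).hasDerivWithinAt
        hc''.hasDerivWithinAt
      exact this.mono_of_mem_nhdsWithin (Icc_mem_nhdsGE one_pos)
    · intro t ht
      simp only [hc0, h.eq_zero _ hy]
      exact h.nonneg (hcK ⟨ht.1.le, ht.2.le⟩)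
  have hexp : ∀ s : ℝ, B (s • τ + d) (s • τ + d) = B d d + s * (B τ d + B d τ) := by
    intro s
    simp only [map_add, map_smul, add_apply, smul_apply, hττ, smul_eq_mul]
    ring
  have hcross : B τ d + B d τ = 0 := by
    by_contra hne
    have h1 := hquad (-(B d d + 1) / (B τ d + B d τ))
    rw [hexp, div_mul_cancel₀ _ hne] at h1
    linarith
  have hdd : 0 ≤ B d d := by
    have := hquad 0
    simpa using this
  have hpsd : ∀ v, 0 ≤ B v v := by
    intro v
    set D := τ.re * d.im - τ.im * d.re with hD
    obtain ⟨a, b, hv⟩ : ∃ a b : ℝ, v = a • τ + b • d := by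
      refine ⟨(v.re * d.im - v.im * d.re) / D, (τ.re * v.im - τ.im * v.re) / D, ?_⟩
      apply Complex.ext <;> simp <;> field_simp <;> ring
    have : B v v = b ^ 2 * B d d := by
      rw [hv]
      simp only [map_add, map_smul, add_apply, smul_apply, hττ, smul_eq_mul]
      linear_combination a * b * hcross
    rw [this]
    positivity
  have heq := h.eqn_closure (hγK t₀)
  rw [hG, h.eq_zero _ hy] at heq
  have h1 : perp 0 = 0 := by apply Complex.ext <;> simp [perp]
  have h2 : areaElt 0 = 1 := by simp [areaElt]
  rw [h1, h2, one_pow, mul_one] at heq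
  have h3 : 0 ≤ ellip 0 B := add_nonneg (add_nonneg (hpsd _) (hpsd _)) (hpsd _)
  rw [hB, heq] at h3
  exact absurd h.f_zero_neg (not_lt.2 h3)

theorem interior_closure (h : IsPlanarSolution Ω f u) : interior (closure Ω) = Ω := by
  refine subset_antisymm (fun y hy => ?_) h.subset_interior
  by_contra hyΩ
  have hyf : y ∈ frontier Ω := ⟨interior_subset hy, by rwa [h.isOpen.interior_eq]⟩
  have hmin : IsLocalMin u y := by
    filter_upwards [mem_interior_iff_mem_nhds.1 hy] with x hx
    rw [h.eq_zero y hyf]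
    exact h.nonneg hx
  exact h.grad_ne_zero hyf ((grad_eq_fderiv hy).trans hmin.fderiv_eq_zero)

theorem convex (h : IsPlanarSolution Ω f u)
    : Convex ℝ Ω := h.interior_closure ▸ h.convex_closure.interior

theorem grad_apply_pos (h : IsPlanarSolution Ω f u) {y z : ℂ} (hy : y ∈ frontier Ω) (hz : z ∈ Ω) :
    0 < grad Ω u y (z - y) := by
  have hyK := frontier_subset_closure hy
  have hnn : ∀ z ∈ Ω, 0 ≤ grad Ω u y (z - y) := by
    intro z hz
    have hc : HasDerivWithinAt (fun t : ℝ => y + t • (z - y)) (z - y) (Icc 0 1) 0 := by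
      simpa using (((hasDerivAt_id (0 : ℝ)).smul_const (z - y)).const_add y).hasDerivWithinAt
    have hm : MapsTo (fun t : ℝ => y + t • (z - y)) (Icc 0 1) (closure Ω) := fun t ht =>
      h.convex_closure.add_smul_sub_mem hyK (subset_closure hz) ht
    have h0 : HasFDerivWithinAt u (grad Ω u y) (closure Ω) (y + (0 : ℝ) • (z - y)) := by
      simpa using h.hasFDerivWithinAt hyK
    have h1 := (h0.comp_hasDerivWithinAt 0 hc hm).mono_of_mem_nhdsWithin
      (Icc_mem_nhdsGE one_pos)
    have hmin : ∀ᶠ t in nhdsWithin (0 : ℝ) (Ioi 0),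
        0 ≤ slope (u ∘ fun t : ℝ => y + t • (z - y)) 0 t := by
      filter_upwards [Ioc_mem_nhdsGT one_pos] with t ht
      rw [slope_def_field]
      have := h.nonneg (hm ⟨ht.1.le, ht.2⟩)
      simp only [Function.comp, zero_smul, add_zero, h.eq_zero y hy, sub_zero]
      exact div_nonneg this ht.1.le
    rw [hasDerivWithinAt_iff_tendsto_slope, Ici_sdiff_left] at h1
    exact ge_of_tendsto h1 hmin
  refine (hnn z hz).lt_of_ne fun h0 => h.grad_ne_zero hy (ContinuousLinearMap.ext fun w => ?_)
  have hle : ∀ w, grad Ω u y w ≤ 0 := by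
    intro w
    have hc : Filter.Tendsto (fun t : ℝ => z - t • w) (nhds 0) (nhds z) := by
      have : Continuous (fun t : ℝ => z - t • w) := by fun_prop
      simpa using this.tendsto 0
    obtain ⟨r, hr, hr'⟩ := Metric.eventually_nhds_iff.1 (hc.eventually (h.isOpen.mem_nhds hz))
    have := hnn _ (hr' (y := r / 2) (by
      rw [Real.dist_eq, sub_zero, abs_of_pos (by positivity)]; linarith))
    rw [sub_right_comm, map_sub, ← h0, map_smul, smul_eq_mul] at this
    nlinarith
  have h1 := hle w
  have h2 := hle (-w)
  rw [map_neg] at h2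
  simp only [zero_apply]
  linarith

end IsPlanarSolution

/-- A nonzero linear form on the plane has a one-dimensional kernel. -/
theorem exists_smul_eq_of_apply_eq_zero {p : ℂ →L[ℝ] ℝ} (hp : p ≠ 0) {τ w : ℂ} (hτ0 : τ ≠ 0)
    (hτ : p τ = 0) (hw : p w = 0) : ∃ a : ℝ, w = a • τ := by
  have hexp : ∀ z : ℂ, p z = z.re * p 1 + z.im * p Complex.I := by
    intro z
    have h1 : z = z.re • (1 : ℂ) + z.im • Complex.I := by
      apply Complex.ext <;> simp
    calc p z = p (z.re • (1 : ℂ) + z.im • Complex.I) := congrArg p h1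
      _ = _ := by rw [map_add, map_smul, map_smul]; rfl
  rw [hexp] at hτ hw
  have hdet : τ.re * w.im = τ.im * w.re := by
    by_contra hne
    have hne' : τ.re * w.im - τ.im * w.re ≠ 0 := sub_ne_zero.2 hne
    have h1 : p 1 = 0 := by
      have : (τ.re * w.im - τ.im * w.re) * p 1 = 0 := by linear_combination w.im * hτ - τ.im * hw
      exact (mul_eq_zero.1 this).resolve_left hne'
    have h2 : p Complex.I = 0 := by
      have : (τ.re * w.im - τ.im * w.re) * p Complex.I = 0 := by
        linear_combination τ.re * hw - w.re * hτ
      exact (mul_eq_zero.1 this).resolve_left hne'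
    refine hp (ContinuousLinearMap.ext fun z => ?_)
    rw [hexp, h1, h2]
    simp
  have hn : τ.re ^ 2 + τ.im ^ 2 ≠ 0 := by
    have := Complex.normSq_pos.2 hτ0
    rw [Complex.normSq_apply] at this
    nlinarith
  refine ⟨(w.re * τ.re + w.im * τ.im) / (τ.re ^ 2 + τ.im ^ 2), ?_⟩
  apply Complex.ext
  · simp only [Complex.real_smul, Complex.re_ofReal_mul]
    field_simp
    linear_combination (-τ.im) * hdet
  · simp only [Complex.real_smul, Complex.im_ofReal_mul]
    field_simp
    linear_combination τ.re * hdet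

namespace IsPlanarSolution

variable {Ω : Set ℂ} {f : ℝ → ℝ} {u : ℂ → ℝ}

/-- From a boundary point where `u` increases in the direction `θ`, the direction `θ` points into
the domain. -/
theorem exists_add_smul_mem (h : IsPlanarSolution Ω f u)
    {y θ : ℂ} (hy : y ∈ frontier Ω) (hθ : 0 < grad Ω u y θ) :
    ∃ t > (0 : ℝ), y + t • θ ∈ Ω := by
  by_contra! hcon
  have hyΩ : y ∉ Ω := fun hyΩ => hy.2 (by rwa [h.isOpen.interior_eq])
  obtain ⟨γ, hγ, hγ', hγr⟩ := h.exists_param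
  obtain ⟨t₀, rfl⟩ : y ∈ range γ := hγr ▸ hy
  set y := γ t₀ with hy'
  have hγK : ∀ t, γ t ∈ closure Ω := fun t =>
    frontier_subset_closure (hγr ▸ mem_range_self t)
  have hγd : HasDerivAt γ (deriv γ t₀) t₀ := (hγ.differentiable (by norm_num) t₀).hasDerivAt
  have hGτ : grad Ω u y (deriv γ t₀) = 0 := by
    have h1 := (h.hasFDerivWithinAt (hγK t₀)).comp_hasDerivWithinAt t₀
      (hγd.hasDerivWithinAt (s := univ)) (fun t _ => hγK t)
    have h2 : u ∘ γ = fun _ => 0 := funext fun t => h.eq_zero _ (hγr ▸ mem_range_self t)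
    rw [h2, hasDerivWithinAt_univ] at h1
    exact h1.unique (hasDerivAt_const t₀ (0 : ℝ))
  have hray : Convex ℝ ((fun t : ℝ => y + t • θ) '' Ici 0) := by
    have h1 : (fun t : ℝ => y + t • θ) '' Ici 0
        = (fun z => y + z) '' ((LinearMap.toSpanSingleton ℝ ℂ θ) '' Ici 0) := by
      rw [image_image]; rfl
    rw [h1]
    exact ((convex_Ici 0).linear_image _).translate y
  obtain ⟨g, a, hg1, hg2⟩ := geometric_hahn_banach_open h.convex h.isOpen hray
    (disjoint_right.2 (by
      rintro _ ⟨t, ht, rfl⟩ hmem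
      rcases (mem_Ici.1 ht).eq_or_lt with h0 | h0
      · subst h0; simp at hmem; exact hyΩ hmem
      · exact hcon t h0 hmem))
  have hgy : a ≤ g y := by simpa using hg2 y ⟨0, by simp, by simp⟩
  have hgK : ∀ x ∈ closure Ω, g x ≤ a := fun x hx =>
    closure_minimal (fun x hx => (hg1 x hx).le) (isClosed_le g.continuous continuous_const) hx
  have hgya : g y = a := le_antisymm (hgK _ (hγK t₀)) hgy
  have hgθ : 0 ≤ g θ := by
    have := hg2 (y + (1 : ℝ) • θ) ⟨1, by simp, rfl⟩
    rw [one_smul, map_add, hgya] at this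
    linarith
  have hgτ : g (deriv γ t₀) = 0 := by
    have hmax : IsLocalMax (fun t => g (γ t)) t₀ := Filter.Eventually.of_forall fun t => by
      have := hgK _ (hγK t)
      change g (γ t) ≤ g y
      rwa [hgya]
    exact hmax.hasDerivAt_eq_zero (g.hasFDerivAt.comp_hasDerivAt t₀ hγd)
  obtain ⟨z, hz⟩ := h.nonempty
  have hGz := h.grad_apply_pos hy hz
  set b := grad Ω u y θ / grad Ω u y (z - y) with hb
  have hb0 : 0 < b := div_pos hθ hGz
  obtain ⟨r, hr⟩ := exists_smul_eq_of_apply_eq_zero (h.grad_ne_zero hy) (hγ' t₀) hGτ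
    (w := θ - b • (z - y)) (by
      rw [map_sub, map_smul, smul_eq_mul, hb, div_mul_cancel₀ _ hGz.ne', sub_self])
  have h1 : g θ = b * (g z - a) := by
    have : θ = r • deriv γ t₀ + b • (z - y) := by rw [← hr]; abel
    rw [this, map_add, map_smul, map_smul, hgτ, map_sub, hgya]
    simp
  have h2 := hg1 z hz
  nlinarith

/-- The part of the boundary on which `u` increases in the direction `θ` is connected. -/
theorem isPreconnected_frontier_pos (h : IsPlanarSolution Ω f u) {θ : ℂ} (hθ : θ ≠ 0) :
    IsPreconnected {y ∈ frontier Ω | 0 < grad Ω u y θ} := by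
  have hcont : ∀ x, Continuous (fun t : ℝ => x - t • θ) := fun x => by fun_prop
  have hθn : 0 < ‖θ‖ := norm_pos_iff.2 hθ
  obtain ⟨R, hR⟩ := h.isCompact_closure.isBounded.exists_norm_le
  have hbdd : ∀ x ∈ Ω, BddAbove {t : ℝ | x - t • θ ∈ closure Ω} := by
    intro x hx
    refine ⟨(R + R) / ‖θ‖, fun t ht => ?_⟩
    rw [le_div_iff₀ hθn]
    have h1 : t • θ = x - (x - t • θ) := by abel
    have h2 := norm_sub_le x (x - t • θ)
    rw [← h1, norm_smul, Real.norm_eq_abs] at h2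
    have h3 := hR _ (subset_closure hx)
    have h4 := hR _ ht
    nlinarith [le_abs_self t]
  set τ : ℂ → ℝ := fun x => sSup {t : ℝ | x - t • θ ∈ closure Ω} with hτ
  have hne : ∀ x ∈ Ω, {t : ℝ | x - t • θ ∈ closure Ω}.Nonempty := fun x hx =>
    ⟨0, by simpa using subset_closure hx⟩
  have hmem : ∀ x ∈ Ω, x - τ x • θ ∈ closure Ω := fun x hx =>
    (isClosed_closure.preimage (hcont x)).csSup_mem (hne x hx) (hbdd x hx)
  have hconc : ConcaveOn ℝ Ω τ := by
    refine ⟨h.convex, fun x hx y hy a b ha hb hab => ?_⟩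
    refine le_csSup (hbdd _ (h.convex hx hy ha hb hab)) ?_
    have := h.convex_closure (hmem x hx) (hmem y hy) ha hb hab
    change _ ∈ closure Ω
    convert! this using 1
    simp only [smul_sub, add_smul, smul_smul, smul_eq_mul]
    abel
  have hτc : ContinuousOn τ Ω := hconc.continuousOn h.isOpen
  have himg : {y ∈ frontier Ω | 0 < grad Ω u y θ} = (fun x => x - τ x • θ) '' Ω := by
    ext y
    constructor
    · rintro ⟨hy, hpos⟩
      obtain ⟨t, ht, hmemt⟩ := h.exists_add_smul_mem hy hpos
      refine ⟨_, hmemt, ?_⟩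
      have hyΩ : y ∉ Ω := fun hyΩ => hy.2 (by rwa [h.isOpen.interior_eq])
      have hτt : τ (y + t • θ) = t := by
        refine le_antisymm (csSup_le (hne _ hmemt) fun s hs => ?_)
          (le_csSup (hbdd _ hmemt) (by simpa using frontier_subset_closure hy))
        by_contra! hlt
        have hs0 : 0 < s := ht.trans hlt
        have h1 : y ∈ interior (closure Ω) := by
          have := h.convex_closure.combo_interior_self_mem_interior
            (h.subset_interior hmemt) hs (a := (s - t) / s) (b := t / s)
            (div_pos (by linarith) hs0) (by positivity) (by field_simp; ring)
          convert! this using 1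
          have e1 : ((s - t) / s) • (y + t • θ) + (t / s) • (y + t • θ - s • θ)
              = ((s - t) / s + t / s) • y + (((s - t) / s + t / s) * t - t / s * s) • θ := by
            simp only [smul_add, smul_sub, smul_smul, add_smul, sub_smul, add_mul]
            abel
          rw [e1]
          have e2 : (s - t) / s + t / s = 1 := by field_simp; ring
          have e3 : t / s * s = t := by field_simp
          rw [e2, e3]
          simp
        rw [h.interior_closure] at h1
        exact hyΩ h1
      simp only [hτt, add_sub_cancel_right]
    · rintro ⟨x, hx, rfl⟩
      have hpos : 0 < τ x := by
        have h1 : ∀ᶠ t in nhds (0 : ℝ), x - t • θ ∈ Ω :=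
          (hcont x).tendsto 0 |>.eventually (h.isOpen.mem_nhds (by simpa using hx))
        obtain ⟨r, hr, hr'⟩ := Metric.eventually_nhds_iff.1 h1
        refine (half_pos hr).trans_le (le_csSup (hbdd x hx) (subset_closure (hr' ?_)))
        rw [Real.dist_eq, sub_zero, abs_of_pos (by positivity)]; linarith
      have hnot : x - τ x • θ ∉ Ω := by
        intro hin
        have h1 : ∀ᶠ t in nhds (τ x), x - t • θ ∈ Ω :=
          (hcont x).tendsto _ |>.eventually (h.isOpen.mem_nhds hin)
        obtain ⟨r, hr, hr'⟩ := Metric.eventually_nhds_iff.1 h1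
        have h2 := le_csSup (hbdd x hx) (subset_closure (hr' (y := τ x + r / 2) (by
          rw [Real.dist_eq, add_sub_cancel_left, abs_of_pos (by positivity)]; linarith)))
        change τ x + r / 2 ≤ τ x at h2
        linarith
      have hfr : x - τ x • θ ∈ frontier Ω := ⟨hmem x hx, by rwa [h.isOpen.interior_eq]⟩
      refine ⟨hfr, ?_⟩
      have h1 := h.grad_apply_pos hfr hx
      rw [sub_sub_cancel, map_smul, smul_eq_mul] at h1
      exact pos_of_mul_pos_right h1 hpos.le
  rw [himg]
  exact h.convex.isPreconnected.image _ (continuousOn_id.sub (hτc.smul continuousOn_const))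

end IsPlanarSolution

theorem norm_perp_le (p : ℂ →L[ℝ] ℝ) : ‖perp p‖ ≤ 2 * ‖p‖ := by
  have h1 : |p 1| ≤ ‖p‖ := by simpa using p.le_opNorm 1
  have h2 : |p Complex.I| ≤ ‖p‖ := by simpa using p.le_opNorm Complex.I
  have := Complex.norm_le_abs_re_add_abs_im (perp p)
  simp only [perp, abs_neg] at this ⊢
  linarith

theorem HasDerivAt.perp {p : ℝ → ℂ →L[ℝ] ℝ} {q : ℂ →L[ℝ] ℝ} {t : ℝ} (hp : HasDerivAt p q t) :
    HasDerivAt (fun t => _root_.perp (p t)) (_root_.perp q) t := by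
  have e : ∀ p : ℂ →L[ℝ] ℝ, _root_.perp p = p Complex.I • (1 : ℂ) - p 1 • Complex.I := fun p => by
    apply Complex.ext <;> simp [_root_.perp]
  simp only [e]
  have h1 : ∀ v, HasDerivAt (fun t => p t v) (q v) t := fun v => by
    simpa using hp.clm_apply (hasDerivAt_const t v)
  exact ((h1 _).smul_const _).sub ((h1 _).smul_const _)

theorem HasDerivAt.areaElt_pow_three {p : ℝ → ℂ →L[ℝ] ℝ} {q : ℂ →L[ℝ] ℝ} {t : ℝ}
    (hp : HasDerivAt p q t) :
    HasDerivAt (fun t => areaElt (p t) ^ 3)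
      (3 * areaElt (p t) * (p t 1 * q 1 + p t Complex.I * q Complex.I)) t := by
  have h1 : ∀ v, HasDerivAt (fun t => p t v) (q v) t := fun v => by
    simpa using hp.clm_apply (hasDerivAt_const t v)
  have hW := one_le_areaElt (p t)
  have h2 := ((((h1 1).pow 2).add ((h1 Complex.I).pow 2)).const_add 1).sqrt
    (show (1 + (p t 1 ^ 2 + p t Complex.I ^ 2)) ≠ 0 by positivity)
  have h3 := h2.pow 3
  refine h3.congr_deriv ?_
  change _ * areaElt (p t) ^ _ * (_ / (2 * areaElt (p t))) = _
  have : areaElt (p t) ≠ 0 := by positivity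
  field_simp
  push_cast
  ring

namespace IsPlanarSolution

variable {Ω : Set ℂ} {f : ℝ → ℝ} {u : ℂ → ℝ}

theorem contDiffAt_fderiv (h : IsPlanarSolution Ω f u)
    {x : ℂ} (hx : x ∈ Ω) : ContDiffAt ℝ 2 (fderiv ℝ u) x :=
  (h.analytic x hx).fderiv.contDiffAt

theorem hasFDerivAt_fderiv_apply (h : IsPlanarSolution Ω f u) {x : ℂ} (hx : x ∈ Ω) (θ : ℂ) :
    HasFDerivAt (fun y => fderiv ℝ u y θ) (fderiv ℝ (fderiv ℝ u) x θ) x := by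
  have h1 := (h.contDiffAt hx).hasFDerivAt_fderiv.clm_apply (hasFDerivAt_const θ x)
  refine h1.congr_fderiv (ContinuousLinearMap.ext fun w => ?_)
  have hs := (h.contDiffAt hx).isSymmSndFDerivAt (by simp) w θ
  simpa using hs

theorem fderiv_fderiv_apply (h : IsPlanarSolution Ω f u) {x : ℂ} (hx : x ∈ Ω) (θ : ℂ) :
    fderiv ℝ (fderiv ℝ fun y => fderiv ℝ u y θ) x = fderiv ℝ (fderiv ℝ (fderiv ℝ u)) x θ := by
  have h1 : fderiv ℝ (fun y => fderiv ℝ u y θ) =ᶠ[nhds x] fun y => fderiv ℝ (fderiv ℝ u) y θ := by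
    filter_upwards [h.isOpen.mem_nhds hx] with y hy using (h.hasFDerivAt_fderiv_apply hy θ).fderiv
  rw [h1.fderiv_eq]
  have h2 := (h.analytic x hx).fderiv.fderiv.differentiableAt.hasFDerivAt.clm_apply (hasFDerivAt_const θ x)
  rw [h2.fderiv]
  ext w : 1
  have hs := (h.contDiffAt_fderiv hx).isSymmSndFDerivAt (by simp) w θ
  simpa using hs

/-- The equation satisfied by the directional derivatives of a solution. -/
theorem linearized (h : IsPlanarSolution Ω f u) {x : ℂ} (hx : x ∈ Ω) (θ : ℂ) :
    ellip (perp (fderiv ℝ u x)) (fderiv ℝ (fderiv ℝ fun y => fderiv ℝ u y θ) x)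
      - deriv f (u x) * areaElt (fderiv ℝ u x) ^ 3 * fderiv ℝ u x θ
    = f (u x) * (3 * areaElt (fderiv ℝ u x) *
        (fderiv ℝ u x 1 * fderiv ℝ (fun y => fderiv ℝ u y θ) x 1
          + fderiv ℝ u x Complex.I * fderiv ℝ (fun y => fderiv ℝ u y θ) x Complex.I))
      - (fderiv ℝ (fderiv ℝ u) x (perp (fderiv ℝ (fun y => fderiv ℝ u y θ) x))
            (perp (fderiv ℝ u x))
        + fderiv ℝ (fderiv ℝ u) x (perp (fderiv ℝ u x))
            (perp (fderiv ℝ (fun y => fderiv ℝ u y θ) x))) := by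
  rw [h.fderiv_fderiv_apply hx, (h.hasFDerivAt_fderiv_apply hx θ).fderiv]
  have hl : HasDerivAt (fun t : ℝ => x + t • θ) θ 0 := by
    simpa using ((hasDerivAt_id (0 : ℝ)).smul_const θ).const_add x
  have hx0 : x + (0 : ℝ) • θ = x := by simp
  have hp : HasDerivAt (fun t : ℝ => fderiv ℝ u (x + t • θ)) (fderiv ℝ (fderiv ℝ u) x θ) 0 := by
    have := (h.contDiffAt hx).hasFDerivAt_fderiv
    rw [← hx0] at this
    exact (this.comp_hasDerivAt (0 : ℝ) hl).congr_deriv (by rw [hx0])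
  have hH : HasDerivAt (fun t : ℝ => fderiv ℝ (fderiv ℝ u) (x + t • θ))
      (fderiv ℝ (fderiv ℝ (fderiv ℝ u)) x θ) 0 := by
    have := (h.analytic x hx).fderiv.fderiv.differentiableAt.hasFDerivAt
    rw [← hx0] at this
    exact (this.comp_hasDerivAt (0 : ℝ) hl).congr_deriv (by rw [hx0])
  have hu : HasDerivAt (fun t : ℝ => u (x + t • θ)) (fderiv ℝ u x θ) 0 := by
    have := ((h.contDiffAt hx).differentiableAt (by norm_num)).hasFDerivAt
    rw [← hx0] at this
    exact (this.comp_hasDerivAt (0 : ℝ) hl).congr_deriv (by rw [hx0])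
  have hf : HasDerivAt (fun t : ℝ => f (u (x + t • θ))) (deriv f (u x) * fderiv ℝ u x θ) 0 := by
    have h1 : HasDerivAt f (deriv f (u x)) (u (x + (0 : ℝ) • θ)) := by
      rw [hx0]; exact (h.contDiff.differentiable (by norm_num) _).hasDerivAt
    exact h1.comp 0 hu
  have hη := hp.perp
  have hL := (((hH.clm_apply (hasDerivAt_const 0 (1 : ℂ))).clm_apply
    (hasDerivAt_const 0 (1 : ℂ))).add ((hH.clm_apply (hasDerivAt_const 0 Complex.I)).clm_apply
    (hasDerivAt_const 0 Complex.I))).add ((hH.clm_apply hη).clm_apply hη)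
  have hR := hf.mul hp.areaElt_pow_three
  have heq : (fun t : ℝ => ellip (perp (fderiv ℝ u (x + t • θ)))
        (fderiv ℝ (fderiv ℝ u) (x + t • θ)))
      =ᶠ[nhds 0] fun t : ℝ => f (u (x + t • θ)) * areaElt (fderiv ℝ u (x + t • θ)) ^ 3 := by
    have h1 : ∀ᶠ t in nhds (0 : ℝ), x + t • θ ∈ Ω :=
      hl.continuousAt.eventually (h.isOpen.mem_nhds (by simpa using hx))
    filter_upwards [h1] with t ht using h.eqn _ ht
  have := (hR.congr_of_eventuallyEq heq).unique hL
  simp only [map_zero, add_zero, zero_smul, add_apply] at this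
  unfold ellip
  linear_combination -this

theorem exists_linearized_bound (h : IsPlanarSolution Ω f u) : ∃ β ≥ (0 : ℝ), ∀ θ, ∀ x ∈ Ω,
    |ellip (perp (fderiv ℝ u x)) (fderiv ℝ (fderiv ℝ fun y => fderiv ℝ u y θ) x)
      - deriv f (u x) * areaElt (fderiv ℝ u x) ^ 3 * fderiv ℝ u x θ|
    ≤ β * ‖fderiv ℝ (fun y => fderiv ℝ u y θ) x‖ := by
  have hG := h.continuousOn_grad
  have hHn : ContinuousOn (fun x => ‖hess Ω u x‖) (closure Ω) :=
    (continuous_norm (E := ℂ →L[ℝ] ℂ →L[ℝ] ℝ)).comp_continuousOn h.continuousOn_hess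
  have hc : ContinuousOn (fun x => 6 * |f (u x)| * areaElt (grad Ω u x) * ‖grad Ω u x‖
      + 8 * ‖hess Ω u x‖ * ‖grad Ω u x‖) (closure Ω) := by
    refine (((continuousOn_const.mul
      (h.contDiff.continuous.comp_continuousOn h.contDiffOn.continuousOn).abs).mul
      (continuous_areaElt.comp_continuousOn hG)).mul hG.norm).add
      ((continuousOn_const.mul hHn).mul hG.norm)
  obtain ⟨β, hβ⟩ := h.isCompact_closure.exists_bound_of_continuousOn hc
  refine ⟨max β 0, le_max_right _ _, fun θ x hx => ?_⟩
  rw [h.linearized hx]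
  set q := fderiv ℝ (fun y => fderiv ℝ u y θ) x
  have hb := (le_abs_self _).trans (hβ x (subset_closure hx))
  rw [grad_eq_fderiv (h.subset_interior hx), h.hess_eq hx] at hb
  set p := fderiv ℝ u x
  set H := fderiv ℝ (fderiv ℝ u) x
  have hW := one_le_areaElt p
  have hn : ∀ r : ℂ →L[ℝ] ℝ, |r 1| ≤ ‖r‖ ∧ |r Complex.I| ≤ ‖r‖ := fun r =>
    ⟨by simpa using r.le_opNorm 1, by simpa using r.le_opNorm Complex.I⟩
  have hH : ∀ a b, |H a b| ≤ ‖H‖ * ‖a‖ * ‖b‖ := fun a b => H.le_opNorm₂ a b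
  have h1 : |p 1 * q 1 + p Complex.I * q Complex.I| ≤ 2 * (‖p‖ * ‖q‖) := by
    have e1 := mul_le_mul (hn p).1 (hn q).1 (abs_nonneg _) (norm_nonneg _)
    have e2 := mul_le_mul (hn p).2 (hn q).2 (abs_nonneg _) (norm_nonneg _)
    rw [← abs_mul] at e1 e2
    have := abs_add_le (p 1 * q 1) (p Complex.I * q Complex.I)
    linarith
  have h2 : ∀ a b : ℂ →L[ℝ] ℝ, |H (perp a) (perp b)| ≤ 4 * (‖H‖ * ‖a‖ * ‖b‖) := fun a b => by
    refine (hH _ _).trans ?_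
    have e1 := norm_perp_le a
    have e2 := norm_perp_le b
    calc ‖H‖ * ‖perp a‖ * ‖perp b‖ ≤ ‖H‖ * (2 * ‖a‖) * (2 * ‖b‖) := by gcongr
      _ = _ := by ring
  have h3 : |f (u x) * (3 * areaElt p * (p 1 * q 1 + p Complex.I * q Complex.I))|
      ≤ |f (u x)| * (3 * areaElt p * (2 * (‖p‖ * ‖q‖))) := by
    rw [abs_mul, abs_mul, abs_of_nonneg (by positivity : 0 ≤ 3 * areaElt p)]
    gcongr
  refine (abs_sub _ _).trans ?_
  have h4 := abs_add_le (H (perp q) (perp p)) (H (perp p) (perp q))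
  have h5 := h2 q p
  have h6 := h2 p q
  calc _ ≤ (6 * |f (u x)| * areaElt p * ‖p‖ + 8 * ‖H‖ * ‖p‖) * ‖q‖ := by
        nlinarith
    _ ≤ _ := by gcongr; exact le_max_of_le_left hb

end IsPlanarSolution

namespace IsPlanarSolution

variable {Ω : Set ℂ} {f : ℝ → ℝ} {u : ℂ → ℝ}

theorem fderiv_eventuallyEq_grad (h : IsPlanarSolution Ω f u) {x : ℂ} (hx : x ∈ Ω) (θ : ℂ) :
    (fun y => grad Ω u y θ) =ᶠ[nhds x] fun y => fderiv ℝ u y θ := by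
  filter_upwards [h.isOpen.mem_nhds hx] with y hy
  rw [grad_eq_fderiv (h.subset_interior hy)]

theorem analyticAt_fderiv_apply (h : IsPlanarSolution Ω f u) {x : ℂ} (hx : x ∈ Ω) (θ : ℂ) :
    AnalyticAt ℝ (fun y => fderiv ℝ u y θ) x :=
  (ContinuousLinearMap.apply ℝ ℝ θ).analyticAt _ |>.comp (h.analytic x hx).fderiv

theorem exists_isMaxOn (h : IsPlanarSolution Ω f u) : ∃ x ∈ Ω, IsMaxOn u (closure Ω) x := by
  obtain ⟨z, hz⟩ := h.nonempty
  obtain ⟨x, hx, hmax⟩ := h.isCompact_closure.exists_isMaxOn ⟨z, subset_closure hz⟩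
    h.contDiffOn.continuousOn
  refine ⟨x, ?_, hmax⟩
  by_contra hxΩ
  have h1 := h.eq_zero x ⟨hx, by rwa [h.isOpen.interior_eq]⟩
  have h2 := hmax (subset_closure hz)
  have h3 := h.pos z hz
  simp only [mem_ofPred_eq] at h2
  linarith

theorem eqn_of_fderiv_eq_zero (h : IsPlanarSolution Ω f u)
    {x : ℂ} (hx : x ∈ Ω) (h0 : fderiv ℝ u x = 0) :
    fderiv ℝ (fderiv ℝ u) x 1 1 + fderiv ℝ (fderiv ℝ u) x Complex.I Complex.I = f (u x) := by
  have h1 := h.eqn x hx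
  have h2 : perp 0 = 0 := by apply Complex.ext <;> simp [perp]
  have h3 : areaElt 0 = 1 := by simp [areaElt]
  simpa [h0, h2, h3, ellip] using h1

theorem f_nonpos (h : IsPlanarSolution Ω f u) {x : ℂ} (hx : x ∈ Ω) : f (u x) ≤ 0 := by
  obtain ⟨m, hm, hmax⟩ := h.exists_isMaxOn
  refine (h.monotone (hmax (subset_closure hx))).trans ?_
  have hl : IsLocalMax u m :=
    (hmax.on_subset subset_closure).isLocalMax (h.isOpen.mem_nhds hm)
  have h1 := hl.fderiv_fderiv_nonpos (h.contDiffAt hm)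
  rw [← h.eqn_of_fderiv_eq_zero hm hl.fderiv_eq_zero]
  exact add_nonpos (h1 1) (h1 Complex.I)

/-- The sets where `u` increases in a given direction are connected. -/
theorem isPreconnected_fderiv_pos (h : IsPlanarSolution Ω f u) {θ : ℂ} (hθ : θ ≠ 0) :
    IsPreconnected {x ∈ Ω | 0 < fderiv ℝ u x θ} := by
  obtain ⟨β, hβ, hL⟩ := h.exists_linearized_bound
  have h1 := isPreconnected_pos_of_le_ellip h.isOpen h.isBounded h.convex
    (V := fun y => grad Ω u y θ) (η := fun x => perp (fderiv ℝ u x))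
    (c := fun x => deriv f (u x) * areaElt (fderiv ℝ u x) ^ 3) (β := β)
    (h.continuousOn_grad.clm_apply continuousOn_const)
    (fun x hx => (h.analyticAt_fderiv_apply hx θ).contDiffAt.congr_of_eventuallyEq
      (h.fderiv_eventuallyEq_grad hx θ)) hβ
    (fun x hx => mul_nonneg h.monotone.deriv_nonneg
      (pow_nonneg (zero_le_one.trans (one_le_areaElt _)) 3))
    (fun x hx => by
      have e := h.fderiv_eventuallyEq_grad hx θ
      have := hL θ x hx
      rw [e.fderiv.fderiv_eq, e.fderiv_eq, grad_eq_fderiv (h.subset_interior hx)]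
      linarith [neg_le_of_abs_le this])
    (h.isPreconnected_frontier_pos hθ)
  convert! h1 using 1
  ext x
  refine and_congr_right fun hx => ?_
  rw [grad_eq_fderiv (h.subset_interior hx)]

/-- The sublevel sets of `u` are connected. -/
theorem isPreconnected_lt (h : IsPlanarSolution Ω f u)
    {c : ℝ} (hc : 0 < c) : IsPreconnected {x ∈ Ω | u x < c} := by
  have e1 : fderiv ℝ (fun y => c - u y) = fun y => -fderiv ℝ u y := by
    ext1 y; exact fderiv_const_sub c
  have h1 := isPreconnected_pos_of_le_ellip h.isOpen h.isBounded h.convex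
    (V := fun y => c - u y) (η := fun x => perp (fderiv ℝ u x))
    (c := fun _ => 0) (β := 0)
    (continuousOn_const.sub h.contDiffOn.continuousOn)
    (fun x hx => contDiffAt_const.sub (h.contDiffAt hx)) le_rfl (fun _ _ => le_rfl)
    (fun x hx => by
      rw [e1, fderiv_fun_neg]
      have h2 := h.eqn x hx
      have h3 : f (u x) * areaElt (fderiv ℝ u x) ^ 3 ≤ 0 :=
        mul_nonpos_of_nonpos_of_nonneg (h.f_nonpos hx)
          (pow_nonneg (zero_le_one.trans (one_le_areaElt _)) 3)
      simp only [ellip, neg_apply] at h2 ⊢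
      linarith)
    (by
      have : {y ∈ frontier Ω | 0 < c - u y} = frontier Ω := by
        ext y
        refine ⟨fun hy => hy.1, fun hy => ⟨hy, ?_⟩⟩
        rw [h.eq_zero y hy]; linarith
      rw [this]
      obtain ⟨γ, hγ, -, hγr⟩ := h.exists_param
      rw [← hγr]
      exact isPreconnected_range hγ.continuous)
  simpa only [sub_pos] using h1

/-- A directional derivative of `u` does not vanish on an open set. -/
theorem not_eventually_fderiv_apply_eq_zero (h : IsPlanarSolution Ω f u)
    {x θ : ℂ} (hx : x ∈ Ω) (hθ : θ ≠ 0) :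
    ¬ ∀ᶠ y in nhds x, fderiv ℝ u y θ = 0 := by
  intro hev
  have h1 : EqOn (fun y => fderiv ℝ u y θ) 0 Ω :=
    AnalyticOnNhd.eqOn_zero_of_preconnected_of_eventuallyEq_zero
      (fun y hy => h.analyticAt_fderiv_apply hy θ) h.convex.isPreconnected hx hev
  have h2 : EqOn (fun y => grad Ω u y θ) 0 (closure Ω) :=
    EqOn.of_subset_closure (s := Ω) (fun y hy => by
      simpa [grad_eq_fderiv (h.subset_interior hy)] using h1 hy)
      (h.continuousOn_grad.clm_apply continuousOn_const) continuousOn_const subset_closure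
      subset_rfl
  obtain ⟨R, hR⟩ := h.isBounded.exists_norm_le
  have hθn : 0 < ‖θ‖ := norm_pos_iff.2 hθ
  have hc : Continuous fun t : ℝ => x + t • θ := by fun_prop
  obtain ⟨t, ht⟩ : (frontier ((fun t : ℝ => x + t • θ) ⁻¹' Ω)).Nonempty := by
    refine nonempty_frontier_iff.2 ⟨⟨0, by simpa using hx⟩, fun huniv => ?_⟩
    have hmem : (R + ‖x‖ + 1) / ‖θ‖ ∈ (fun t : ℝ => x + t • θ) ⁻¹' Ω := huniv ▸ mem_univ _
    have h3 := hR _ hmem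
    have h4 := norm_sub_le (x + ((R + ‖x‖ + 1) / ‖θ‖) • θ) x
    have h5 : 0 ≤ R := (norm_nonneg _).trans h3
    rw [add_sub_cancel_left, norm_smul, Real.norm_of_nonneg (by positivity),
      div_mul_cancel₀ _ hθn.ne'] at h4
    linarith
  have hy := hc.frontier_preimage_subset Ω ht
  have h3 := h.grad_apply_pos hy hx
  have h4 : x - (x + t • θ) = (-t) • θ := by rw [neg_smul]; abel
  have h5 := h2 (frontier_subset_closure hy)
  simp only [Pi.zero_apply] at h5
  rw [h4, map_smul, h5, smul_zero] at h3
  exact lt_irrefl _ h3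

end IsPlanarSolution

/-- The function `g` has a power series at `x` starting at order `k`. -/
def VanishesToOrder {E F : Type*} [NormedAddCommGroup E] [NormedSpace ℝ E] [NormedAddCommGroup F]
    [NormedSpace ℝ F] (k : ℕ) (g : E → F) (x : E) : Prop :=
  ∃ p : FormalMultilinearSeries ℝ E F, HasFPowerSeriesAt g p x ∧ ∀ n < k, p n = 0

section

variable {E F : Type*} [NormedAddCommGroup E] [NormedSpace ℝ E] [NormedAddCommGroup F]
  [NormedSpace ℝ F]

theorem VanishesToOrder.isBigO {k : ℕ} {g : E → F} {x : E} (hg : VanishesToOrder k g x) :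
    (fun y => g (x + y)) =O[nhds 0] fun y => ‖y‖ ^ k := by
  obtain ⟨p, hp, hk⟩ := hg
  refine (hp.isBigO_sub_partialSum_pow k).congr_left fun y => ?_
  rw [FormalMultilinearSeries.partialSum, Finset.sum_eq_zero, sub_zero]
  intro n hn
  rw [hk n (Finset.mem_range.1 hn), zero_apply]

theorem VanishesToOrder.fderiv [CompleteSpace F] {k : ℕ} {g : E → F} {x : E}
    (hg : VanishesToOrder (k + 1) g x) : VanishesToOrder k (fderiv ℝ g) x := by
  obtain ⟨p, ⟨r, hp⟩, hk⟩ := hg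
  refine ⟨p.derivSeries, ⟨r, hp.fderiv⟩, fun n hn => ?_⟩
  have h1 : p.changeOriginSeries 1 n = 0 := by
    rw [FormalMultilinearSeries.changeOriginSeries]
    refine Finset.sum_eq_zero fun s _ => ?_
    have h2 : ‖p.changeOriginSeriesTerm 1 n s s.2‖ = 0 := by
      rw [FormalMultilinearSeries.norm_changeOriginSeriesTerm, hk (1 + n) (by omega), norm_zero]
    exact (norm_eq_zero (E := E [×n]→L[ℝ] E [×1]→L[ℝ] F)).1 h2
  ext v
  simp [FormalMultilinearSeries.derivSeries, h1]

theorem HasFPowerSeriesAt.vanishesToOrder_sub_partialSum {g : E → F}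
    {p : FormalMultilinearSeries ℝ E F} {x : E} (hp : HasFPowerSeriesAt g p x) (N : ℕ) :
    VanishesToOrder N (fun y => g y - p.partialSum N (y - x)) x := by
  obtain ⟨r, hp⟩ := hp
  refine ⟨fun n => if n < N then 0 else p n, ⟨r, ?_, hp.r_pos, fun {y} hy => ?_⟩,
    fun n hn => if_pos hn⟩
  · refine hp.r_le.trans (FormalMultilinearSeries.radius_le_of_le fun n => ?_)
    split_ifs <;> simp
  · have h1 : HasSum (fun n => if n < N then p n (fun _ => y) else 0) (p.partialSum N y) := by
      have : HasSum (fun n => if n < N then p n (fun _ => y) else 0)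
          (∑ n ∈ Finset.range N, if n < N then p n (fun _ => y) else 0) :=
        hasSum_sum_of_ne_finset_zero fun n hn => if_neg (by simpa using hn)
      convert! this using 1
      exact Finset.sum_congr rfl fun n hn => (if_pos (Finset.mem_range.1 hn)).symm
    convert! (hp.hasSum hy).sub h1 using 1
    · ext n
      split_ifs <;> simp
    · simp

/-- An analytic function which is not locally zero has a leading homogeneous term. -/
theorem AnalyticAt.exists_leading_term {g : E → F} (hg : AnalyticAt ℝ g 0)
    (h0 : ¬ ∀ᶠ y in nhds 0, g y = 0) :
    ∃ (m : ℕ) (q : ContinuousMultilinearMap ℝ (fun _ : Fin m => E) F) (v : E),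
      q (fun _ => v) ≠ 0 ∧ VanishesToOrder m g 0 ∧
      VanishesToOrder (m + 1) (fun y => g y - q fun _ => y) 0 := by
  obtain ⟨p, hp⟩ := hg
  have hex : ∃ m, ∃ v, p m (fun _ => v) ≠ 0 := by
    by_contra! hz
    refine h0 ?_
    filter_upwards [hp.eventually_hasSum] with y hy
    simp only [hz, zero_add] at hy
    exact hy.unique hasSum_zero
  classical
  obtain ⟨v, hv⟩ := Nat.find_spec hex
  have hlt : ∀ n < Nat.find hex, ∀ y, p n (fun _ => y) = 0 := fun n hn => by
    simpa using Nat.find_min hex hn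
  set m := Nat.find hex
  refine ⟨m, p m, v, hv, ?_, ?_⟩
  · convert! hp.vanishesToOrder_sub_partialSum m using 1
    ext y
    rw [FormalMultilinearSeries.partialSum, Finset.sum_eq_zero, sub_zero]
    exact fun n hn => hlt n (Finset.mem_range.1 hn) _
  · convert! hp.vanishesToOrder_sub_partialSum (m + 1) using 1
    ext y
    rw [FormalMultilinearSeries.partialSum, Finset.sum_range_succ, Finset.sum_eq_zero, zero_add,
      sub_zero]
    exact fun n hn => hlt n (Finset.mem_range.1 hn) _

end

section

open Filter Topology Asymptotics

theorem eq_zero_of_pow_smul_isLittleO {F : Type*} [NormedAddCommGroup F] [NormedSpace ℝ F] {j : ℕ}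
    {c : F} (hc : (fun t : ℝ => t ^ j • c) =o[𝓝[>] 0] fun t => t ^ j) : c = 0 := by
  by_contra hne
  have hc0 : 0 < ‖c‖ := norm_pos_iff.2 hne
  obtain ⟨t, ht, ht0⟩ := ((hc.def (half_pos hc0)).and self_mem_nhdsWithin).exists
  have ht0 : (0 : ℝ) < t := ht0
  rw [norm_smul] at ht
  have : 0 < ‖t ^ j‖ := norm_pos_iff.2 (by positivity)
  nlinarith

theorem pow_succ_isLittleO_pow (j : ℕ) :
    (fun t : ℝ => t ^ (j + 1)) =o[𝓝[>] 0] fun t => t ^ j :=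
  (isLittleO_pow_pow (lt_add_one j)).mono nhdsWithin_le_nhds

/-- Solutions of the harmonic oscillator equation. -/
theorem exists_eq_mul_cos_of_hasDerivAt {g g' : ℝ → ℝ} {m : ℝ} (hm : m ≠ 0)
    (hg : ∀ t, HasDerivAt g (g' t) t) (hg' : ∀ t, HasDerivAt g' (-(m ^ 2 * g t)) t) :
    ∃ R φ : ℝ, 0 ≤ R ∧ ∀ t, g t = R * Real.cos (m * (t - φ)) := by
  have hcos : ∀ t, HasDerivAt (fun t => Real.cos (m * t)) (-(m * Real.sin (m * t))) t := fun t =>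
    ((((hasDerivAt_id t).const_mul m).cos)).congr_deriv (by simp; ring)
  have hsin : ∀ t, HasDerivAt (fun t => Real.sin (m * t)) (m * Real.cos (m * t)) t := fun t =>
    ((((hasDerivAt_id t).const_mul m).sin)).congr_deriv (by simp; ring)
  have hA : ∀ t, HasDerivAt (fun t => g t * Real.cos (m * t) - g' t / m * Real.sin (m * t)) 0 t :=
    fun t => (((hg t).mul (hcos t)).sub (((hg' t).div_const m).mul (hsin t))).congr_deriv (by
      field_simp; ring)
  have hB : ∀ t, HasDerivAt (fun t => g t * Real.sin (m * t) + g' t / m * Real.cos (m * t)) 0 t :=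
    fun t => (((hg t).mul (hsin t)).add (((hg' t).div_const m).mul (hcos t))).congr_deriv (by
      field_simp; ring)
  have hA' := fun t => is_const_of_deriv_eq_zero (fun t => (hA t).differentiableAt)
    (fun t => (hA t).deriv) t 0
  have hB' := fun t => is_const_of_deriv_eq_zero (fun t => (hB t).differentiableAt)
    (fun t => (hB t).deriv) t 0
  set z : ℂ := ⟨g 0, g' 0 / m⟩ with hz
  refine ⟨‖z‖, z.arg / m, norm_nonneg _, fun t => ?_⟩
  have h1 := hA' t
  have h2 := hB' t
  simp only [mul_zero, Real.cos_zero, Real.sin_zero, mul_one, sub_zero, zero_add] at h1 h2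
  have h3 : ‖z‖ * Real.cos z.arg = g 0 := Complex.norm_mul_cos_arg z
  have h4 : ‖z‖ * Real.sin z.arg = g' 0 / m := Complex.norm_mul_sin_arg z
  have h5 : m * (t - z.arg / m) = m * t - z.arg := by field_simp
  rw [h5, Real.cos_sub]
  have h6 := Real.sin_sq_add_cos_sq (m * t)
  linear_combination (-g t) * h6 - Real.cos (m * t) * h3 - Real.sin (m * t) * h4
    + Real.cos (m * t) * h1 + Real.sin (m * t) * h2

theorem apply_apply_add_apply_mul_I (B : ℂ →L[ℝ] ℂ →L[ℝ] ℝ) (e : ℂ) :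
    B e e + B (Complex.I * e) (Complex.I * e)
      = (e.re ^ 2 + e.im ^ 2) * (B 1 1 + B Complex.I Complex.I) := by
  have h1 : e = e.re • (1 : ℂ) + e.im • Complex.I := by apply Complex.ext <;> simp
  have h2 : Complex.I * e = (-e.im) • (1 : ℂ) + e.re • Complex.I := by
    apply Complex.ext <;> simp
  have h3 : B e e = B (e.re • (1 : ℂ) + e.im • Complex.I) (e.re • (1 : ℂ) + e.im • Complex.I) :=
    congrArg (fun e => B e e) h1
  rw [h3, h2]
  simp only [map_add, map_smul, add_apply, smul_apply, smul_eq_mul]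
  ring

section Homogeneous

variable {P : ℂ → ℝ} {j : ℕ}

theorem fderiv_apply_self_of_homogeneous (hP : ContDiff ℝ 2 P)
    (hhom : ∀ (c : ℝ) y, P (c • y) = c ^ (j + 2) * P y)
    (y : ℂ) : fderiv ℝ P y y = (j + 2) * P y := by
  have h1 : HasDerivAt (fun t : ℝ => P (t • y)) (fderiv ℝ P y y) 1 := by
    have h2 : HasFDerivAt P (fderiv ℝ P y) ((1 : ℝ) • y) := by
      rw [one_smul]; exact (hP.differentiable (by norm_num) y).hasFDerivAt
    simpa using! h2.comp_hasDerivAt 1 ((hasDerivAt_id (1 : ℝ)).smul_const y)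
  simp only [hhom] at h1
  have h3 := ((hasDerivAt_pow (j + 2) (1 : ℝ)).mul_const (P y))
  rw [h1.unique h3]
  simp

theorem fderiv_fderiv_apply_self_of_homogeneous (hP : ContDiff ℝ 2 P)
    (hhom : ∀ (c : ℝ) y, P (c • y) = c ^ (j + 2) * P y)
    (y : ℂ) :
    fderiv ℝ (fderiv ℝ P) y y y = (j + 2) * (j + 1) * P y := by
  have hP' : HasFDerivAt (fderiv ℝ P) (fderiv ℝ (fderiv ℝ P) y) y :=
    hP.contDiffAt.hasFDerivAt_fderiv
  have h1 := hP'.clm_apply (hasFDerivAt_id y)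
  simp only [id, fderiv_apply_self_of_homogeneous hP hhom] at h1
  have h2 := (hP.differentiable (by norm_num) y).hasFDerivAt.const_mul ((j : ℝ) + 2)
  have h3 := congrArg (fun L : ℂ →L[ℝ] ℝ => L y) (h1.unique h2)
  have h4 := fderiv_apply_self_of_homogeneous hP hhom y
  simp at h3
  rw [h4] at h3
  linear_combination h3

theorem fderiv_fderiv_smul_of_homogeneous (hP : ContDiff ℝ 2 P)
    (hhom : ∀ (c : ℝ) y, P (c • y) = c ^ (j + 2) * P y)
    {c : ℝ} (hc : c ≠ 0) (y : ℂ) :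
    fderiv ℝ (fderiv ℝ P) (c • y) = c ^ j • fderiv ℝ (fderiv ℝ P) y := by
  have h1 : ∀ y, c • fderiv ℝ P (c • y) = c ^ (j + 2) • fderiv ℝ P y := fun y => by
    rw [← fderiv_comp_smul, ← fderiv_const_smul (hP.differentiable (by norm_num) y)]
    congr 1
    ext y; exact hhom c y
  have h2 : fderiv ℝ (fun y => c • fderiv ℝ P (c • y)) y
      = fderiv ℝ (fun y => c ^ (j + 2) • fderiv ℝ P y) y := by
    congr 1; ext1 y; exact h1 y
  have hd : ∀ y, DifferentiableAt ℝ (fderiv ℝ P) y := fun y =>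
    hP.contDiffAt.hasFDerivAt_fderiv.differentiableAt
  have h3 : DifferentiableAt ℝ (fun y => fderiv ℝ P (c • y)) y :=
    (hd (c • y)).comp y (differentiableAt_id.const_smul c)
  rw [fderiv_fun_const_smul h3, fderiv_fun_const_smul (hd y), fderiv_comp_smul, smul_smul] at h2
  have h4 : (c * c) • fderiv ℝ (fderiv ℝ P) (c • y)
      = (c * c) • (c ^ j • fderiv ℝ (fderiv ℝ P) y) := by
    rw [h2, smul_smul]; congr 1; ring
  exact smul_right_injective _ (mul_ne_zero hc hc) h4

/-- A homogeneous harmonic function in the plane is a trigonometric monomial. -/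
theorem exists_eq_mul_cos_of_homogeneous (hP : ContDiff ℝ 2 P)
    (hhom : ∀ (c : ℝ) y, P (c • y) = c ^ (j + 2) * P y)
   
    (hΔ : ∀ φ : ℝ, fderiv ℝ (fderiv ℝ P) (Complex.exp (φ * Complex.I)) 1 1
      + fderiv ℝ (fderiv ℝ P) (Complex.exp (φ * Complex.I)) Complex.I Complex.I = 0) :
    ∃ R φ₀ : ℝ, 0 ≤ R ∧
      ∀ φ : ℝ, P (Complex.exp (φ * Complex.I)) = R * Real.cos ((j + 2) * (φ - φ₀)) := by
  have hE : ∀ φ : ℝ, HasDerivAt (fun φ : ℝ => Complex.exp (φ * Complex.I))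
      (Complex.I * Complex.exp (φ * Complex.I)) φ := fun φ => by
    have h1 : HasDerivAt (fun φ : ℝ => (φ : ℂ) * Complex.I) Complex.I φ := by
      simpa using (Complex.ofRealCLM.hasDerivAt (x := φ)).mul_const Complex.I
    exact h1.cexp.congr_deriv (mul_comm _ _)
  refine exists_eq_mul_cos_of_hasDerivAt (by positivity)
    (g' := fun φ : ℝ => fderiv ℝ P (Complex.exp (φ * Complex.I))
      (Complex.I * Complex.exp (φ * Complex.I))) (fun φ => ?_) (fun φ => ?_)
  · exact (hP.differentiable (by norm_num) _).hasFDerivAt.comp_hasDerivAt φ (hE φ)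
  · have hP' : HasFDerivAt (fderiv ℝ P) _ (Complex.exp (φ * Complex.I)) :=
      hP.contDiffAt.hasFDerivAt_fderiv
    have hIE : HasDerivAt (fun φ : ℝ => Complex.I * Complex.exp (φ * Complex.I))
        (Complex.I * (Complex.I * Complex.exp (φ * Complex.I))) φ := (hE φ).const_mul Complex.I
    have hDP : HasDerivAt (fun φ : ℝ => fderiv ℝ P (Complex.exp (φ * Complex.I)))
        (fderiv ℝ (fderiv ℝ P) (Complex.exp (φ * Complex.I))
          (Complex.I * Complex.exp (φ * Complex.I))) φ := hP'.comp_hasDerivAt φ (hE φ)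
    refine (hDP.clm_apply hIE).congr_deriv ?_
    set e := Complex.exp (φ * Complex.I)
    have h1 := apply_apply_add_apply_mul_I (fderiv ℝ (fderiv ℝ P) e) e
    rw [hΔ, mul_zero, fderiv_fderiv_apply_self_of_homogeneous hP hhom] at h1
    have h2 : Complex.I * (Complex.I * e) = -e := by
      rw [← mul_assoc, Complex.I_mul_I, neg_one_mul]
    have h3 := fderiv_apply_self_of_homogeneous hP hhom e
    rw [h2, map_neg, h3]
    linear_combination h1

end Homogeneous

theorem tendsto_smul_nhdsGT_zero {E : Type*} [NormedAddCommGroup E] [NormedSpace ℝ E] (e : E) :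
    Tendsto (fun t : ℝ => t • e) (𝓝[>] 0) (𝓝 0) := by
  have : Continuous fun t : ℝ => t • e := by fun_prop
  simpa using (this.tendsto 0).mono_left nhdsWithin_le_nhds

theorem VanishesToOrder.isBigO_smul {E F : Type*} [NormedAddCommGroup E] [NormedSpace ℝ E]
    [NormedAddCommGroup F] [NormedSpace ℝ F] {k : ℕ} {g : E → F}
    (hg : VanishesToOrder k g 0) (e : E) :
    (fun t : ℝ => g (t • e)) =O[𝓝[>] 0] fun t : ℝ => t ^ k := by
  have h1 := hg.isBigO.comp_tendsto (tendsto_smul_nhdsGT_zero e)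
  simp only [Function.comp_def, zero_add] at h1
  refine h1.trans ?_
  simp only [norm_smul, mul_pow]
  exact isBigO_of_le' (c := ‖e‖ ^ k) _ fun t => by
    rw [norm_mul, norm_pow, norm_pow, norm_pow, norm_norm, norm_norm, mul_comm]

/-- An analytic function in the plane with a degenerate zero, satisfying approximately Laplace's
equation, alternates in sign along equally spaced rays. -/
theorem exists_alternating_rays_zero {W : ℂ → ℝ} (hW : AnalyticAt ℝ W 0) (h0 : W 0 = 0)
    (h1 : fderiv ℝ W 0 = 0) (hne : ¬ ∀ᶠ y in 𝓝 0, W y = 0) {κ : ℂ → ℝ} {C : ℝ}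
    (hκ : Tendsto κ (𝓝 0) (𝓝 0))
    (hΔ : ∀ᶠ y in 𝓝 0, |fderiv ℝ (fderiv ℝ W) y 1 1 + fderiv ℝ (fderiv ℝ W) y Complex.I Complex.I|
      ≤ κ y * ‖fderiv ℝ (fderiv ℝ W) y‖ + C * (‖fderiv ℝ W y‖ + |W y|)) :
    ∃ (φ₀ : ℝ) (m : ℕ), 2 ≤ m ∧ ∀ k : ℕ, ∀ᶠ t : ℝ in 𝓝[>] 0,
      0 < (-1) ^ k * W (t • Complex.exp ((φ₀ + k * Real.pi / m : ℝ) * Complex.I)) := by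
  obtain ⟨m, q, v, hv, hWm, hRm⟩ := hW.exists_leading_term hne
  set P : ℂ → ℝ := fun y => q fun _ => y with hPdef
  have hhom : ∀ (c : ℝ) y, P (c • y) = c ^ m * P y := fun c y => by
    simpa using q.map_smul_univ (fun _ => c) (fun _ => y)
  have hPa : AnalyticOnNhd ℝ P univ := fun y _ =>
    q.analyticAt.comp (AnalyticAt.pi fun _ => analyticAt_id)
  have hP : ContDiff ℝ 2 P := contDiff_iff_contDiffAt.2 fun y => (hPa y trivial).contDiffAt
  have hm : 2 ≤ m := by
    by_contra! hlt
    refine hv (eq_zero_of_pow_smul_isLittleO (j := m) (c := P v) ?_)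
    have e1 : (fun t : ℝ => W (t • v)) =o[𝓝[>] 0] fun t : ℝ => t ^ m := by
      have := hW.differentiableAt.hasFDerivAt.isLittleO
      simp only [h0, h1, sub_zero, zero_apply] at this
      have e2 := this.comp_tendsto (tendsto_smul_nhdsGT_zero v)
      refine e2.trans_isBigO ?_
      have e3 : (fun t : ℝ => t • v) =O[𝓝[>] 0] fun t : ℝ => t ^ 1 := by
        simp only [pow_one]
        exact isBigO_of_le' (c := ‖v‖) _ fun t => by rw [norm_smul, mul_comm]
      refine e3.trans (IsBigO.mono ?_ nhdsWithin_le_nhds)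
      rcases (by omega : m = 0 ∨ m = 1) with rfl | rfl
      · exact (isLittleO_pow_pow one_pos).isBigO
      · exact isBigO_refl _ _
    have e4 := (hRm.isBigO_smul v).trans_isLittleO (pow_succ_isLittleO_pow m)
    refine (e1.sub e4).congr_left fun t => ?_
    change W (t • v) - (W (t • v) - P (t • v)) = _
    rw [hhom, smul_eq_mul]; ring
  obtain ⟨j, rfl⟩ := Nat.exists_eq_add_of_le' hm
  have hWd := hWm.fderiv
  have hWdd := hWd.fderiv
  have hRdd := hRm.fderiv.fderiv
  have hlap : ∀ e : ℂ, fderiv ℝ (fderiv ℝ P) e 1 1 + fderiv ℝ (fderiv ℝ P) e Complex.I Complex.I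
      = 0 := by
    intro e
    refine eq_zero_of_pow_smul_isLittleO (j := j) ?_
    have hlim := tendsto_smul_nhdsGT_zero e
    have e1 : (fun t : ℝ => fderiv ℝ (fderiv ℝ W) (t • e) 1 1
        + fderiv ℝ (fderiv ℝ W) (t • e) Complex.I Complex.I) =o[𝓝[>] 0] fun t : ℝ => t ^ j := by
      have a1 : (fun t : ℝ => κ (t • e) * ‖fderiv ℝ (fderiv ℝ W) (t • e)‖)
          =o[𝓝[>] 0] fun t : ℝ => t ^ j := by
        have := ((isLittleO_one_iff ℝ).2 (hκ.comp hlim)).mul_isBigO (hWdd.isBigO_smul e).norm_left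
        simpa only [one_mul, Function.comp_def] using this
      have a2 : (fun t : ℝ => C * (‖fderiv ℝ W (t • e)‖ + |W (t • e)|))
          =o[𝓝[>] 0] fun t : ℝ => t ^ j := by
        have b1 := (hWd.isBigO_smul e).trans_isLittleO (pow_succ_isLittleO_pow j)
        have b2 := (hWm.isBigO_smul e).trans_isLittleO
          ((pow_succ_isLittleO_pow (j + 1)).trans (pow_succ_isLittleO_pow j))
        exact (b1.norm_left.add b2.norm_left).const_mul_left C
      refine (IsBigO.of_bound 1 ?_).trans_isLittleO (a1.add a2)
      filter_upwards [hlim.eventually hΔ] with t ht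
      rw [one_mul]
      exact ht.trans (le_abs_self _)
    have e2 : (fun t : ℝ => fderiv ℝ (fderiv ℝ fun y => W y - P y) (t • e) 1 1
        + fderiv ℝ (fderiv ℝ fun y => W y - P y) (t • e) Complex.I Complex.I)
        =o[𝓝[>] 0] fun t : ℝ => t ^ j := by
      have b := (hRdd.isBigO_smul e).trans_isLittleO (pow_succ_isLittleO_pow j)
      refine IsBigO.trans_isLittleO (IsBigO.of_bound 2 (Eventually.of_forall fun t => ?_)) b
      set B := fderiv ℝ (fderiv ℝ fun y => W y - P y) (t • e)
      have c1 : ‖B 1 1‖ ≤ ‖B‖ := by simpa using B.le_opNorm₂ 1 1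
      have c2 : ‖B Complex.I Complex.I‖ ≤ ‖B‖ := by simpa using B.le_opNorm₂ Complex.I Complex.I
      have := norm_add_le (B 1 1) (B Complex.I Complex.I)
      linarith
    refine (e1.sub e2).congr' ?_ EventuallyEq.rfl
    have hev : ∀ᶠ y in 𝓝 (0 : ℂ), fderiv ℝ (fderiv ℝ fun y => W y - P y) y
        = fderiv ℝ (fderiv ℝ W) y - fderiv ℝ (fderiv ℝ P) y := by
      filter_upwards [hW.eventually_analyticAt.eventually_nhds] with y hy
      have c1 : fderiv ℝ (fun y => W y - P y) =ᶠ[𝓝 y] fun y => fderiv ℝ W y - fderiv ℝ P y := by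
        filter_upwards [hy] with z hz
        exact fderiv_fun_sub hz.differentiableAt (hPa z trivial).differentiableAt
      rw [c1.fderiv_eq]
      exact fderiv_fun_sub hy.self_of_nhds.fderiv.differentiableAt
        (hPa y trivial).fderiv.differentiableAt
    filter_upwards [hlim.eventually hev, self_mem_nhdsWithin] with t ht ht0
    rw [ht, fderiv_fderiv_smul_of_homogeneous hP hhom (ne_of_gt ht0)]
    simp only [sub_apply, smul_apply, smul_eq_mul]
    ring
  obtain ⟨R, φ₀, hR, hcos⟩ := exists_eq_mul_cos_of_homogeneous hP hhom fun φ => hlap _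
  have hR0 : 0 < R := by
    refine hR.lt_of_ne fun hR0 => hv ?_
    have c1 : v = ‖v‖ • Complex.exp (v.arg * Complex.I) := by
      rw [Complex.real_smul, Complex.norm_mul_exp_arg_mul_I]
    change P v = 0
    rw [c1, hhom, hcos, ← hR0]
    simp
  refine ⟨φ₀, j + 2, hm, fun k => ?_⟩
  set φ : ℝ := φ₀ + k * Real.pi / (j + 2 : ℕ) with hφ
  set e : ℂ := Complex.exp (φ * Complex.I) with he
  have hPe : P e = R * (-1) ^ k := by
    rw [he, hcos, hφ]
    have : ((j : ℝ) + 2) * (φ₀ + k * Real.pi / (j + 2 : ℕ) - φ₀) = k * Real.pi := by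
      push_cast; field_simp; ring
    rw [this, Real.cos_nat_mul_pi]
  have hb := (hRm.isBigO_smul e).trans_isLittleO (pow_succ_isLittleO_pow (j + 2))
  filter_upwards [hb.def (half_pos hR0), self_mem_nhdsWithin] with t ht ht0
  have ht0 : 0 < t := ht0
  change |W (t • e) - P (t • e)| ≤ _ at ht
  have hk : ((-1 : ℝ) ^ k) * (-1) ^ k = 1 := by rw [← mul_pow]; simp
  have hk' : |(-1 : ℝ) ^ k| = 1 := by simp
  rw [hhom, hPe, Real.norm_of_nonneg (by positivity)] at ht
  have h2 : |(-1) ^ k * W (t • e) - t ^ (j + 2) * R| ≤ R / 2 * t ^ (j + 2) := by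
    calc _ = |(-1 : ℝ) ^ k * (W (t • e) - t ^ (j + 2) * (R * (-1) ^ k))| := by
          congr 1; linear_combination (t ^ (j + 2) * R) * hk
      _ ≤ _ := by rwa [abs_mul, hk', one_mul]
  have h3 : 0 < R * t ^ (j + 2) := by positivity
  linarith [neg_le_of_abs_le h2]

/-- The ray `t ↦ x + t • e` eventually satisfies what holds near `x`. -/
theorem Filter.Eventually.nhdsGT_ray {E : Type*} [NormedAddCommGroup E] [NormedSpace ℝ E] {x : E}
    {p : E → Prop} (hp : ∀ᶠ y in 𝓝 x, p y) (e : E) : ∀ᶠ t : ℝ in 𝓝[>] 0, p (x + t • e) := by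
  have h1 := (tendsto_smul_nhdsGT_zero e).const_add x
  rw [add_zero] at h1
  exact h1.eventually hp

theorem exists_forall_Ioc_of_eventually_nhdsGT {p : ℝ → Prop} (hp : ∀ᶠ t in 𝓝[>] 0, p t) :
    ∃ ε > 0, ∀ t ∈ Ioc 0 ε, p t := by
  obtain ⟨ε, hε, h⟩ := mem_nhdsGT_iff_exists_Ioc_subset.1 hp
  exact ⟨ε, hε, h⟩

/-- The crossing lemma for germs of rays. -/
theorem false_of_eventually_interlacing_rays {P M : Set ℂ} (hP : IsOpen P)
    (hPc : IsPreconnected P) (hM : IsOpen M) (hMc : IsPreconnected M) (hPM : Disjoint P M) {x₀ : ℂ}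
    (hxP : x₀ ∉ P) (hxM : x₀ ∉ M) {α₁ α₂ α₃ α₄ : ℝ} (h₁₂ : α₁ < α₂) (h₂₃ : α₂ < α₃)
    (h₃₄ : α₃ < α₄) (h₄₁ : α₄ < α₁ + 2 * Real.pi)
    (h₁ : ∀ᶠ t : ℝ in 𝓝[>] 0, x₀ + t • Complex.exp (α₁ * Complex.I) ∈ P)
    (h₂ : ∀ᶠ t : ℝ in 𝓝[>] 0, x₀ + t • Complex.exp (α₂ * Complex.I) ∈ M)
    (h₃ : ∀ᶠ t : ℝ in 𝓝[>] 0, x₀ + t • Complex.exp (α₃ * Complex.I) ∈ P)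
    (h₄ : ∀ᶠ t : ℝ in 𝓝[>] 0, x₀ + t • Complex.exp (α₄ * Complex.I) ∈ M) : False := by
  obtain ⟨ε, hε, H⟩ := exists_forall_Ioc_of_eventually_nhdsGT (h₁.and (h₂.and (h₃.and h₄)))
  simp only [Complex.real_smul] at H
  exact false_of_interlacing_rays hP hPc hM hMc hPM hxP hxM hε h₁₂ h₂₃ h₃₄ h₄₁
    (fun t ht => (H t ht).1) (fun t ht => (H t ht).2.1) (fun t ht => (H t ht).2.2.1)
    (fun t ht => (H t ht).2.2.2)

/-- An analytic function in the plane with a degenerate zero, satisfying approximately Laplace's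
equation, alternates in sign along equally spaced rays. -/
theorem exists_alternating_rays {V : ℂ → ℝ} {x : ℂ} (hV : AnalyticAt ℝ V x) (h0 : V x = 0)
    (h1 : fderiv ℝ V x = 0) (hne : ¬ ∀ᶠ y in 𝓝 x, V y = 0) {κ : ℂ → ℝ} {C : ℝ}
    (hκ : Tendsto κ (𝓝 x) (𝓝 0))
    (hΔ : ∀ᶠ y in 𝓝 x, |fderiv ℝ (fderiv ℝ V) y 1 1 + fderiv ℝ (fderiv ℝ V) y Complex.I Complex.I|
      ≤ κ y * ‖fderiv ℝ (fderiv ℝ V) y‖ + C * (‖fderiv ℝ V y‖ + |V y|)) :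
    ∃ (φ₀ : ℝ) (m : ℕ), 2 ≤ m ∧ ∀ k : ℕ, ∀ᶠ t : ℝ in 𝓝[>] 0,
      0 < (-1) ^ k * V (x + t • Complex.exp ((φ₀ + k * Real.pi / m : ℝ) * Complex.I)) := by
  have ht : Tendsto (fun y : ℂ => x + y) (𝓝 0) (𝓝 x) := by
    simpa using (tendsto_id (x := 𝓝 (0 : ℂ))).const_add x
  have e1 : fderiv ℝ (fun y => V (x + y)) = fun y => fderiv ℝ V (x + y) := by
    ext1 y; exact fderiv_comp_add_left x
  have e2 : fderiv ℝ (fun y => fderiv ℝ V (x + y)) = fun y => fderiv ℝ (fderiv ℝ V) (x + y) := by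
    ext1 y; exact fderiv_comp_add_left x
  refine exists_alternating_rays_zero (W := fun y => V (x + y)) (κ := fun y => κ (x + y)) (C := C)
    ?_ (by simpa) (by rw [e1]; simpa) (fun h => hne ?_) (hκ.comp ht) ?_
  · refine AnalyticAt.comp (by simpa using hV) (by fun_prop)
  · have h2 : Tendsto (fun y : ℂ => y - x) (𝓝 x) (𝓝 0) := by
      simpa using (tendsto_id (x := 𝓝 x)).sub_const x
    simpa using h2.eventually h
  · rw [e1, e2]
    exact ht.eventually hΔ

namespace IsPlanarSolution

variable {Ω : Set ℂ} {f : ℝ → ℝ} {u : ℂ → ℝ}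

theorem continuousOn_fderiv (h : IsPlanarSolution Ω f u)
    : ContinuousOn (fderiv ℝ u) Ω := fun _ hx =>
  (h.contDiffAt_fderiv hx).continuousAt.continuousWithinAt

theorem isOpen_fderiv_pos (h : IsPlanarSolution Ω f u)
    (θ : ℂ) : IsOpen {x ∈ Ω | 0 < fderiv ℝ u x θ} :=
  (h.continuousOn_fderiv.clm_apply continuousOn_const).isOpen_inter_preimage h.isOpen isOpen_Ioi

/-- Critical points are nondegenerate. -/
theorem fderiv_fderiv_ne_zero (h : IsPlanarSolution Ω f u)
    {x : ℂ} (hx : x ∈ Ω) (h0 : fderiv ℝ u x = 0) {θ : ℂ} (hθ : θ ≠ 0) :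
    fderiv ℝ (fderiv ℝ u) x θ ≠ 0 := by
  intro hdeg
  obtain ⟨β, hβ, hL⟩ := h.exists_linearized_bound
  have hGx : ContinuousAt (fderiv ℝ u) x := (h.contDiffAt_fderiv hx).continuousAt
  have hperp : Tendsto (fun y => ‖perp (fderiv ℝ u y)‖) (𝓝 x) (𝓝 0) := by
    have h1 : Tendsto (fun y => 2 * ‖fderiv ℝ u y‖) (𝓝 x) (𝓝 0) := by
      simpa [h0] using hGx.norm.tendsto.const_mul 2
    exact squeeze_zero (fun _ => norm_nonneg _) (fun y => norm_perp_le _) h1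
  set c : ℂ → ℝ := fun y => deriv f (u y) * areaElt (fderiv ℝ u y) ^ 3 with hc
  have hcx : ContinuousAt c x := by
    have h1 : Continuous (deriv f) := h.contDiff.continuous_deriv (le_refl _)
    have h2 : Continuous fun p : ℂ →L[ℝ] ℝ => areaElt p := by unfold areaElt; fun_prop
    exact (h1.continuousAt.comp (h.contDiffAt hx).continuousAt).mul
      ((h2.continuousAt.comp hGx).pow 3)
  have hcb : ∀ᶠ y in 𝓝 x, |c y| < |c x| + 1 :=
    hcx.abs.eventually_lt continuousAt_const (lt_add_one _)
  obtain ⟨φ₀, m, hm, hrays⟩ := exists_alternating_rays (V := fun y => fderiv ℝ u y θ)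
    (κ := fun y => ‖perp (fderiv ℝ u y)‖ ^ 2) (C := max β (|c x| + 1))
    (h.analyticAt_fderiv_apply hx θ) (by simp [h0])
    ((h.hasFDerivAt_fderiv_apply hx θ).fderiv.trans hdeg)
    (h.not_eventually_fderiv_apply_eq_zero hx hθ) (by simpa using hperp.pow 2) (by
      filter_upwards [hcb, h.isOpen.mem_nhds hx] with y hy hyΩ
      have h1 := hL θ y hyΩ
      set V := fun y => fderiv ℝ u y θ with hV
      set B := fderiv ℝ (fderiv ℝ V) y
      set η := perp (fderiv ℝ u y)
      have h2 : |B η η| ≤ ‖η‖ ^ 2 * ‖B‖ := by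
        have := B.le_opNorm₂ η η
        rw [Real.norm_eq_abs] at this
        linarith [mul_comm (‖B‖ * ‖η‖) ‖η‖, mul_comm ‖B‖ (‖η‖ ^ 2), sq ‖η‖,
          mul_assoc ‖B‖ ‖η‖ ‖η‖, congrArg (‖B‖ * ·) (sq ‖η‖)]
      have h3 : |c y * V y| ≤ max β (|c x| + 1) * |V y| := by
        rw [abs_mul]
        gcongr
        exact hy.le.trans (le_max_right _ _)
      have h4 : β * ‖fderiv ℝ V y‖ ≤ max β (|c x| + 1) * ‖fderiv ℝ V y‖ := by
        gcongr
        exact le_max_left _ _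
      have h5 : B 1 1 + B Complex.I Complex.I = (ellip η B - c y * V y) + c y * V y - B η η := by
        simp only [ellip]; ring
      rw [h5]
      have h6 := abs_sub ((ellip η B - c y * V y) + c y * V y) (B η η)
      have h7 := abs_add_le (ellip η B - c y * V y) (c y * V y)
      have h8 : |ellip η B - c y * V y| ≤ β * ‖fderiv ℝ V y‖ := h1
      linarith)
  have hπ := Real.pi_pos
  have hm' : (2 : ℝ) ≤ m := by exact_mod_cast hm
  have hδ : 0 < Real.pi / m := by positivity
  have hδ2 : Real.pi / m ≤ Real.pi / 2 := by gcongr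
  have hr : ∀ k : ℕ, ∀ᶠ t : ℝ in 𝓝[>] 0,
      x + t • Complex.exp ((φ₀ + k * Real.pi / m : ℝ) * Complex.I) ∈
        {y ∈ Ω | 0 < fderiv ℝ u y ((-1 : ℝ) ^ k • θ)} := fun k => by
    filter_upwards [hrays k, (h.isOpen.eventually_mem hx).nhdsGT_ray
      (Complex.exp ((φ₀ + k * Real.pi / m : ℝ) * Complex.I))] with t ht1 ht2
    refine ⟨ht2, ?_⟩
    rwa [map_smul, smul_eq_mul]
  have r0 := hr 0
  have r1 := hr 1
  have r2 := hr 2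
  have r3 := hr 3
  have e3 : (-1 : ℝ) ^ 3 = -1 := by norm_num
  simp only [pow_zero, one_smul, pow_one, even_two, Even.neg_pow, one_pow, e3, neg_smul]
    at r0 r1 r2 r3
  refine false_of_eventually_interlacing_rays (h.isOpen_fderiv_pos θ)
    (h.isPreconnected_fderiv_pos hθ) (h.isOpen_fderiv_pos (-θ))
    (h.isPreconnected_fderiv_pos (neg_ne_zero.2 hθ)) ?_ ?_ ?_ ?_ ?_ ?_ ?_ r0 r1 r2 r3
  · rw [Set.disjoint_left]
    rintro y ⟨_, hy⟩ ⟨_, hy'⟩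
    rw [map_neg] at hy'
    linarith
  · simp [h0]
  · simp [h0]
  all_goals
    simp only [mul_div_assoc]
    push_cast
    linarith

end IsPlanarSolution

section

variable {E : Type*} [NormedAddCommGroup E] [NormedSpace ℝ E]

theorem ContDiffAt.eventually_lt_ray {V : E → ℝ} {x e : E} (h : ContDiffAt ℝ 2 V x)
    (h0 : fderiv ℝ V x = 0) (hpos : 0 < fderiv ℝ (fderiv ℝ V) x e e) :
    ∀ᶠ t : ℝ in 𝓝[>] 0, V x < V (x + t • e) := by
  have hline : ∀ t : ℝ, HasDerivAt (fun t : ℝ => x + t • e) e t := fun t => by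
    simpa using ((hasDerivAt_id t).smul_const e).const_add x
  have hd : HasDerivAt (fun t : ℝ => fderiv ℝ V (x + t • e) e) (fderiv ℝ (fderiv ℝ V) x e e) 0 := by
    have h1 : HasFDerivAt (fderiv ℝ V) (fderiv ℝ (fderiv ℝ V) x) (x + (0 : ℝ) • e) := by
      simpa using h.hasFDerivAt_fderiv
    have h2 : HasDerivAt (fun t : ℝ => fderiv ℝ V (x + t • e)) (fderiv ℝ (fderiv ℝ V) x e) 0 :=
      h1.comp_hasDerivAt (0 : ℝ) (hline 0)
    have h3 := h2.clm_apply (hasDerivAt_const (0 : ℝ) e)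
    rwa [map_zero, add_zero] at h3
  have hslope : ∀ᶠ t : ℝ in 𝓝[>] 0, 0 < fderiv ℝ V (x + t • e) e := by
    have h2 := (hasDerivAt_iff_tendsto_slope.1 hd).mono_left
      (nhdsWithin_mono 0 fun t (ht : 0 < t) => ht.ne')
    filter_upwards [h2.eventually_const_lt hpos, self_mem_nhdsWithin] with t ht ht0
    have ht0 : 0 < t := ht0
    simpa [slope_def_field, h0, ht0] using ht
  have hdiff : ∀ᶠ y in 𝓝 x, DifferentiableAt ℝ V y := by
    filter_upwards [h.eventually (by simp)] with y hy using hy.differentiableAt (by simp)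
  obtain ⟨ε, hε, H⟩ := mem_nhdsGT_iff_exists_Ioc_subset.1
    (hslope.and (hdiff.nhdsGT_ray e))
  have hε : 0 < ε := hε
  have hder : ∀ t ∈ Icc 0 ε, HasDerivAt (fun t : ℝ => V (x + t • e)) (fderiv ℝ V (x + t • e) e) t := by
    intro t ht
    have h3 : DifferentiableAt ℝ V (x + t • e) := by
      rcases ht.1.eq_or_lt with rfl | h4
      · simpa using h.differentiableAt (by simp)
      · exact (H ⟨h4, ht.2⟩).2
    exact h3.hasFDerivAt.comp_hasDerivAt t (hline t)
  filter_upwards [Ioc_mem_nhdsGT hε] with t ht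
  have hmono : StrictMonoOn (fun t : ℝ => V (x + t • e)) (Icc 0 ε) := by
    refine strictMonoOn_of_deriv_pos (convex_Icc 0 ε)
      (fun s hs => (hder s hs).continuousAt.continuousWithinAt) fun s hs => ?_
    rw [interior_Icc] at hs
    rw [(hder s (Ioo_subset_Icc_self hs)).deriv]
    exact (H (Ioo_subset_Ioc_self hs)).1
  simpa using hmono (left_mem_Icc.2 hε.le) (Ioc_subset_Icc_self ht) ht.1

theorem ContDiffAt.eventually_ray_lt {V : E → ℝ} {x e : E} (h : ContDiffAt ℝ 2 V x)
    (h0 : fderiv ℝ V x = 0) (hneg : fderiv ℝ (fderiv ℝ V) x e e < 0) :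
    ∀ᶠ t : ℝ in 𝓝[>] 0, V (x + t • e) < V x := by
  have h2 : fderiv ℝ (fun y => -V y) = fun y => -fderiv ℝ V y := by
    ext1 y; exact fderiv_fun_neg
  have h3 := h.neg.eventually_lt_ray (e := e) (by simp [h0])
    (by rw [h2, fderiv_fun_neg]; simpa using hneg)
  simpa using h3

/-- A nondegenerate negative semidefinite symmetric form is negative definite. -/
theorem apply_self_neg_of_nonpos {B : E →L[ℝ] E →L[ℝ] ℝ} (hB : ∀ v w, B v w = B w v)
    (hnd : ∀ v ≠ 0, B v ≠ 0) (hnp : ∀ v, B v v ≤ 0) {v : E} (hv : v ≠ 0) : B v v < 0 := by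
  refine (hnp v).lt_of_ne fun h0 => hnd v hv (ContinuousLinearMap.ext fun w => ?_)
  have key : ∀ t : ℝ, t * (2 * B v w) + t ^ 2 * B w w ≤ 0 := fun t => by
    have := hnp (v + t • w)
    simp only [map_add, map_smul, add_apply, smul_apply, smul_eq_mul, h0, hB w v] at this
    linarith
  by_contra hne
  have hne : B v w ≠ 0 := hne
  have hw := hnp w
  have h1 : 0 < 1 - B w w := by linarith
  have h2 := key (B v w / (1 - B w w))
  have h3 : B v w / (1 - B w w) * (2 * B v w) + (B v w / (1 - B w w)) ^ 2 * B w w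
      = (B v w) ^ 2 / (1 - B w w) ^ 2 * (2 - B w w) := by
    field_simp; ring
  rw [h3] at h2
  have : 0 < (B v w) ^ 2 / (1 - B w w) ^ 2 * (2 - B w w) := by
    have : 0 < 2 - B w w := by linarith
    positivity
  linarith

end

namespace IsPlanarSolution

variable {Ω : Set ℂ} {f : ℝ → ℝ} {u : ℂ → ℝ}

theorem fderiv_fderiv_symm (h : IsPlanarSolution Ω f u) {x : ℂ} (hx : x ∈ Ω) (v w : ℂ) :
    fderiv ℝ (fderiv ℝ u) x v w = fderiv ℝ (fderiv ℝ u) x w v :=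
  (h.contDiffAt hx).isSymmSndFDerivAt (by simp) v w

theorem fderiv_fderiv_neg_of_nonpos (h : IsPlanarSolution Ω f u)
    {x : ℂ} (hx : x ∈ Ω) (h0 : fderiv ℝ u x = 0)
    (hnp : ∀ v, fderiv ℝ (fderiv ℝ u) x v v ≤ 0) {v : ℂ} (hv : v ≠ 0) :
    fderiv ℝ (fderiv ℝ u) x v v < 0 :=
  apply_self_neg_of_nonpos (h.fderiv_fderiv_symm hx)
    (fun _ hv => h.fderiv_fderiv_ne_zero hx h0 hv) hnp hv

theorem eq_of_fderiv_eq_zero_of_nonpos (h : IsPlanarSolution Ω f u)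
    {p q : ℂ} (hp : p ∈ Ω) (hq : q ∈ Ω)
    (hp0 : fderiv ℝ u p = 0) (hq0 : fderiv ℝ u q = 0)
    (hp1 : ∀ v, fderiv ℝ (fderiv ℝ u) p v v ≤ 0)
    (hq1 : ∀ v, fderiv ℝ (fderiv ℝ u) q v v ≤ 0) : p = q := by
  refine eq_of_negDef_of_isPreconnected h.isOpen h.continuousOn_fderiv (fun α => ?_) hp hq hp0 hq0
    (h.contDiffAt hp).hasFDerivAt_fderiv (h.contDiffAt hq).hasFDerivAt_fderiv
    (fun v hv => h.fderiv_fderiv_neg_of_nonpos hp hp0 hp1 hv)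
    (fun v hv => h.fderiv_fderiv_neg_of_nonpos hq hq0 hq1 hv)
  have := h.isPreconnected_fderiv_pos (neg_ne_zero.2 (Complex.exp_ne_zero (α * Complex.I)))
  simpa only [map_neg, Left.neg_pos_iff] using this

theorem isOpen_gt (h : IsPlanarSolution Ω f u) (c : ℝ) : IsOpen {x ∈ Ω | c < u x} :=
  (h.contDiffOn.continuousOn.mono subset_closure).isOpen_inter_preimage h.isOpen isOpen_Ioi

theorem isOpen_lt (h : IsPlanarSolution Ω f u) (c : ℝ) : IsOpen {x ∈ Ω | u x < c} :=
  (h.contDiffOn.continuousOn.mono subset_closure).isOpen_inter_preimage h.isOpen isOpen_Iio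

theorem exists_isLocalMax_mem (h : IsPlanarSolution Ω f u)
    {c : ℝ} (hc : 0 < c) {U V : Set ℂ} (hU : IsOpen U) (hV : IsOpen V)
    (hcov : {x ∈ Ω | c < u x} ⊆ U ∪ V) (hne : ({x ∈ Ω | c < u x} ∩ U).Nonempty)
    (hdisj : {x ∈ Ω | c < u x} ∩ (U ∩ V) = ∅) : ∃ p ∈ Ω, p ∈ U ∧ c < u p ∧ IsLocalMax u p := by
  obtain ⟨z, ⟨hzΩ, hzc⟩, hzU⟩ := hne
  have hSV : IsOpen ({x ∈ Ω | c < u x} ∩ V) := (h.isOpen_gt c).inter hV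
  have hnot : ∀ y ∈ Ω, c < u y → y ∈ U → y ∉ {x ∈ Ω | c < u x} ∩ V := fun y h1 h2 h3 h4 =>
    (hdisj ▸ (⟨⟨h1, h2⟩, h3, h4.2⟩ : y ∈ {x ∈ Ω | c < u x} ∩ (U ∩ V)) : y ∈ (∅ : Set ℂ))
  obtain ⟨p, hp, hmax⟩ := (h.isCompact_closure.diff hSV).exists_isMaxOn
    ⟨z, subset_closure hzΩ, hnot z hzΩ hzc hzU⟩ (h.contDiffOn.continuousOn.mono sdiff_subset)
  have hpc : c < u p := hzc.trans_le (hmax ⟨subset_closure hzΩ, hnot z hzΩ hzc hzU⟩)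
  have hpΩ : p ∈ Ω := by
    by_contra hn
    have := h.eq_zero p ⟨hp.1, by rwa [h.isOpen.interior_eq]⟩
    linarith
  have hpU : p ∈ U := (hcov ⟨hpΩ, hpc⟩).resolve_right fun hpV => hp.2 ⟨⟨hpΩ, hpc⟩, hpV⟩
  refine ⟨p, hpΩ, hpU, hpc, ?_⟩
  filter_upwards [((h.isOpen_gt c).inter hU).mem_nhds ⟨⟨hpΩ, hpc⟩, hpU⟩] with y hy
  exact hmax ⟨subset_closure hy.1.1, hnot y hy.1.1 hy.1.2 hy.2⟩

theorem isPreconnected_gt (h : IsPlanarSolution Ω f u)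
    {c : ℝ} (hc : 0 < c) : IsPreconnected {x ∈ Ω | c < u x} := by
  intro U V hU hV hcov hSU hSV
  by_contra hne
  rw [not_nonempty_iff_eq_empty] at hne
  obtain ⟨p, hp, hpU, hpc, hpm⟩ := h.exists_isLocalMax_mem hc hU hV hcov hSU hne
  obtain ⟨q, hq, hqV, hqc, hqm⟩ := h.exists_isLocalMax_mem hc hV hU (by rwa [union_comm]) hSV
    (by rwa [inter_comm V U])
  have hpq := h.eq_of_fderiv_eq_zero_of_nonpos hp hq hpm.fderiv_eq_zero hqm.fderiv_eq_zero
    (hpm.fderiv_fderiv_nonpos (h.contDiffAt hp)) (hqm.fderiv_fderiv_nonpos (h.contDiffAt hq))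
  subst hpq
  exact (hne ▸ (⟨⟨hp, hpc⟩, hpU, hqV⟩ : p ∈ {x ∈ Ω | c < u x} ∩ (U ∩ V)) : p ∈ (∅ : Set ℂ))

/-- There are no saddle points. -/
theorem fderiv_fderiv_nonpos (h : IsPlanarSolution Ω f u)
    {q : ℂ} (hq : q ∈ Ω) (h0 : fderiv ℝ u q = 0) (e : ℂ) :
    fderiv ℝ (fderiv ℝ u) q e e ≤ 0 := by
  by_contra! hpos
  have hπ := Real.pi_pos
  have he : e ≠ 0 := by rintro rfl; simp at hpos
  have hr : 0 < ‖e‖ := norm_pos_iff.2 he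
  set B := fderiv ℝ (fderiv ℝ u) q with hB
  set w : ℂ := Complex.exp (e.arg * Complex.I) with hw
  have hew : e = ‖e‖ • w := by
    rw [Complex.real_smul, hw, Complex.norm_mul_exp_arg_mul_I]
  have hpos' : 0 < B w w := by
    rw [hew] at hpos
    simp only [map_smul, smul_apply, smul_eq_mul] at hpos
    exact pos_of_mul_pos_right (pos_of_mul_pos_right hpos hr.le) hr.le
  have hneg : B (Complex.I * w) (Complex.I * w) < 0 := by
    have h1 := apply_apply_add_apply_mul_I B w
    rw [h.eqn_of_fderiv_eq_zero hq h0] at h1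
    have h2 := mul_nonpos_of_nonneg_of_nonpos
      (by positivity : 0 ≤ w.re ^ 2 + w.im ^ 2) (h.f_nonpos hq)
    linarith
  have hrot : ∀ β : ℝ, Complex.exp (((e.arg + β : ℝ) : ℂ) * Complex.I)
      = Complex.exp (β * Complex.I) * w := fun β => by
    rw [hw, ← Complex.exp_add]; congr 1; push_cast; ring
  have hin : ∀ v : ℂ, ∀ᶠ t : ℝ in 𝓝[>] 0, q + t • v ∈ Ω := fun v =>
    (h.isOpen.eventually_mem hq).nhdsGT_ray v
  have hP : ∀ v, 0 < B v v → ∀ᶠ t : ℝ in 𝓝[>] 0, q + t • v ∈ {x ∈ Ω | u q < u x} := fun v hv =>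
    (hin v).and ((h.contDiffAt hq).eventually_lt_ray h0 hv)
  have hM : ∀ v, B v v < 0 → ∀ᶠ t : ℝ in 𝓝[>] 0, q + t • v ∈ {x ∈ Ω | u x < u q} := fun v hv =>
    (hin v).and ((h.contDiffAt hq).eventually_ray_lt h0 hv)
  refine false_of_eventually_interlacing_rays (x₀ := q) (α₁ := e.arg + (0 : ℝ))
    (α₂ := e.arg + Real.pi / 2) (α₃ := e.arg + Real.pi) (α₄ := e.arg + -(Real.pi / 2) + 2 * Real.pi)
    (h.isOpen_gt (u q))
    (h.isPreconnected_gt (h.pos q hq)) (h.isOpen_lt (u q)) (h.isPreconnected_lt (h.pos q hq))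
    ?_ (by simp) (by simp) (by linarith) (by linarith) (by linarith) (by linarith)
    (hP _ ?_) (hM _ ?_) (hP _ ?_) (hM _ ?_)
  · rw [Set.disjoint_left]
    rintro y ⟨_, hy⟩ ⟨_, hy'⟩
    exact lt_asymm hy hy'
  · rw [hrot]; simpa using hpos'
  · rw [hrot]; push_cast; rwa [Complex.exp_pi_div_two_mul_I]
  · rw [hrot, Complex.exp_pi_mul_I]; simpa using hpos'
  · have : e.arg + -(Real.pi / 2) + 2 * Real.pi = e.arg + (Real.pi / 2 + Real.pi) := by ring
    rw [this, hrot]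
    push_cast
    rw [add_mul, Complex.exp_add, Complex.exp_pi_mul_I, Complex.exp_pi_div_two_mul_I]
    simpa using hneg

theorem existsUnique_fderiv_eq_zero (h : IsPlanarSolution Ω f u)
    : ∃! x, x ∈ Ω ∧ fderiv ℝ u x = 0 := by
  obtain ⟨m, hm, hmax⟩ := h.exists_isMaxOn
  have hl : IsLocalMax u m := (hmax.on_subset subset_closure).isLocalMax (h.isOpen.mem_nhds hm)
  exact ⟨m, ⟨hm, hl.fderiv_eq_zero⟩, fun y ⟨hy, hy0⟩ =>
    h.eq_of_fderiv_eq_zero_of_nonpos hy hm hy0 hl.fderiv_eq_zero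
      (h.fderiv_fderiv_nonpos hy hy0) (h.fderiv_fderiv_nonpos hm hl.fderiv_eq_zero)⟩

end IsPlanarSolution

end

theorem hessEntry_eq {n : ℕ} (u : EuclideanSpace ℝ (Fin n) → ℝ) (x : EuclideanSpace ℝ (Fin n))
    (i j : Fin n) : hessEntry u x i j
      = fderiv ℝ (fderiv ℝ u) x (EuclideanSpace.single i 1) (EuclideanSpace.single j 1) := by
  simp [hessEntry, iteratedFDeriv_two_apply]

theorem gradient_apply {n : ℕ} (u : EuclideanSpace ℝ (Fin n) → ℝ) (x : EuclideanSpace ℝ (Fin n))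
    (i : Fin n) : gradient u x i = fderiv ℝ u x (EuclideanSpace.single i 1) := by
  rw [← inner_gradient_left, EuclideanSpace.inner_single_right]
  simp

theorem gradient_eq_zero_iff {n : ℕ} {u : EuclideanSpace ℝ (Fin n) → ℝ}
    {x : EuclideanSpace ℝ (Fin n)} : gradient u x = 0 ↔ fderiv ℝ u x = 0 := by
  simp [gradient]

theorem meanCurv_mul_areaElt_pow_three {u : EuclideanSpace ℝ (Fin 2) → ℝ}
    {x : EuclideanSpace ℝ (Fin 2)} {p : ℂ →L[ℝ] ℝ} {B : ℂ →L[ℝ] ℂ →L[ℝ] ℝ}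
    (hp0 : gradient u x 0 = p 1) (hp1 : gradient u x 1 = p Complex.I)
    (h00 : hessEntry u x 0 0 = B 1 1) (h01 : hessEntry u x 0 1 = B 1 Complex.I)
    (h10 : hessEntry u x 1 0 = B Complex.I 1) (h11 : hessEntry u x 1 1 = B Complex.I Complex.I) :
    meanCurv u x * areaElt p ^ 3 = ellip (perp p) B := by
  have hsq : ‖gradient u x‖ ^ 2 = p 1 ^ 2 + p Complex.I ^ 2 := by
    rw [EuclideanSpace.norm_sq_eq]
    simp [hp0, hp1]
  have hW : areaElt p ^ 2 = 1 + (p 1 ^ 2 + p Complex.I ^ 2) := by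
    rw [areaElt, Real.sq_sqrt (by positivity)]
  have hW0 : areaElt p ≠ 0 := (zero_lt_one.trans_le (one_le_areaElt p)).ne'
  have hsqrt : √(1 + ‖gradient u x‖ ^ 2) = areaElt p := by rw [hsq, areaElt]
  have hperp : perp p = p Complex.I • (1 : ℂ) - p 1 • Complex.I := by
    apply Complex.ext <;> simp [perp]
  simp only [meanCurv, Fin.sum_univ_two, mcCoeff, hsqrt, hp0, hp1, h00, h01, h10, h11, ellip, hperp,
    map_sub, map_smul, sub_apply, smul_apply, smul_eq_mul]
  rw [hsq, ← hW]
  norm_num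
  field_simp
  linear_combination (B 1 1 + B Complex.I Complex.I) * hW

/-- The identification of the complex plane with the Euclidean plane. -/
abbrev planeEquiv : ℂ ≃L[ℝ] EuclideanSpace ℝ (Fin 2) :=
  Complex.orthonormalBasisOneI.repr.toContinuousLinearEquiv

theorem planeEquiv_one : planeEquiv 1 = EuclideanSpace.single 0 1 := by
  ext i; fin_cases i <;> simp

theorem planeEquiv_I : planeEquiv Complex.I = EuclideanSpace.single 1 1 := by
  ext i; fin_cases i <;> simp

theorem fderiv_comp_planeEquiv (u : EuclideanSpace ℝ (Fin 2) → ℝ) (z v : ℂ) :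
    fderiv ℝ (u ∘ planeEquiv) z v = fderiv ℝ u (planeEquiv z) (planeEquiv v) := by
  rw [planeEquiv.comp_right_fderiv]; rfl

theorem fderiv_fderiv_comp_planeEquiv {u : EuclideanSpace ℝ (Fin 2) → ℝ} {z : ℂ}
    (hu : DifferentiableAt ℝ (fderiv ℝ u) (planeEquiv z)) (v w : ℂ) :
    fderiv ℝ (fderiv ℝ (u ∘ planeEquiv)) z v w
      = fderiv ℝ (fderiv ℝ u) (planeEquiv z) (planeEquiv v) (planeEquiv w) := by
  have h1 : fderiv ℝ (u ∘ planeEquiv)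
      = fun z => (fderiv ℝ u (planeEquiv z)).comp (planeEquiv : ℂ →L[ℝ] EuclideanSpace ℝ (Fin 2)) := by
    ext1 z; exact planeEquiv.comp_right_fderiv
  have h2 := (hu.hasFDerivAt.comp z planeEquiv.hasFDerivAt).clm_comp
    (hasFDerivAt_const (planeEquiv : ℂ →L[ℝ] EuclideanSpace ℝ (Fin 2)) z)
  rw [h1]
  erw [h2.fderiv]
  simp

theorem fderiv_comp_planeEquiv_eq_zero_iff {u : EuclideanSpace ℝ (Fin 2) → ℝ} {z : ℂ} :
    fderiv ℝ (u ∘ planeEquiv) z = 0 ↔ fderiv ℝ u (planeEquiv z) = 0 := by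
  refine ⟨fun h => ContinuousLinearMap.ext fun v => ?_, fun h => ContinuousLinearMap.ext fun v => ?_⟩
  · obtain ⟨w, rfl⟩ := planeEquiv.surjective v
    rw [← fderiv_comp_planeEquiv, h]; rfl
  · rw [fderiv_comp_planeEquiv, h]; rfl

theorem isPlanarSolution_comp_planeEquiv {Ω : Set (EuclideanSpace ℝ (Fin 2))}
    (hΩne : Ω.Nonempty) (hΩopen : IsOpen Ω) (hΩbd : Bornology.IsBounded Ω)
    (hΩconv : StrictConvex ℝ (closure Ω)) (hΩsmooth : SmoothPosCurvBoundary Ω)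
    {f : ℝ → ℝ} (hf : AnalyticOnNhd ℝ f Set.univ) (hfmono : Monotone f)
    {u : EuclideanSpace ℝ (Fin 2) → ℝ}
    (hsol : IsMCSolution Ω f u) (hupos : ∀ x ∈ Ω, 0 < u x) (huan : AnalyticOnNhd ℝ u Ω)
    (huC2 : ContDiffOn ℝ 2 u (closure Ω)) :
    IsPlanarSolution (planeEquiv ⁻¹' Ω) f (u ∘ planeEquiv) := by
  have hcl : closure (planeEquiv ⁻¹' Ω) = planeEquiv ⁻¹' closure Ω :=
    (planeEquiv.preimage_closure Ω).symm
  have hfr : frontier (planeEquiv ⁻¹' Ω) = planeEquiv ⁻¹' frontier Ω :=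
    (planeEquiv.toHomeomorph.preimage_frontier Ω).symm
  have hpe : ContDiff ℝ 2 planeEquiv := planeEquiv.contDiff
  refine ⟨hΩne.preimage planeEquiv.surjective, hΩopen.preimage planeEquiv.continuous, ?_, ?_, ?_,
    (contDiff_iff_contDiffAt.2 fun t => (hf t trivial).contDiffAt), hfmono, fun z hz => ?_, ?_, ?_,
    fun z hz => hupos _ hz, fun z hz => ?_⟩
  · exact planeEquiv.antilipschitz.isBounded_preimage hΩbd
  · rw [hcl]
    exact hΩconv.convex.linear_preimage (planeEquiv : ℂ →ₗ[ℝ] EuclideanSpace ℝ (Fin 2))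
  · obtain ⟨T, -, γ, hγ, -, hrange, hreg⟩ := hΩsmooth
    refine ⟨planeEquiv.symm ∘ γ, planeEquiv.symm.contDiff.comp (hγ.of_le (by
        rw [show (2 : WithTop ℕ∞) = ((2 : ℕ∞) : WithTop ℕ∞) from rfl]
        exact WithTop.coe_le_coe.2 le_top)),
      fun t => ?_, ?_⟩
    · have h1 : HasDerivAt (planeEquiv.symm ∘ γ) (planeEquiv.symm (deriv γ t)) t :=
        planeEquiv.symm.hasFDerivAt.comp_hasDerivAt t
          (hγ.differentiable (by simp) t).hasDerivAt
      rw [h1.deriv]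
      exact (map_ne_zero_iff _ planeEquiv.symm.injective).2 (hreg t).1
    · rw [hfr, range_comp, hrange, planeEquiv.image_symm_eq_preimage]
  · exact (huan _ hz).comp ((planeEquiv : ℂ →L[ℝ] EuclideanSpace ℝ (Fin 2)).analyticAt z)
  · rw [hcl]
    exact huC2.comp hpe.contDiffOn fun _ h => h
  · rw [hfr]
    exact fun z hz => hsol.2.2.2 _ hz
  · have hd : DifferentiableAt ℝ (fderiv ℝ u) (planeEquiv z) := (huan _ hz).fderiv.differentiableAt
    rw [show f ((u ∘ planeEquiv) z) = meanCurv u (planeEquiv z) from (hsol.2.2.1 _ hz).symm]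
    refine (meanCurv_mul_areaElt_pow_three ?_ ?_ ?_ ?_ ?_ ?_).symm
    all_goals
      simp only [gradient_apply, hessEntry_eq, fderiv_comp_planeEquiv,
        fderiv_fderiv_comp_planeEquiv hd, planeEquiv_one, planeEquiv_I]

theorem IsPlanarSolution.det_ne_zero {Ω : Set ℂ} {f : ℝ → ℝ} {u : ℂ → ℝ}
    (h : IsPlanarSolution Ω f u) {x : ℂ} (hx : x ∈ Ω) (h0 : fderiv ℝ u x = 0) :
    fderiv ℝ (fderiv ℝ u) x 1 1 * fderiv ℝ (fderiv ℝ u) x Complex.I Complex.I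
      - fderiv ℝ (fderiv ℝ u) x 1 Complex.I * fderiv ℝ (fderiv ℝ u) x Complex.I 1 ≠ 0 := by
  have hneg : ∀ v ≠ 0, fderiv ℝ (fderiv ℝ u) x v v < 0 := fun v hv =>
    h.fderiv_fderiv_neg_of_nonpos hx h0 (h.fderiv_fderiv_nonpos hx h0) hv
  have hsymm := h.fderiv_fderiv_symm hx 1 Complex.I
  set B := fderiv ℝ (fderiv ℝ u) x
  intro hdet
  have h1 := hneg 1 one_ne_zero
  have h2 := hneg (B 1 Complex.I • (1 : ℂ) - B 1 1 • Complex.I) fun h3 => by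
    have := congrArg Complex.im h3
    simp at this
    linarith
  simp only [map_sub, map_smul, sub_apply, smul_apply, smul_eq_mul] at h2
  rw [← hsymm] at h2 hdet
  have h3 : B 1 1 * (B 1 1 * B Complex.I Complex.I - B 1 Complex.I * B 1 Complex.I) = 0 := by
    rw [hdet, mul_zero]
  linarith

/-- For a positive analytic solution of the mean curvature equation with
zero Dirichlet data in a bounded strictly convex smooth planar domain with positive boundary
curvature, `u` has exactly one critical point, and it is nondegenerate. -/
theorem unique_nondegenerate_critical_point_planar
    (Ω : Set (EuclideanSpace ℝ (Fin 2)))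
    (hΩne : Ω.Nonempty) (hΩopen : IsOpen Ω) (hΩbd : Bornology.IsBounded Ω)
    (hΩconv : StrictConvex ℝ (closure Ω)) (hΩsmooth : SmoothPosCurvBoundary Ω)
    (f : ℝ → ℝ) (hf : AnalyticOnNhd ℝ f Set.univ) (hfmono : Monotone f)
    (u : EuclideanSpace ℝ (Fin 2) → ℝ)
    (hsol : IsMCSolution Ω f u) (hupos : ∀ x ∈ Ω, 0 < u x)
    (huan : AnalyticOnNhd ℝ u Ω)
    (huC2 : ContDiffOn ℝ 2 u (closure Ω)) :
    (∃! x₀ : EuclideanSpace ℝ (Fin 2), x₀ ∈ Ω ∧ gradient u x₀ = 0) ∧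
      ∀ x ∈ Ω, gradient u x = 0 → (hessMatrix u x).det ≠ 0 := by
  have h := isPlanarSolution_comp_planeEquiv hΩne hΩopen hΩbd hΩconv hΩsmooth hf hfmono hsol hupos
    huan huC2
  simp only [gradient_eq_zero_iff]
  constructor
  · obtain ⟨z, ⟨hz, hz0⟩, huniq⟩ := h.existsUnique_fderiv_eq_zero
    refine ⟨planeEquiv z, ⟨hz, fderiv_comp_planeEquiv_eq_zero_iff.1 hz0⟩, fun y ⟨hy, hy0⟩ => ?_⟩
    obtain ⟨w, rfl⟩ := planeEquiv.surjective y
    rw [huniq w ⟨hy, fderiv_comp_planeEquiv_eq_zero_iff.2 hy0⟩]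
  · intro x hx hx0
    obtain ⟨z, rfl⟩ := planeEquiv.surjective x
    have hd : DifferentiableAt ℝ (fderiv ℝ u) (planeEquiv z) := (huan _ hx).fderiv.differentiableAt
    have hdet := h.det_ne_zero hx (fderiv_comp_planeEquiv_eq_zero_iff.2 hx0)
    simp only [fderiv_fderiv_comp_planeEquiv hd, planeEquiv_one, planeEquiv_I] at hdet
    simpa only [Matrix.det_fin_two, hessMatrix, Matrix.of_apply, hessEntry_eq] using hdet
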